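/- Let K be a field, A a finite dimensional K-algebra, and θ a stability function on mod A. Then the following conditions are equivalent: (i) T_θ is compact; (ii) T_θ is bicompact; (iii) T_θ is functorially finite; (iv) \bar T_θ is cocompact; (v) \bar T_θ is bicompact; (vi) \bar T_θ is functorially finite. -/

import Mathlib

namespace TorsPaper

variable (A : Type) [Ring A]

/-- `N` is (isomorphic to) a factor module of `M`. -/
def IsQuotientOf (N M : ModuleCat.{0} A) : Prop :=
  ∃ f : M →ₗ[A] N, Function.Surjective f

/-- `L` is (isomorphic to) a submodule of `M`. -/
def IsSubmoduleOf (L M : ModuleCat.{0} A) : Prop :=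
  ∃ f : L →ₗ[A] M, Function.Injective f

/-- `M` is a nonzero module. -/
def Nonzero (M : ModuleCat.{0} A) : Prop := ∃ x : M, x ≠ 0

/-- A torsion class in `mod A`: a class of finitely generated modules, containing the zero
modules, closed under isomorphisms (which follows from `quot`), factor modules and
extensions. -/
structure IsTorsionClass (T : ModuleCat.{0} A → Prop) : Prop where
  fin : ∀ M, T M → Module.Finite A M
  zero : ∀ M : ModuleCat.{0} A, (∀ x : M, x = 0) → T M
  quot : ∀ M N : ModuleCat.{0} A, T M → Module.Finite A N → IsQuotientOf A N M → T N
  ext : ∀ M : ModuleCat.{0} A, Module.Finite A M → ∀ N : Submodule A M,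
    T (ModuleCat.of A N) → T (ModuleCat.of A (M ⧸ N)) → T M

/-- A torsion-free class in `mod A`. -/
structure IsTorsionFreeClass (F : ModuleCat.{0} A → Prop) : Prop where
  fin : ∀ M, F M → Module.Finite A M
  zero : ∀ M : ModuleCat.{0} A, (∀ x : M, x = 0) → F M
  sub : ∀ M N : ModuleCat.{0} A, F M → Module.Finite A N → IsSubmoduleOf A N M → F N
  ext : ∀ M : ModuleCat.{0} A, Module.Finite A M → ∀ N : Submodule A M,
    F (ModuleCat.of A N) → F (ModuleCat.of A (M ⧸ N)) → F M

/-- The right Hom-perpendicular class `T^⊥` inside `mod A`. -/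
def rightPerp (T : ModuleCat.{0} A → Prop) : ModuleCat.{0} A → Prop :=
  fun X => Module.Finite A X ∧ ∀ M : ModuleCat.{0} A, T M → ∀ f : M →ₗ[A] X, f = 0

/-- The smallest torsion class containing a class `S` of modules. -/
def torsClosure (S : ModuleCat.{0} A → Prop) : ModuleCat.{0} A → Prop :=
  fun X => ∀ T : ModuleCat.{0} A → Prop, IsTorsionClass A T → (∀ Y, S Y → T Y) → T X

/-- The smallest torsion-free class containing a class `S` of modules. -/
def torfClosure (S : ModuleCat.{0} A → Prop) : ModuleCat.{0} A → Prop :=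
  fun X => ∀ F : ModuleCat.{0} A → Prop, IsTorsionFreeClass A F → (∀ Y, S Y → F Y) → F X

/-- A torsion class is compact if it is the smallest torsion class containing a single
module `M`. -/
def IsCompactTors (T : ModuleCat.{0} A → Prop) : Prop :=
  ∃ M : ModuleCat.{0} A, Module.Finite A M ∧ T = torsClosure A (fun X => X = M)

/-- A torsion class is cocompact if `T^⊥` is the smallest torsion-free class containing a
single module `N`. -/
def IsCocompactTors (T : ModuleCat.{0} A → Prop) : Prop :=
  ∃ N : ModuleCat.{0} A, Module.Finite A N ∧ rightPerp A T = torfClosure A (fun X => X = N)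

/-- A torsion class is bicompact if it is both compact and cocompact. -/
def IsBicompactTors (T : ModuleCat.{0} A → Prop) : Prop :=
  IsCompactTors A T ∧ IsCocompactTors A T

/-- A class `C` of modules is functorially finite in `mod A` if every finitely generated
module has a left `C`-approximation and a right `C`-approximation. -/
def FunctoriallyFinite (C : ModuleCat.{0} A → Prop) : Prop :=
  (∀ M : ModuleCat.{0} A, Module.Finite A M →
    ∃ (X : ModuleCat.{0} A) (f : M →ₗ[A] X), C X ∧
      ∀ Y : ModuleCat.{0} A, C Y → ∀ g : M →ₗ[A] Y, ∃ h : X →ₗ[A] Y, h.comp f = g) ∧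
  (∀ M : ModuleCat.{0} A, Module.Finite A M →
    ∃ (X : ModuleCat.{0} A) (f : X →ₗ[A] M), C X ∧
      ∀ Y : ModuleCat.{0} A, C Y → ∀ g : Y →ₗ[A] M, ∃ h : Y →ₗ[A] X, f.comp h = g)

/-- A stability function: a real-valued function on `mod A` which is additive on short
exact sequences. -/
def IsStability (θ : ModuleCat.{0} A → ℝ) : Prop :=
  ∀ L M N : ModuleCat.{0} A, Module.Finite A L → Module.Finite A M → Module.Finite A N →
    ∀ (f : L →ₗ[A] M) (g : M →ₗ[A] N), Function.Injective f → Function.Surjective g →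
      LinearMap.range f = LinearMap.ker g → θ M = θ L + θ N

/-- The semistable torsion class `T_θ`. -/
def tTheta (θ : ModuleCat.{0} A → ℝ) : ModuleCat.{0} A → Prop :=
  fun M => Module.Finite A M ∧ ∀ N : ModuleCat.{0} A, Module.Finite A N →
    IsQuotientOf A N M → Nonzero A N → 0 < θ N

/-- The semistable torsion class `\bar T_θ`. -/
def tThetaBar (θ : ModuleCat.{0} A → ℝ) : ModuleCat.{0} A → Prop :=
  fun M => Module.Finite A M ∧ ∀ N : ModuleCat.{0} A, Module.Finite A N →
    IsQuotientOf A N M → 0 ≤ θ N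

/-- The semistable torsion-free class `F_θ`. -/
def fTheta (θ : ModuleCat.{0} A → ℝ) : ModuleCat.{0} A → Prop :=
  fun M => Module.Finite A M ∧ ∀ L : ModuleCat.{0} A, Module.Finite A L →
    IsSubmoduleOf A L M → Nonzero A L → θ L < 0

/-- The semistable torsion-free class `\bar F_θ`. -/
def fThetaBar (θ : ModuleCat.{0} A → ℝ) : ModuleCat.{0} A → Prop :=
  fun M => Module.Finite A M ∧ ∀ L : ModuleCat.{0} A, Module.Finite A L →
    IsSubmoduleOf A L M → θ L ≤ 0

/-- An integer-valued function on `mod A` additive on short exact sequences; these are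
exactly the group homomorphisms `K0(mod A) → ℤ`. -/
def IsAdditiveZ (φ : ModuleCat.{0} A → ℤ) : Prop :=
  ∀ L M N : ModuleCat.{0} A, Module.Finite A L → Module.Finite A M → Module.Finite A N →
    ∀ (f : L →ₗ[A] M) (g : M →ₗ[A] N), Function.Injective f → Function.Surjective g →
      LinearMap.range f = LinearMap.ker g → φ M = φ L + φ N

/-- `[X] = [Y]` in the Grothendieck group `K0(mod A)`: since `K0(mod A)` is free abelian
on the simple modules, this holds iff all additive `ℤ`-valued functions agree on `X`, `Y`. -/
def SameK0Class (X Y : ModuleCat.{0} A) : Prop :=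
  ∀ φ : ModuleCat.{0} A → ℤ, IsAdditiveZ A φ → φ X = φ Y

/-- Two classes of modules are numerically disjoint if they contain no nonzero `X`, `Y`
with `[X] = [Y] ≠ 0` in `K0(mod A)`. -/
def NumericallyDisjoint (C D : ModuleCat.{0} A → Prop) : Prop :=
  ¬ ∃ X Y : ModuleCat.{0} A, C X ∧ D Y ∧ Nonzero A X ∧ Nonzero A Y ∧ SameK0Class A X Y

/-- A brick: a finitely generated module whose endomorphism algebra is a division algebra,
i.e. `M` is nonzero and every nonzero endomorphism is invertible. -/
def IsBrick (M : ModuleCat.{0} A) : Prop :=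
  Module.Finite A M ∧ Nonzero A M ∧ ∀ f : M →ₗ[A] M, f ≠ 0 → Function.Bijective f

/-- A semibrick: a set of pairwise Hom-orthogonal bricks. -/
def IsSemibrick (S : Set (ModuleCat.{0} A)) : Prop :=
  (∀ M ∈ S, IsBrick A M) ∧
    ∀ M ∈ S, ∀ N ∈ S, M ≠ N → ∀ f : M →ₗ[A] N, f = 0



section Aux1
set_option linter.all false
set_option linter.unusedSectionVars false
set_option linter.style.haveILetI false
variable {A}
variable [IsNoetherianRing A] [IsArtinianRing A]
variable {T : ModuleCat.{0} A → Prop}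
variable {X Y Z : Type} [AddCommGroup X] [Module A X] [AddCommGroup Y] [Module A Y]
  [AddCommGroup Z] [Module A Z]

theorem tors_fin (hT : IsTorsionClass A T) (h : T (ModuleCat.of A X)) : Module.Finite A X :=
  hT.fin _ h

theorem tors_surj (hT : IsTorsionClass A T) (h : T (ModuleCat.of A X)) (f : X →ₗ[A] Y)
    (hf : Function.Surjective f) : T (ModuleCat.of A Y) := by
  haveI : Module.Finite A X := tors_fin hT h
  haveI : Module.Finite A Y := Module.Finite.of_surjective f hf
  exact hT.quot (ModuleCat.of A X) (ModuleCat.of A Y) h this ⟨f, hf⟩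

theorem tors_equiv (hT : IsTorsionClass A T) (h : T (ModuleCat.of A X)) (f : X ≃ₗ[A] Y) :
    T (ModuleCat.of A Y) := tors_surj hT h f.toLinearMap f.surjective

theorem tors_sub (hT : IsTorsionClass A T) (N : Submodule A X)
    (h1 : T (ModuleCat.of A N)) (h2 : T (ModuleCat.of A (X ⧸ N))) : T (ModuleCat.of A X) := by
  haveI : Module.Finite A N := tors_fin hT h1
  haveI : Module.Finite A (X ⧸ N) := tors_fin hT h2
  haveI : Module.Finite A X := Module.Finite.of_submodule_quotient N
  exact hT.ext (ModuleCat.of A X) this N h1 h2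

theorem tors_range (hT : IsTorsionClass A T) (h : T (ModuleCat.of A X)) (f : X →ₗ[A] Y) :
    T (ModuleCat.of A (LinearMap.range f)) :=
  tors_surj hT h f.rangeRestrict f.surjective_rangeRestrict

/-- middle term of an exact sequence `X → Y → Z → 0`. -/
theorem tors_exact (hT : IsTorsionClass A T) (f : X →ₗ[A] Y) (g : Y →ₗ[A] Z)
    (hg : Function.Surjective g) (hfg : LinearMap.ker g ≤ LinearMap.range f)
    (h1 : T (ModuleCat.of A X)) (h2 : T (ModuleCat.of A Z)) : T (ModuleCat.of A Y) := by
  refine tors_sub hT (LinearMap.range f) (tors_range hT h1 f) ?_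
  refine tors_surj hT h2 ((Submodule.mapQ _ (LinearMap.range f) LinearMap.id
    (by simpa using hfg)).comp (g.quotKerEquivOfSurjective hg).symm.toLinearMap) ?_
  rw [LinearMap.coe_comp]
  refine Function.Surjective.comp ?_ (LinearEquiv.surjective _)
  intro y
  obtain ⟨y, rfl⟩ := Submodule.Quotient.mk_surjective _ y
  exact ⟨Submodule.Quotient.mk y, by simp⟩

theorem tors_subsingleton (hT : IsTorsionClass A T) [Subsingleton X] : T (ModuleCat.of A X) :=
  hT.zero _ (fun x => Subsingleton.elim (α := X) x 0)

theorem tors_prod (hT : IsTorsionClass A T) (h1 : T (ModuleCat.of A X))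
    (h2 : T (ModuleCat.of A Y)) : T (ModuleCat.of A (X × Y)) := by
  refine tors_exact hT (LinearMap.inl A X Y) (LinearMap.snd A X Y) Prod.snd_surjective ?_ h1 h2
  rintro ⟨a, b⟩ h
  simp only [LinearMap.mem_ker, LinearMap.snd_apply] at h
  exact ⟨a, by simp [h]⟩

theorem tors_pi (hT : IsTorsionClass A T) (h1 : T (ModuleCat.of A X)) (n : ℕ) :
    T (ModuleCat.of A (Fin n → X)) := by
  induction n with
  | zero => exact tors_subsingleton hT
  | succ n ih =>
    refine tors_surj hT (tors_prod hT h1 ih)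
      (Fin.consLinearEquiv A (fun _ : Fin (n+1) => X)).toLinearMap (LinearEquiv.surjective _)

theorem tors_sup (hT : IsTorsionClass A T) (N M : Submodule A X)
    (h1 : T (ModuleCat.of A N)) (h2 : T (ModuleCat.of A M)) :
    T (ModuleCat.of A (N ⊔ M : Submodule A X)) := by
  have h := tors_range hT (tors_prod hT h1 h2) (N.subtype.coprod M.subtype)
  rw [LinearMap.range_coprod, Submodule.range_subtype, Submodule.range_subtype] at h
  exact h

/-- the torsion part -/
theorem exists_tors (hT : IsTorsionClass A T) (X : Type) [AddCommGroup X] [Module A X]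
    [Module.Finite A X] : ∃ t : Submodule A X, T (ModuleCat.of A t) ∧
      (∀ s : Submodule A X, T (ModuleCat.of A s) → s ≤ t) ∧
      rightPerp A T (ModuleCat.of A (X ⧸ t)) := by
  obtain ⟨t, ht, hmax⟩ := WellFounded.has_min (wellFounded_gt (α := Submodule A X))
    {s | T (ModuleCat.of A s)} ⟨⊥, tors_subsingleton hT⟩
  have hle : ∀ s : Submodule A X, T (ModuleCat.of A s) → s ≤ t := by
    intro s hs
    have h2 := hmax (t ⊔ s) (tors_sup hT t s ht hs)
    have : t ⊔ s = t := by
      by_contra hne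
      exact h2 (lt_of_le_of_ne le_sup_left (Ne.symm hne))
    exact this ▸ le_sup_right
  refine ⟨t, ht, hle, (inferInstance : Module.Finite A (X ⧸ t)), ?_⟩
  intro M hM f
  have hr : T (ModuleCat.of A (LinearMap.range f)) := tors_range (X := M) hT hM f
  have hle' := hle ((LinearMap.range f).comap t.mkQ) (by
    refine tors_exact hT (Submodule.inclusion (p := t) (p' := (LinearMap.range f).comap t.mkQ)
      (by
        intro x hx
        have h0 : t.mkQ x = 0 := by simpa using hx
        simp only [Submodule.mem_comap, h0]
        exact Submodule.zero_mem _)) (t.mkQ.restrict (p := (LinearMap.range f).comap t.mkQ)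
        (q := LinearMap.range f) (fun x hx => hx)) ?_ ?_ ht hr
    · rintro ⟨y, hy⟩
      obtain ⟨x, rfl⟩ := t.mkQ_surjective y
      exact ⟨⟨x, hy⟩, rfl⟩
    · rintro ⟨x, hx⟩ h
      have h' : t.mkQ x = 0 := congrArg Subtype.val (LinearMap.mem_ker.1 h)
      have : x ∈ t := by simpa using h'
      exact ⟨⟨x, this⟩, rfl⟩)
  ext m
  obtain ⟨x, hx⟩ := t.mkQ_surjective (f m)
  have hx' : x ∈ t := hle' (show t.mkQ x ∈ LinearMap.range f by rw [hx]; exact ⟨m, rfl⟩)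
  rw [← hx]
  simpa using hx'

theorem perp_fin (h : rightPerp A T (ModuleCat.of A Y)) : Module.Finite A Y := h.1

theorem perp_hom (h : rightPerp A T (ModuleCat.of A Y)) (hX : T (ModuleCat.of A X))
    (f : X →ₗ[A] Y) : f = 0 := h.2 (ModuleCat.of A X) hX f

theorem perp_inj (h : rightPerp A T (ModuleCat.of A Y)) (f : X →ₗ[A] Y)
    (hf : Function.Injective f) : rightPerp A T (ModuleCat.of A X) := by
  haveI : Module.Finite A Y := perp_fin h
  refine ⟨Module.Finite.of_injective f hf, ?_⟩
  intro M hM g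
  have := perp_hom (X := M) h hM (f.comp g)
  ext m
  have h2 := LinearMap.congr_fun this m
  exact hf (by simpa using h2)

theorem perp_sub (h : rightPerp A T (ModuleCat.of A Y)) (N : Submodule A Y) :
    rightPerp A T (ModuleCat.of A N) := perp_inj h N.subtype N.injective_subtype

theorem perp_of_ker (f : X →ₗ[A] Y) (h : rightPerp A T (ModuleCat.of A Y))
    (hk : rightPerp A T (ModuleCat.of A (LinearMap.ker f))) (hfin : Module.Finite A X) :
    rightPerp A T (ModuleCat.of A X) := by
  refine ⟨hfin, ?_⟩
  intro M hM g
  have h0 := perp_hom (X := M) h hM (f.comp g)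
  have h1 := perp_hom (X := M) hk hM (g.codRestrict (LinearMap.ker f)
    (fun m => LinearMap.congr_fun h0 m))
  ext m
  exact congrArg Subtype.val (LinearMap.congr_fun h1 m)

theorem perp_ext (N : Submodule A X) (h1 : rightPerp A T (ModuleCat.of A N))
    (h2 : rightPerp A T (ModuleCat.of A (X ⧸ N))) : rightPerp A T (ModuleCat.of A X) := by
  haveI : Module.Finite A N := perp_fin h1
  haveI : Module.Finite A (X ⧸ N) := perp_fin h2
  refine perp_of_ker N.mkQ h2 ?_ (Module.Finite.of_submodule_quotient N)
  rw [Submodule.ker_mkQ]; exact h1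

theorem perp_torf : IsTorsionFreeClass A (rightPerp A T) where
  fin M h := h.1
  zero M h := by
    haveI : Subsingleton M := ⟨fun a b => by rw [h a, h b]⟩
    refine ⟨Module.Finite.of_finite, fun N _ f => ?_⟩
    ext m; exact h _
  sub M N h _ hs := by
    obtain ⟨f, hf⟩ := hs
    exact perp_inj (Y := M) (X := N) h f hf
  ext M _ N h1 h2 := perp_ext (X := M) N h1 h2

/-- an object with no nonzero map to the perp class is torsion -/
theorem tors_of_hom_perp (hT : IsTorsionClass A T) [Module.Finite A X]
    (h : ∀ (Y : Type) [AddCommGroup Y] [Module A Y], rightPerp A T (ModuleCat.of A Y) →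
      ∀ f : X →ₗ[A] Y, f = 0) : T (ModuleCat.of A X) := by
  obtain ⟨t, ht, -, hp⟩ := exists_tors hT X
  have h0 := h (X ⧸ t) hp t.mkQ
  have : t = ⊤ := by
    rw [← t.ker_mkQ, h0, LinearMap.ker_zero]
  subst this
  exact tors_equiv hT ht Submodule.topEquiv

theorem tors_perp_zero (h : T (ModuleCat.of A X)) (h2 : rightPerp A T (ModuleCat.of A X)) :
    Subsingleton X := by
  have h0 := perp_hom h2 h (LinearMap.id)
  refine ⟨fun a b => ?_⟩
  have ha := LinearMap.congr_fun h0 a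
  have hb := LinearMap.congr_fun h0 b
  simp only [LinearMap.id_apply, LinearMap.zero_apply] at ha hb
  rw [ha, hb]

theorem perp_subsingleton [Subsingleton X] : rightPerp A T (ModuleCat.of A X) :=
  perp_torf.zero _ (fun x => Subsingleton.elim (α := X) x 0)

end Aux1

section Aux2
set_option linter.all false
set_option linter.unusedSectionVars false
set_option linter.style.haveILetI false
variable {A}
variable [IsNoetherianRing A] [IsArtinianRing A]
variable {T : ModuleCat.{0} A → Prop}
variable {X Y Z : Type} [AddCommGroup X] [Module A X] [AddCommGroup Y] [Module A Y]
  [AddCommGroup Z] [Module A Z]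
variable (K : Type) [Field K] [Algebra K A] [FiniteDimensional K A]

/-- `K`-dimension of an `A`-module. -/
noncomputable def dm (X : ModuleCat.{0} A) : ℕ :=
  @Module.finrank K X _ _ (Module.compHom X (algebraMap K A))

theorem dm_eq [Module K X] [IsScalarTower K A X] :
    dm K (ModuleCat.of A X) = Module.finrank K X := by
  unfold dm
  congr 1
  refine Module.ext' _ _ ?_
  intro r x
  show (algebraMap K A r) • x = r • x
  rw [algebraMap_smul]

/-- the `K`-structure on an `A`-module -/
@[reducible] noncomputable def kmod (A : Type) [Ring A] [Algebra K A] (X : Type) [AddCommGroup X]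
    [Module A X] : Module K X :=
  Module.compHom X (algebraMap K A)

theorem kmod_tower (A : Type) [Ring A] [Algebra K A] (X : Type) [AddCommGroup X] [Module A X] :
    @IsScalarTower K A X _ _ (kmod K A X).toSMul := by
  letI := kmod K A X
  exact IsScalarTower.of_algebraMap_smul (fun r x => rfl)

theorem kfin [Module.Finite A X] [Module K X] [IsScalarTower K A X] : Module.Finite K X :=
  Module.Finite.trans A X

theorem dm_stab : IsStability A (fun X => (dm K X : ℝ)) := by
  intro L M N hL hM hN f g hf hg hfg
  letI := kmod K A L
  haveI := kmod_tower K A L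
  letI := kmod K A M
  haveI := kmod_tower K A M
  letI := kmod K A N
  haveI := kmod_tower K A N
  haveI : Module.Finite K M := kfin (A := A) K
  haveI : Module.Finite K L := kfin (A := A) K
  have e1 : dm K L = Module.finrank K L := dm_eq (X := L) K
  have e2 : dm K M = Module.finrank K M := dm_eq (X := M) K
  have e3 : dm K N = Module.finrank K N := dm_eq (X := N) K
  simp only [e1, e2, e3]
  have h1 := (g.restrictScalars K).finrank_range_add_finrank_ker
  have h2 := LinearMap.finrank_range_of_inj (f := f.restrictScalars K) hf
  have h3 : LinearMap.range (f.restrictScalars K) = LinearMap.ker (g.restrictScalars K) := by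
    ext x
    exact SetLike.ext_iff.1 hfg x
  have h4 : LinearMap.range (g.restrictScalars K) = ⊤ := LinearMap.range_eq_top.2 hg
  rw [← h3, h2, h4, finrank_top] at h1
  rw [← h1]; push_cast; ring

variable {θ : ModuleCat.{0} A → ℝ}

theorem th_add (hθ : IsStability A θ) [Module.Finite A X] (N : Submodule A X) :
    θ (ModuleCat.of A X) = θ (ModuleCat.of A N) + θ (ModuleCat.of A (X ⧸ N)) :=
  hθ (ModuleCat.of A N) (ModuleCat.of A X) (ModuleCat.of A (X ⧸ N))
    (inferInstance : Module.Finite A N) (inferInstance : Module.Finite A X)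
    (inferInstance : Module.Finite A (X ⧸ N)) N.subtype N.mkQ N.injective_subtype
    N.mkQ_surjective (by simp)

theorem th_sub (hθ : IsStability A θ) [Subsingleton X] : θ (ModuleCat.of A X) = 0 := by
  haveI : Module.Finite A X := inferInstance
  have := hθ (ModuleCat.of A X) (ModuleCat.of A X) (ModuleCat.of A X) ‹_› ‹_› ‹_›
    (LinearMap.id (M := X)) (LinearMap.id (M := X)) (fun _ _ h => h) (fun x => ⟨x, rfl⟩) (by
      ext x; simp [Subsingleton.elim (α := X) x 0])
  linarith

theorem th_equiv (hθ : IsStability A θ) [Module.Finite A X] (e : X ≃ₗ[A] Y) :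
    θ (ModuleCat.of A X) = θ (ModuleCat.of A Y) := by
  haveI : Module.Finite A Y := Module.Finite.equiv e
  have := hθ (ModuleCat.of A X) (ModuleCat.of A Y) (ModuleCat.of A PUnit) ‹_› ‹_›
    (inferInstance : Module.Finite A PUnit)
    (e : X →ₗ[A] Y) (0 : Y →ₗ[A] PUnit) e.injective (fun x => ⟨0, rfl⟩) (by
      rw [LinearMap.ker_zero]; exact LinearEquiv.range e)
  rw [this, th_sub (X := PUnit) hθ, add_zero]

theorem th_surj (hθ : IsStability A θ) [Module.Finite A X] (f : X →ₗ[A] Y)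
    (hf : Function.Surjective f) :
    θ (ModuleCat.of A X) = θ (ModuleCat.of A (LinearMap.ker f)) + θ (ModuleCat.of A Y) := by
  rw [th_add hθ (LinearMap.ker f), th_equiv hθ (f.quotKerEquivOfSurjective hf)]

theorem stab_comb (hθ : IsStability A θ) (c : ℝ) :
    IsStability A (fun X => θ X + c * dm K X) := by
  intro L M N hL hM hN f g hf hg hfg
  have h1 := hθ L M N hL hM hN f g hf hg hfg
  have h2 := dm_stab K L M N hL hM hN f g hf hg hfg
  simp only at h2 ⊢
  rw [h1, h2]; ring

theorem dm_add [Module.Finite A X] (N : Submodule A X) :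
    dm K (ModuleCat.of A X) = dm K (ModuleCat.of A N) + dm K (ModuleCat.of A (X ⧸ N)) := by
  exact_mod_cast th_add (dm_stab K) N

theorem dm_surj [Module.Finite A X] (f : X →ₗ[A] Y) (hf : Function.Surjective f) :
    dm K (ModuleCat.of A X) = dm K (ModuleCat.of A (LinearMap.ker f)) + dm K (ModuleCat.of A Y) := by
  exact_mod_cast th_surj (dm_stab K) f hf

theorem dm_equiv [Module.Finite A X] (e : X ≃ₗ[A] Y) :
    dm K (ModuleCat.of A X) = dm K (ModuleCat.of A Y) := by
  exact_mod_cast th_equiv (dm_stab K) e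

theorem dm_zero [Subsingleton X] : dm K (ModuleCat.of A X) = 0 := by
  exact_mod_cast th_sub (X := X) (dm_stab (A := A) K)

theorem dm_pos [Module.Finite A X] [Nontrivial X] : 0 < dm K (ModuleCat.of A X) := by
  letI := kmod K A X
  haveI := kmod_tower K A X
  haveI : Module.Finite K X := kfin (A := A) K
  rw [dm_eq]
  exact Module.finrank_pos

theorem dm_sub_lt [Module.Finite A X] {N : Submodule A X} (h : N ≠ ⊤) :
    dm K (ModuleCat.of A N) < dm K (ModuleCat.of A X) := by
  rw [dm_add K N]
  haveI : Nontrivial (X ⧸ N) := Submodule.Quotient.nontrivial_iff.2 h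
  have := dm_pos (A := A) (X := X ⧸ N) K
  omega

theorem dm_quot_lt [Module.Finite A X] {N : Submodule A X} (h : N ≠ ⊥) :
    dm K (ModuleCat.of A (X ⧸ N)) < dm K (ModuleCat.of A X) := by
  rw [dm_add K N]
  haveI : Nontrivial N := Submodule.nontrivial_iff_ne_bot.2 h
  have := dm_pos (A := A) (X := N) K
  omega

theorem dm_sub_le [Module.Finite A X] (N : Submodule A X) :
    dm K (ModuleCat.of A N) ≤ dm K (ModuleCat.of A X) := by
  rw [dm_add K N]; omega

theorem dm_quot_le [Module.Finite A X] (N : Submodule A X) :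
    dm K (ModuleCat.of A (X ⧸ N)) ≤ dm K (ModuleCat.of A X) := by
  rw [dm_add K N]; omega

theorem not_nonzero (h : ¬ Nonzero A (ModuleCat.of A X)) : Subsingleton X := by
  unfold Nonzero at h
  push Not at h
  exact ⟨fun a b => (h a).trans (h b).symm⟩

theorem nonzero_of [Nontrivial X] : Nonzero A (ModuleCat.of A X) := by
  exact exists_ne (0 : X)

theorem nontrivial_of (h : Nonzero A (ModuleCat.of A X)) : Nontrivial X := by
  obtain ⟨x, hx⟩ := h
  exact ⟨⟨x, 0, hx⟩⟩

theorem tTheta_iff [Module.Finite A X] : tTheta A θ (ModuleCat.of A X) ↔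
    ∀ (N : Type) [AddCommGroup N] [Module A N] (f : X →ₗ[A] N), Function.Surjective f →
      Nontrivial N → 0 < θ (ModuleCat.of A N) := by
  constructor
  · intro h N _ _ f hf hN
    haveI : Module.Finite A N := Module.Finite.of_surjective f hf
    exact h.2 (ModuleCat.of A N) this ⟨f, hf⟩ nonzero_of
  · intro h
    refine ⟨‹_›, ?_⟩
    rintro N hN ⟨f, hf⟩ hn
    exact h N f hf (nontrivial_of (X := N) hn)

theorem tThetaBar_iff [Module.Finite A X] : tThetaBar A θ (ModuleCat.of A X) ↔
    ∀ (N : Type) [AddCommGroup N] [Module A N] (f : X →ₗ[A] N), Function.Surjective f →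
      0 ≤ θ (ModuleCat.of A N) := by
  constructor
  · intro h N _ _ f hf
    haveI : Module.Finite A N := Module.Finite.of_surjective f hf
    exact h.2 (ModuleCat.of A N) this ⟨f, hf⟩
  · intro h
    refine ⟨‹_›, ?_⟩
    rintro N hN ⟨f, hf⟩
    exact h N f hf

/-- splitting a quotient of an extension -/
theorem quot_split (hθ : IsStability A θ) [Module.Finite A X] (N : Submodule A X) (f : X →ₗ[A] Y)
    (hf : Function.Surjective f) : ∃ (S : Submodule A Y) (p : N →ₗ[A] S) (q : (X ⧸ N) →ₗ[A] (Y ⧸ S)),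
    Function.Surjective p ∧ Function.Surjective q ∧
    θ (ModuleCat.of A Y) = θ (ModuleCat.of A S) + θ (ModuleCat.of A (Y ⧸ S)) := by
  haveI : Module.Finite A Y := Module.Finite.of_surjective f hf
  refine ⟨N.map f, f.submoduleMap N, Submodule.mapQ _ _ f (Submodule.le_comap_map f N),
    f.submoduleMap_surjective N, ?_, th_add hθ _⟩
  intro y
  obtain ⟨y, rfl⟩ := Submodule.Quotient.mk_surjective _ y
  obtain ⟨x, rfl⟩ := hf y
  exact ⟨Submodule.Quotient.mk x, rfl⟩

theorem tThetaBar_tors (hθ : IsStability A θ) : IsTorsionClass A (tThetaBar A θ) where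
  fin M h := h.1
  zero M h := by
    haveI : Subsingleton M := ⟨fun a b => by rw [h a, h b]⟩
    refine (tThetaBar_iff (X := M)).2 ?_
    intro N _ _ f hf
    haveI : Subsingleton N := hf.subsingleton
    rw [th_sub hθ]
  quot M N h hN hq := by
    obtain ⟨f, hf⟩ := hq
    refine ⟨hN, ?_⟩
    rintro N' h' ⟨g, hg⟩
    exact h.2 N' h' ⟨g.comp f, hg.comp hf⟩
  ext M hM N h1 h2 := by
    refine (tThetaBar_iff (X := M)).2 ?_
    intro Y _ _ f hf
    obtain ⟨S, p, q, hp, hq, e⟩ := quot_split hθ N f hf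
    rw [e]
    exact add_nonneg (tThetaBar_iff.1 h1 _ p hp) (tThetaBar_iff.1 h2 _ q hq)

theorem tTheta_tors (hθ : IsStability A θ) : IsTorsionClass A (tTheta A θ) where
  fin M h := h.1
  zero M h := by
    haveI : Subsingleton M := ⟨fun a b => by rw [h a, h b]⟩
    refine (tTheta_iff (X := M)).2 ?_
    intro N _ _ f hf hN
    haveI : Subsingleton N := hf.subsingleton
    exact absurd hN (not_nontrivial N)
  quot M N h hN hq := by
    obtain ⟨f, hf⟩ := hq
    refine ⟨hN, ?_⟩
    rintro N' h' ⟨g, hg⟩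
    exact h.2 N' h' ⟨g.comp f, hg.comp hf⟩
  ext M hM N h1 h2 := by
    refine (tTheta_iff (X := M)).2 ?_
    intro Y _ _ f hf hY
    haveI : Module.Finite A Y := Module.Finite.of_surjective f hf
    obtain ⟨S, p, q, hp, hq, e⟩ := quot_split hθ N f hf
    rw [e]
    have a1 := tTheta_iff.1 h1 _ p hp
    have a2 := tTheta_iff.1 h2 _ q hq
    rcases subsingleton_or_nontrivial S with hS | hS
    · rw [th_sub (X := S) hθ, zero_add]
      refine a2 (Submodule.Quotient.nontrivial_iff.2 ?_)
      rintro rfl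
      have : Subsingleton Y := (Submodule.topEquiv (R := A) (M := Y)).symm.toEquiv.subsingleton
      exact absurd hY (not_nontrivial Y)
    · rcases subsingleton_or_nontrivial (Y ⧸ S) with hS' | hS'
      · rw [th_sub (X := Y ⧸ S) hθ, add_zero]; exact a1 hS
      · exact add_pos (a1 hS) (a2 hS')

theorem tTheta_le (hθ : IsStability A θ) {X : ModuleCat.{0} A} (h : tTheta A θ X) :
    tThetaBar A θ X := by
  refine ⟨h.1, fun N hN hq => ?_⟩
  by_cases hz : Nonzero A N
  · exact (h.2 N hN hq hz).le
  · haveI := not_nonzero (X := N) hz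
    exact (th_sub (X := N) hθ).ge

/-- Elements of the perp of `T_θ` have `θ ≤ 0`. -/
theorem perp_tTheta_le (hθ : IsStability A θ) (n : ℕ) : ∀ (Y : Type) [AddCommGroup Y] [Module A Y]
    [Module.Finite A Y], dm K (ModuleCat.of A Y) = n → rightPerp A (tTheta A θ) (ModuleCat.of A Y) →
      θ (ModuleCat.of A Y) ≤ 0 := by
  induction n using Nat.strong_induction_on with
  | _ n ih =>
    intro Y _ _ _ hn hY
    by_contra hpos
    push Not at hpos
    by_cases hT : tTheta A θ (ModuleCat.of A Y)
    · haveI := tors_perp_zero hT hY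
      rw [th_sub (X := Y) hθ] at hpos
      exact lt_irrefl _ hpos
    · rw [tTheta_iff] at hT
      push Not at hT
      obtain ⟨N, _, _, f, hf, hN, hle⟩ := hT
      have e := th_surj hθ f hf
      have hk : LinearMap.ker f ≠ ⊤ := by
        intro h
        rw [LinearMap.ker_eq_top] at h
        subst h
        obtain ⟨x, hx⟩ := exists_ne (0 : N)
        obtain ⟨y, rfl⟩ := hf x
        exact hx rfl
      have := ih _ (hn ▸ dm_sub_lt K hk) (LinearMap.ker f) rfl (perp_sub hY _)
      linarith

theorem perp_tThetaBar_lt (hθ : IsStability A θ) (n : ℕ) : ∀ (Y : Type) [AddCommGroup Y] [Module A Y]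
    [Module.Finite A Y], dm K (ModuleCat.of A Y) = n →
      rightPerp A (tThetaBar A θ) (ModuleCat.of A Y) → Nontrivial Y →
      θ (ModuleCat.of A Y) < 0 := by
  induction n using Nat.strong_induction_on with
  | _ n ih =>
    intro Y _ _ _ hn hY hnt
    by_contra hpos
    push Not at hpos
    by_cases hT : tThetaBar A θ (ModuleCat.of A Y)
    · haveI := tors_perp_zero hT hY
      exact not_nontrivial Y hnt
    · rw [tThetaBar_iff] at hT
      push Not at hT
      obtain ⟨N, _, _, f, hf, hle⟩ := hT
      have e := th_surj hθ f hf
      have hk : LinearMap.ker f ≠ ⊤ := by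
        intro h
        rw [LinearMap.ker_eq_top] at h
        subst h
        haveI : Subsingleton N := ⟨fun a b => by
          obtain ⟨a, rfl⟩ := hf a
          obtain ⟨b, rfl⟩ := hf b
          rfl⟩
        rw [th_sub (X := N) hθ] at hle
        exact lt_irrefl _ hle
      rcases subsingleton_or_nontrivial (LinearMap.ker f) with hS | hS
      · rw [th_sub (X := LinearMap.ker f) hθ] at e
        linarith
      · have := ih _ (hn ▸ dm_sub_lt K hk) (LinearMap.ker f) rfl (perp_sub hY _) hS
        linarith

theorem fTheta_perp (hθ : IsStability A θ) {Y : ModuleCat.{0} A} (h : fTheta A θ Y) :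
    rightPerp A (tThetaBar A θ) Y := by
  refine ⟨h.1, fun M hM f => ?_⟩
  have hf1 : Module.Finite A M := hM.1
  have hf2 : Module.Finite A Y := h.1
  by_contra hne
  have h1 := (tThetaBar_iff (X := M)).1 hM (LinearMap.range f) f.rangeRestrict
    f.surjective_rangeRestrict
  have h2 := h.2 (ModuleCat.of A (LinearMap.range f))
    (inferInstance : Module.Finite A (LinearMap.range f)) ⟨(LinearMap.range f).subtype,
      Submodule.injective_subtype _⟩ (by
      haveI : Nontrivial (LinearMap.range f) := by
        rw [Submodule.nontrivial_iff_ne_bot]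
        rwa [Ne, LinearMap.range_eq_bot]
      exact nonzero_of)
  linarith

theorem fThetaBar_torf (hθ : IsStability A θ) : IsTorsionFreeClass A (fThetaBar A θ) where
  fin M h := h.1
  zero M h := by
    haveI : Subsingleton M := ⟨fun a b => by rw [h a, h b]⟩
    refine ⟨inferInstance, ?_⟩
    rintro N _ ⟨f, hf⟩
    haveI : Subsingleton N := hf.subsingleton
    exact (th_sub (X := N) hθ).le
  sub M N h hN hq := by
    obtain ⟨f, hf⟩ := hq
    refine ⟨hN, ?_⟩
    rintro N' h' ⟨g, hg⟩
    exact h.2 N' h' ⟨f.comp g, hf.comp hg⟩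
  ext M hM N h1 h2 := by
    refine ⟨hM, ?_⟩
    rintro L hL ⟨f, hf⟩
    have e := th_add (X := L) hθ (N.comap f)
    have a1 := h1.2 (ModuleCat.of A (N.comap f)) (inferInstance : Module.Finite A (N.comap f))
      ⟨f.restrict (p := N.comap f) (q := N) (fun x hx => hx), by
        intro a b hab
        have : f a = f b := congrArg Subtype.val hab
        exact Subtype.ext (hf this)⟩
    have a2 := h2.2 (ModuleCat.of A (L ⧸ N.comap f))
      (inferInstance : Module.Finite A (L ⧸ N.comap f))
      ⟨Submodule.mapQ (N.comap f) N f le_rfl, by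
        rw [← LinearMap.ker_eq_bot, Submodule.mapQ, Submodule.ker_liftQ]
        rw [LinearMap.ker_comp, Submodule.ker_mkQ, Submodule.mkQ_map_self]⟩
    have e' : θ L = _ := e
    rw [e']
    exact add_nonpos a1 a2

end Aux2

section Aux3
set_option linter.all false
set_option linter.unusedSectionVars false
set_option linter.style.haveILetI false
variable {A}
variable [IsNoetherianRing A] [IsArtinianRing A]
variable {T : ModuleCat.{0} A → Prop}
variable {X Y Z : Type} [AddCommGroup X] [Module A X] [AddCommGroup Y] [Module A Y]
  [AddCommGroup Z] [Module A Z]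
variable (K : Type) [Field K] [Algebra K A] [FiniteDimensional K A]
variable {θ : ModuleCat.{0} A → ℝ}

theorem simple_surj {S : Type} [AddCommGroup S] [Module A S] [IsSimpleModule A S] (f : X →ₗ[A] S)
    (hf : f ≠ 0) : Function.Surjective f := by
  rw [← LinearMap.range_eq_top]
  rcases eq_bot_or_eq_top (LinearMap.range f) with h | h
  · exact absurd (LinearMap.range_eq_bot.1 h) hf
  · exact h

theorem exists_coatom_simple [Module.Finite A X] [Nontrivial X] :
    ∃ N : Submodule A X, N ≠ ⊤ ∧ IsSimpleModule A (X ⧸ N) := by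
  obtain ⟨N, hN⟩ := IsCoatomic.exists_coatom (α := Submodule A X)
  exact ⟨N, hN.1, isSimpleModule_iff_isCoatom.2 hN⟩

theorem exists_simple_sub [Module.Finite A X] [Nontrivial X] :
    ∃ N : Submodule A X, N ≠ ⊥ ∧ IsSimpleModule A N := by
  obtain ⟨N, hN⟩ := IsAtomic.exists_atom (α := Submodule A X)
  exact ⟨N, hN.1, isSimpleModule_iff_isAtom.2 hN⟩

theorem simples_aux (n : ℕ) : ∀ (X : Type) [AddCommGroup X] [Module A X]
    [Module.Finite A X], dm K (ModuleCat.of A X) = n →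
    ∃ L : Finset (Ideal A), (∀ I ∈ L, I.IsMaximal) ∧
      ∀ (S : Type) [AddCommGroup S] [Module A S] [IsSimpleModule A S] (f : X →ₗ[A] S), f ≠ 0 →
        ∃ I ∈ L, Nonempty (S ≃ₗ[A] A ⧸ I) := by
  classical
  induction n using Nat.strong_induction_on with
  | _ n ih =>
    intro X _ _ _ hn
    rcases subsingleton_or_nontrivial X with hX | hX
    · refine ⟨∅, by simp, ?_⟩
      intro S _ _ _ f hf
      refine absurd ?_ hf
      ext x
      rw [Subsingleton.elim x 0, map_zero, map_zero]
    · obtain ⟨N, hN, hs⟩ := exists_coatom_simple (A := A) (X := X)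
      obtain ⟨L, hL, hL2⟩ := ih _ (hn ▸ dm_sub_lt K hN) N rfl
      obtain ⟨I, hI, ⟨e⟩⟩ := isSimpleModule_iff_quot_maximal.1 hs
      refine ⟨insert I L, ?_, ?_⟩
      · intro I' hI'
        rcases Finset.mem_insert.1 hI' with h | h
        · rw [h]; exact hI
        · exact hL _ h
      · intro S _ _ _ f hf
        by_cases h : f.comp N.subtype = 0
        · have hle : N ≤ LinearMap.ker f := by
            intro x hx
            exact LinearMap.congr_fun h ⟨x, hx⟩
          have hg : N.liftQ f hle ≠ 0 := by
            intro h0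
            apply hf
            rw [← N.liftQ_mkQ f hle, h0, LinearMap.zero_comp]
          have hb := LinearMap.bijective_of_ne_zero hg
          exact ⟨I, Finset.mem_insert_self _ _, ⟨(LinearEquiv.ofBijective _ hb).symm.trans e⟩⟩
        · obtain ⟨I', h1, h2⟩ := hL2 S _ h
          exact ⟨I', Finset.mem_insert_of_mem h1, h2⟩

/-- There are finitely many simple modules. -/
theorem simples_finite (A : Type) [Ring A] [Algebra K A] [FiniteDimensional K A]
    [IsNoetherianRing A] [IsArtinianRing A] : ∃ L : Finset (Ideal A), (∀ I ∈ L, I.IsMaximal) ∧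
      ∀ (S : Type) [AddCommGroup S] [Module A S] [IsSimpleModule A S],
        ∃ I ∈ L, Nonempty (S ≃ₗ[A] A ⧸ I) := by
  obtain ⟨L, hL, h⟩ := simples_aux (A := A) K _ A rfl
  refine ⟨L, hL, ?_⟩
  intro S _ _ _
  haveI := IsSimpleModule.nontrivial A S
  obtain ⟨s, hs⟩ := exists_ne (0 : S)
  refine h S (LinearMap.toSpanSingleton A S s) ?_
  intro h0
  apply hs
  have := LinearMap.congr_fun h0 1
  simpa using this

theorem simple_finite_module {S : Type} [AddCommGroup S] [Module A S] [IsSimpleModule A S] :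
    Module.Finite A S := inferInstance

theorem simple_values (K : Type) [Field K] [Algebra K A] [FiniteDimensional K A] (hθ : IsStability A θ) : ∃ s : Finset ℝ,
    ∀ (S : Type) [AddCommGroup S] [Module A S] [IsSimpleModule A S], θ (ModuleCat.of A S) ∈ s := by
  classical
  obtain ⟨L, -, h⟩ := simples_finite K A
  refine ⟨L.image (fun I => θ (ModuleCat.of A (A ⧸ I))), ?_⟩
  intro S _ _ _
  obtain ⟨I, hI, ⟨e⟩⟩ := h S
  rw [th_equiv hθ e]
  exact Finset.mem_image_of_mem _ hI

theorem simple_bound (K : Type) [Field K] [Algebra K A] [FiniteDimensional K A] (hθ : IsStability A θ) : ∃ b : ℝ, 0 ≤ b ∧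
    ∀ (S : Type) [AddCommGroup S] [Module A S] [IsSimpleModule A S], |θ (ModuleCat.of A S)| ≤ b := by
  obtain ⟨s, hs⟩ := simple_values K hθ
  refine ⟨∑ v ∈ s, |v|, Finset.sum_nonneg (fun _ _ => abs_nonneg _), ?_⟩
  intro S _ _ _
  exact Finset.single_le_sum (f := fun v => |v|) (fun _ _ => abs_nonneg _) (hs S)

open scoped Pointwise in
theorem finite_values (hθ : IsStability A θ) (n : ℕ) : ∃ s : Set ℝ, s.Finite ∧
    ∀ (X : Type) [AddCommGroup X] [Module A X] [Module.Finite A X],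
      dm K (ModuleCat.of A X) ≤ n → θ (ModuleCat.of A X) ∈ s := by
  obtain ⟨s0, hs0⟩ := simple_values K hθ
  induction n with
  | zero =>
    refine ⟨{0}, Set.finite_singleton _, ?_⟩
    intro X _ _ _ h
    rcases subsingleton_or_nontrivial X with hX | hX
    · exact th_sub hθ
    · have := dm_pos (A := A) (X := X) K
      omega
  | succ n ih =>
    obtain ⟨s, hs, h⟩ := ih
    refine ⟨{0} ∪ (s + (s0 : Set ℝ)), (Set.finite_singleton _).union (hs.add s0.finite_toSet), ?_⟩
    intro X _ _ _ hX
    rcases subsingleton_or_nontrivial X with hX' | hX'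
    · left; exact th_sub hθ
    · right
      obtain ⟨N, hN, hN2⟩ := exists_coatom_simple (A := A) (X := X)
      rw [th_add hθ N]
      have := dm_sub_lt K hN
      exact Set.add_mem_add (h N (by omega)) (hs0 _)

theorem finite_pos_bound (s : Set ℝ) (hs : s.Finite) : ∃ c : ℝ, 0 < c ∧ ∀ v ∈ s, 0 < v → c ≤ v := by
  induction s, hs using Set.Finite.induction_on with
  | empty => exact ⟨1, one_pos, by simp⟩
  | insert _ _ ih =>
    rename_i a s _ _
    obtain ⟨c, hc, h⟩ := ih
    by_cases ha : 0 < a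
    · refine ⟨min a c, lt_min ha hc, ?_⟩
      rintro v (rfl | hv) hpos
      · exact min_le_left _ _
      · exact (min_le_right _ _).trans (h v hv hpos)
    · refine ⟨c, hc, ?_⟩
      rintro v (rfl | hv) hpos
      · exact absurd hpos ha
      · exact h v hv hpos

theorem neg_stab (hθ : IsStability A θ) : IsStability A (fun X => - θ X) := by
  intro L M N hL hM hN f g hf hg hfg
  simp only [hθ L M N hL hM hN f g hf hg hfg]; ring

/-- uniform positivity on small modules -/
theorem small_margin (hθ : IsStability A θ) (n : ℕ) : ∃ c : ℝ, 0 < c ∧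
    ∀ (X : Type) [AddCommGroup X] [Module A X] [Module.Finite A X],
      dm K (ModuleCat.of A X) ≤ n → 0 < θ (ModuleCat.of A X) →
      c * dm K (ModuleCat.of A X) ≤ θ (ModuleCat.of A X) := by
  obtain ⟨s, hs, h⟩ := finite_values K hθ n
  obtain ⟨c, hc, h2⟩ := finite_pos_bound s hs
  refine ⟨c / (n + 1), by positivity, ?_⟩
  intro X _ _ _ hX hpos
  refine le_trans ?_ (h2 _ (h X hX) hpos)
  rw [div_mul_eq_mul_div, div_le_iff₀ (by positivity)]
  have : (dm K (ModuleCat.of A X) : ℝ) ≤ n := by exact_mod_cast hX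
  nlinarith

def MarginT (K : Type) [Field K] [Algebra K A] (θ : ModuleCat.{0} A → ℝ) : Prop :=
  ∃ c : ℝ, 0 < c ∧ ∀ X : ModuleCat.{0} A, tTheta A θ X → c * dm K X ≤ θ X

def MarginF (K : Type) [Field K] [Algebra K A] (θ : ModuleCat.{0} A → ℝ) : Prop :=
  ∃ c : ℝ, 0 < c ∧ ∀ X : ModuleCat.{0} A, rightPerp A (tThetaBar A θ) X → θ X ≤ - (c * dm K X)

theorem compact_margin (hθ : IsStability A θ) (h : IsCompactTors A (tTheta A θ)) : MarginT K θ := by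
  obtain ⟨M, hM, e⟩ := h
  have hMT : tTheta A θ M := by
    rw [e]; intro T hT h; exact h _ rfl
  obtain ⟨c, hc, h⟩ := small_margin K hθ (dm K M)
  refine ⟨c, hc, ?_⟩
  intro X hX
  have hX' := hX
  rw [e] at hX'
  have := hX' _ (tThetaBar_tors (stab_comb K hθ (-c))) (by
    intro Z hZ
    rw [hZ]
    refine (tThetaBar_iff (X := M)).2 ?_
    intro N _ _ f hf
    haveI : Module.Finite A N := Module.Finite.of_surjective f hf
    rcases subsingleton_or_nontrivial N with hN | hN
    · rw [th_sub (X := N) hθ, dm_zero]; simp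
    · have h1 := h N (by
        have := dm_surj K f hf
        have e : dm K M = _ := this
        omega) ((tTheta_iff (X := M)).1 hMT N f hf hN)
      linarith)
  have hfX := hX.1
  have h2 := (tThetaBar_iff (X := X)).1 this X LinearMap.id (fun x => ⟨x, rfl⟩)
  have h3 : 0 ≤ θ X + -c * dm K X := h2
  linarith

theorem cocompact_margin (hθ : IsStability A θ) (h : IsCocompactTors A (tThetaBar A θ)) :
    MarginF K θ := by
  obtain ⟨M, hM, e⟩ := h
  have hMT : rightPerp A (tThetaBar A θ) M := by
    rw [e]; intro T hT h; exact h _ rfl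
  obtain ⟨c, hc, h⟩ := small_margin K (neg_stab hθ) (dm K M)
  refine ⟨c, hc, ?_⟩
  intro X hX
  have hX' := hX
  rw [e] at hX'
  have := hX' _ (fThetaBar_torf (stab_comb K hθ c)) (by
    intro Z hZ
    rw [hZ]
    refine ⟨hM, ?_⟩
    rintro L hL ⟨f, hf⟩
    have hp : rightPerp A (tThetaBar A θ) (ModuleCat.of A L) := perp_inj (X := L) (Y := M) hMT f hf
    rcases subsingleton_or_nontrivial L with hN | hN
    · have e1 := th_sub (X := L) hθ
      have e2 := dm_zero (A := A) (X := L) K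
      have e3 : θ L = 0 := e1
      have e4 : dm K L = 0 := e2
      simp [e3, e4]
    · have h1 := h L (by
        have := dm_sub_le K (LinearMap.range f)
        have e : _ = dm K (ModuleCat.of A (LinearMap.range f)) :=
          dm_equiv K (LinearEquiv.ofInjective f hf)
        rw [e]; exact this) (by
          have := perp_tThetaBar_lt K hθ _ L rfl hp hN
          exact neg_pos.2 this)
      have h2 : c * dm K L ≤ - θ L := h1
      linarith)
  have h3 := this.2 X hX.1 ⟨LinearMap.id, fun _ _ h => h⟩
  linarith

end Aux3

section Aux4
set_option linter.all false
set_option linter.unusedSectionVars false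
set_option linter.style.haveILetI false
variable {A}
variable [IsNoetherianRing A] [IsArtinianRing A]
variable {T : ModuleCat.{0} A → Prop}
variable {X Y Z : Type} [AddCommGroup X] [Module A X] [AddCommGroup Y] [Module A Y]
  [AddCommGroup Z] [Module A Z]
variable (K : Type) [Field K] [Algebra K A] [FiniteDimensional K A]
variable {θ : ModuleCat.{0} A → ℝ}

/-- Projective covers -/
theorem proj_cover (K : Type) [Field K] [Algebra K A] [FiniteDimensional K A]
    (X : Type) [AddCommGroup X] [Module A X] [Module.Finite A X] :
    ∃ (P : Type) (_ : AddCommGroup P) (_ : Module A P) (π : P →ₗ[A] X), Module.Finite A P ∧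
      Module.Projective A P ∧ Function.Surjective π ∧
      ∀ L : Submodule A P, L ⊔ LinearMap.ker π = ⊤ → L = ⊤ := by
  classical
  have hex : ∃ n : ℕ, ∃ (P : Type) (_ : AddCommGroup P) (_ : Module A P) (π : P →ₗ[A] X),
      Module.Finite A P ∧ Module.Projective A P ∧ Function.Surjective π ∧
      dm K (ModuleCat.of A P) = n := by
    obtain ⟨n, f, hf⟩ := Module.Finite.exists_fin' A X
    exact ⟨_, Fin n → A, inferInstance, inferInstance, f, inferInstance, inferInstance, hf, rfl⟩
  obtain ⟨P, _, _, π, hfin, hproj, hπ, hn⟩ := Nat.find_spec hex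
  refine ⟨P, _, _, π, hfin, hproj, hπ, ?_⟩
  intro L hL
  have hs : Function.Surjective (π.comp L.subtype) := by
    intro x
    obtain ⟨p, rfl⟩ := hπ x
    have : p ∈ L ⊔ LinearMap.ker π := by rw [hL]; trivial
    obtain ⟨l, hl, k, hk, rfl⟩ := Submodule.mem_sup.1 this
    exact ⟨⟨l, hl⟩, by simp [LinearMap.mem_ker.1 hk]⟩
  obtain ⟨h, hh⟩ := Module.projective_lifting_property (π.comp L.subtype) π hs
  set α : Module.End A P := L.subtype.comp h with hα
  have hπα : π.comp α = π := hh
  have hpow : ∀ n : ℕ, π.comp (α ^ n) = π := by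
    intro n
    induction n with
    | zero => rfl
    | succ n ih =>
      rw [pow_succ, Module.End.mul_eq_comp, ← LinearMap.comp_assoc, ih, hπα]
  haveI : IsArtinian A P := inferInstance
  obtain ⟨n, hn1⟩ := Filter.eventually_atTop.1 (LinearMap.eventually_isCompl_ker_pow_range_pow α)
  have hc := hn1 (n + 1) (Nat.le_succ n)
  set R := LinearMap.range (α ^ (n + 1)) with hR
  have hRs : Function.Surjective (π.comp R.subtype) := by
    intro x
    obtain ⟨p, rfl⟩ := hπ x
    exact ⟨⟨(α ^ (n+1)) p, ⟨p, rfl⟩⟩, LinearMap.congr_fun (hpow (n+1)) p⟩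
  haveI : Module.Projective A R := Module.Projective.of_split R.subtype
    (Submodule.projectionOnto R (LinearMap.ker (α ^ (n+1))) hc.symm) (by
      ext x
      simp)
  have hle := Nat.find_min' hex ⟨R, _, _, π.comp R.subtype, inferInstance, this, hRs, rfl⟩
  rw [← hn] at hle
  have hRtop : R = ⊤ := by
    by_contra hne
    have := dm_sub_lt K hne
    omega
  rw [eq_top_iff, ← hRtop]
  rintro _ ⟨p, rfl⟩
  rw [pow_succ']
  exact (h _).2

theorem pc_simple {P S S' : Type} [AddCommGroup P] [Module A P] [AddCommGroup S] [Module A S]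
    [AddCommGroup S'] [Module A S'] [IsSimpleModule A S] [IsSimpleModule A S']
    (π : P →ₗ[A] S) (hπ : Function.Surjective π)
    (hsup : ∀ L : Submodule A P, L ⊔ LinearMap.ker π = ⊤ → L = ⊤) (g : P →ₗ[A] S') (hg : g ≠ 0) :
    Nonempty (S' ≃ₗ[A] S) := by
  have hgs := simple_surj g hg
  have hco : IsCoatom (LinearMap.ker g) := by
    rw [← isSimpleModule_iff_isCoatom]
    exact IsSimpleModule.congr (g.quotKerEquivOfSurjective hgs)
  by_cases hle : LinearMap.ker π ≤ LinearMap.ker g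
  · have hco2 : IsCoatom (LinearMap.ker π) := by
      rw [← isSimpleModule_iff_isCoatom]
      exact IsSimpleModule.congr (π.quotKerEquivOfSurjective hπ)
    have he : LinearMap.ker π = LinearMap.ker g := by
      rcases hle.eq_or_lt with h | h
      · exact h
      · exact absurd (hco2.2 _ h) hco.1
    exact ⟨(g.quotKerEquivOfSurjective hgs).symm.trans
      ((Submodule.quotEquivOfEq _ _ he.symm).trans (π.quotKerEquivOfSurjective hπ))⟩
  · exfalso
    apply hco.1
    apply hsup
    apply hco.2
    refine lt_of_le_of_ne le_sup_left ?_
    intro h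
    exact hle (h ▸ le_sup_right)

/-- Hom dimension -/
noncomputable def hd (P : Type) [AddCommGroup P] [Module A P] (X : ModuleCat.{0} A) : ℕ :=
  letI := kmod K A X
  haveI := kmod_tower K A X
  Module.finrank K (P →ₗ[A] X)

variable {P Q : Type} [AddCommGroup P] [Module A P] [AddCommGroup Q] [Module A Q]

theorem hd_eq [Module K X] [IsScalarTower K A X] :
    hd K P (ModuleCat.of A X) = Module.finrank K (P →ₗ[A] X) := by
  have : (‹Module K X› : Module K X) = kmod K A X := by
    refine Module.ext' _ _ ?_
    intro r x
    show r • x = (algebraMap K A r) • x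
    rw [algebraMap_smul]
  subst this
  rfl

theorem hom_fin [Module.Finite A P] [Module.Finite A X] [Module K X] [IsScalarTower K A X] :
    Module.Finite K (P →ₗ[A] X) := by
  letI := kmod K A P
  haveI := kmod_tower K A P
  haveI : Module.Finite K P := kfin (A := A) K
  haveI : Module.Finite K X := kfin (A := A) K
  exact Module.Finite.of_injective (LinearMap.restrictScalarsₗ K A P X K)
    (LinearMap.restrictScalars_injective K)

theorem hd_le [Module.Finite A P] [Module.Finite A X] :
    hd K P (ModuleCat.of A X) ≤ dm K (ModuleCat.of A P) * dm K (ModuleCat.of A X) := by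
  letI := kmod K A P
  haveI := kmod_tower K A P
  letI := kmod K A X
  haveI := kmod_tower K A X
  haveI : Module.Finite K P := kfin (A := A) K
  haveI : Module.Finite K X := kfin (A := A) K
  rw [hd_eq, dm_eq, dm_eq, ← Module.finrank_linearMap K K P X]
  exact LinearMap.finrank_le_finrank_of_injective (f := LinearMap.restrictScalarsₗ K A P X K)
    (LinearMap.restrictScalars_injective K)

/-- postcomposition as a `K`-linear map -/
def postc [Module K X] [IsScalarTower K A X] [Module K Y] [IsScalarTower K A Y]
    (P : Type) [AddCommGroup P] [Module A P] (g : X →ₗ[A] Y) : (P →ₗ[A] X) →ₗ[K] (P →ₗ[A] Y) where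
  toFun h := g.comp h
  map_add' a b := by ext; simp
  map_smul' a b := by
    ext p
    simp only [LinearMap.comp_apply, LinearMap.smul_apply, RingHom.id_apply]
    exact (g.restrictScalars K).map_smul a (b p)

theorem hd_stab [Module.Finite A P] [Module.Projective A P] :
    IsStability A (fun X => (hd K P X : ℝ)) := by
  intro L M N hL hM hN f g hf hg hfg
  letI := kmod K A L
  haveI := kmod_tower K A L
  letI := kmod K A M
  haveI := kmod_tower K A M
  letI := kmod K A N
  haveI := kmod_tower K A N
  haveI : Module.Finite K (P →ₗ[A] M) := hom_fin (A := A) K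
  haveI : Module.Finite K (P →ₗ[A] L) := hom_fin (A := A) K
  have e1 : hd K P L = Module.finrank K (P →ₗ[A] L) := hd_eq (X := L) K
  have e2 : hd K P M = Module.finrank K (P →ₗ[A] M) := hd_eq (X := M) K
  have e3 : hd K P N = Module.finrank K (P →ₗ[A] N) := hd_eq (X := N) K
  simp only [e1, e2, e3]
  have h1 := (postc K P g).finrank_range_add_finrank_ker
  have h2 := LinearMap.finrank_range_of_inj (f := postc K P f) (by
    intro a b hab
    ext p
    exact hf (LinearMap.congr_fun hab p))
  have h3 : LinearMap.range (postc K P f) = LinearMap.ker (postc K P g) := by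
    ext h
    constructor
    · rintro ⟨h, rfl⟩
      ext p
      have : f (h p) ∈ LinearMap.ker g := by rw [← hfg]; exact ⟨_, rfl⟩
      exact this
    · intro hh
      have hr : ∀ p, h p ∈ LinearMap.range f := by
        intro p
        rw [hfg]
        exact LinearMap.congr_fun hh p
      refine ⟨(LinearEquiv.ofInjective f hf).symm.toLinearMap.comp
        (h.codRestrict (LinearMap.range f) hr), ?_⟩
      ext p
      have := (LinearEquiv.ofInjective f hf).apply_symm_apply ⟨h p, hr p⟩
      exact congrArg Subtype.val this
  have h4 : LinearMap.range (postc K P g) = ⊤ := by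
    rw [LinearMap.range_eq_top]
    intro h
    obtain ⟨u, hu⟩ := Module.projective_lifting_property g h hg
    exact ⟨u, hu⟩
  rw [← h3, h2, h4, finrank_top] at h1
  rw [← h1]; push_cast; ring

theorem hd_prod [Module.Finite A P] [Module.Finite A Q] [Module.Finite A X] :
    hd K (P × Q) (ModuleCat.of A X) = hd K P (ModuleCat.of A X) + hd K Q (ModuleCat.of A X) := by
  letI := kmod K A X
  haveI := kmod_tower K A X
  haveI : Module.Finite K (P →ₗ[A] X) := hom_fin (A := A) K
  haveI : Module.Finite K (Q →ₗ[A] X) := hom_fin (A := A) K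
  rw [hd_eq, hd_eq, hd_eq, ← Module.finrank_prod]
  exact (LinearMap.coprodEquiv (M := P) (M₂ := Q) (M₃ := X) (R := A) K).finrank_eq.symm

theorem hd_punit : hd K PUnit (ModuleCat.of A X) = 0 := by
  letI := kmod K A X
  haveI := kmod_tower K A X
  rw [hd_eq]
  haveI : Subsingleton (PUnit →ₗ[A] X) := ⟨fun a b =>
    LinearMap.ext (fun x => by rw [Subsingleton.elim x 0, map_zero, map_zero])⟩
  exact Module.finrank_zero_of_subsingleton

theorem hd_pow [Module.Finite A P] [Module.Projective A P] (n : ℕ) :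
    ∃ (R : Type) (_ : AddCommGroup R) (_ : Module A R), Module.Finite A R ∧ Module.Projective A R ∧
      ∀ (X : Type) [AddCommGroup X] [Module A X] [Module.Finite A X],
        hd K R (ModuleCat.of A X) = n * hd K P (ModuleCat.of A X) := by
  induction n with
  | zero =>
    refine ⟨PUnit, inferInstance, inferInstance, inferInstance, inferInstance, ?_⟩
    intro X _ _ _
    rw [hd_punit, zero_mul]
  | succ n ih =>
    obtain ⟨R, _, _, hf, hp, h⟩ := ih
    refine ⟨R × P, inferInstance, inferInstance, inferInstance, inferInstance, ?_⟩
    intro X _ _ _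
    rw [hd_prod, h]; ring

/-- approximability by differences of Hom dimensions from projectives -/
def Approx (φ : ModuleCat.{0} A → ℝ) : Prop :=
  ∃ B : ℝ, ∀ N : ℕ, ∃ (P : Type) (_ : AddCommGroup P) (_ : Module A P)
    (Q : Type) (_ : AddCommGroup Q) (_ : Module A Q), Module.Finite A P ∧ Module.Projective A P ∧
    Module.Finite A Q ∧ Module.Projective A Q ∧
    ∀ (X : Type) [AddCommGroup X] [Module A X] [Module.Finite A X],
      |(hd K P (ModuleCat.of A X) : ℝ) - hd K Q (ModuleCat.of A X) - N * φ (ModuleCat.of A X)|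
        ≤ B * dm K (ModuleCat.of A X)

theorem approx_zero : Approx (A := A) K (fun _ => 0) := by
  refine ⟨0, fun N => ⟨PUnit, inferInstance, inferInstance, PUnit, inferInstance, inferInstance,
    inferInstance, inferInstance, inferInstance, inferInstance, ?_⟩⟩
  intro X _ _ _
  simp

theorem approx_add {φ ψ : ModuleCat.{0} A → ℝ} (h1 : Approx K φ) (h2 : Approx K ψ) :
    Approx K (fun X => φ X + ψ X) := by
  obtain ⟨B, h1⟩ := h1
  obtain ⟨B', h2⟩ := h2
  refine ⟨B + B', fun N => ?_⟩
  obtain ⟨P, _, _, Q, _, _, _, _, _, _, h⟩ := h1 N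
  obtain ⟨P', _, _, Q', _, _, _, _, _, _, h'⟩ := h2 N
  refine ⟨P × P', inferInstance, inferInstance, Q × Q', inferInstance, inferInstance,
    inferInstance, inferInstance, inferInstance, inferInstance, ?_⟩
  intro X _ _ _
  rw [hd_prod, hd_prod]
  have a := h X
  have b := h' X
  have := (abs_add_le _ _).trans (add_le_add a b)
  refine le_trans (le_of_eq ?_) (this.trans (le_of_eq ?_))
  · push_cast; congr 1; ring
  · ring

theorem approx_hd [Module.Finite A P] [Module.Projective A P] (c : ℝ) :
    Approx (A := A) K (fun X => c * hd K P X) := by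
  refine ⟨dm K (ModuleCat.of A P), fun N => ?_⟩
  obtain ⟨R, _, _, _, _, hR⟩ := hd_pow K (A := A) (P := P) (⌊N * c⌋.toNat)
  obtain ⟨S, _, _, _, _, hS⟩ := hd_pow K (A := A) (P := P) ((-⌊N * c⌋).toNat)
  refine ⟨R, inferInstance, inferInstance, S, inferInstance, inferInstance,
    inferInstance, inferInstance, inferInstance, inferInstance, ?_⟩
  intro X _ _ _
  rw [hR, hS]
  have e : ((⌊N * c⌋.toNat : ℕ) : ℝ) - ((-⌊N * c⌋).toNat : ℕ) = (⌊N * c⌋ : ℝ) := by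
    have := Int.toNat_sub_toNat_neg ⌊N * c⌋
    exact_mod_cast this
  have hle : (hd K P (ModuleCat.of A X) : ℝ) ≤
    dm K (ModuleCat.of A P) * dm K (ModuleCat.of A X) := by exact_mod_cast hd_le K
  have h0 : (0 : ℝ) ≤ hd K P (ModuleCat.of A X) := by positivity
  have e2 : (((⌊N * c⌋.toNat * hd K P (ModuleCat.of A X) : ℕ) : ℝ)
      - (((-⌊N * c⌋).toNat * hd K P (ModuleCat.of A X) : ℕ) : ℝ) -
      N * (c * hd K P (ModuleCat.of A X))) = - ((N * c - ⌊N * c⌋) * hd K P (ModuleCat.of A X)) := by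
    rw [← e]; push_cast; ring
  rw [e2, abs_neg, abs_mul, abs_of_nonneg h0]
  have h3 : |(N * c - ⌊N * c⌋ : ℝ)| ≤ 1 := by
    rw [abs_le]
    constructor <;> linarith [Int.floor_le ((N : ℝ) * c), Int.lt_floor_add_one ((N : ℝ) * c)]
  exact (mul_le_of_le_one_left h0 h3).trans hle

theorem add_stab {φ ψ : ModuleCat.{0} A → ℝ} (h1 : IsStability A φ) (h2 : IsStability A ψ) :
    IsStability A (fun X => φ X + ψ X) := by
  intro L M N hL hM hN f g hf hg hfg
  simp only [h1 L M N hL hM hN f g hf hg hfg, h2 L M N hL hM hN f g hf hg hfg]; ring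

theorem mul_stab {φ : ModuleCat.{0} A → ℝ} (h1 : IsStability A φ) (c : ℝ) :
    IsStability A (fun X => c * φ X) := by
  intro L M N hL hM hN f g hf hg hfg
  simp only [h1 L M N hL hM hN f g hf hg hfg]; ring

theorem approx_list (hθ : IsStability A θ) (L : Finset (Ideal A)) (hL : ∀ I ∈ L, I.IsMaximal) :
    ∃ φ : ModuleCat.{0} A → ℝ, IsStability A φ ∧ Approx K φ ∧
      (∀ I ∈ L, φ (ModuleCat.of A (A ⧸ I)) = θ (ModuleCat.of A (A ⧸ I))) ∧
      (∀ (S : Type) [AddCommGroup S] [Module A S] [IsSimpleModule A S],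
        (∀ I ∈ L, IsEmpty (S ≃ₗ[A] A ⧸ I)) → φ (ModuleCat.of A S) = 0) := by
  classical
  induction L using Finset.induction_on with
  | empty =>
    exact ⟨fun _ => 0, by intro; simp, approx_zero K, by simp, by simp⟩
  | insert I L hI ih =>
    obtain ⟨φ, hφ, ha, h1, h2⟩ := ih (fun J hJ => hL J (Finset.mem_insert_of_mem hJ))
    haveI hIm := hL I (Finset.mem_insert_self _ _)
    haveI hIs : IsSimpleModule A (A ⧸ I) :=
      isSimpleModule_iff_quot_maximal.2 ⟨I, hIm, ⟨LinearEquiv.refl _ _⟩⟩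
    by_cases hex : ∃ J ∈ L, Nonempty ((A ⧸ I) ≃ₗ[A] A ⧸ J)
    · obtain ⟨J, hJ, ⟨e⟩⟩ := hex
      refine ⟨φ, hφ, ha, ?_, ?_⟩
      · intro I' hI'
        rcases Finset.mem_insert.1 hI' with rfl | h
        · rw [th_equiv hφ e, th_equiv hθ e, h1 J hJ]
        · exact h1 _ h
      · intro S _ _ _ hS
        exact h2 S (fun J hJ => hS J (Finset.mem_insert_of_mem hJ))
    · push Not at hex
      obtain ⟨P, _, _, π, hPf, hPp, hπ, hsup⟩ := proj_cover (A := A) K (A ⧸ I)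
      have hpos : 0 < hd K P (ModuleCat.of A (A ⧸ I)) := by
        letI := kmod K A (A ⧸ I)
        haveI := kmod_tower K A (A ⧸ I)
        haveI : Module.Finite K (P →ₗ[A] (A ⧸ I)) := hom_fin (A := A) K
        haveI : Nontrivial (P →ₗ[A] (A ⧸ I)) := by
          refine ⟨⟨π, 0, ?_⟩⟩
          rintro rfl
          haveI := IsSimpleModule.nontrivial A (A ⧸ I)
          obtain ⟨x, hx⟩ := exists_ne (0 : A ⧸ I)
          obtain ⟨y, rfl⟩ := hπ x
          exact hx rfl
        rw [hd_eq]
        exact Module.finrank_pos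
      have hz : ∀ (S : Type) [AddCommGroup S] [Module A S] [IsSimpleModule A S],
          IsEmpty (S ≃ₗ[A] A ⧸ I) → hd K P (ModuleCat.of A S) = 0 := by
        intro S _ _ _ hS
        letI := kmod K A S
        haveI := kmod_tower K A S
        rw [hd_eq]
        haveI : Subsingleton (P →ₗ[A] S) := by
          have h0 : ∀ g : P →ₗ[A] S, g = 0 := by
            intro g
            by_contra hg
            obtain ⟨e⟩ := pc_simple π hπ hsup g hg
            exact hS.false e
          exact ⟨fun a b => (h0 a).trans (h0 b).symm⟩
        exact Module.finrank_zero_of_subsingleton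
      refine ⟨fun X => φ X + (θ (ModuleCat.of A (A ⧸ I)) / hd K P (ModuleCat.of A (A ⧸ I)))
        * hd K P X, add_stab hφ (mul_stab (hd_stab K) _), approx_add K ha (approx_hd K _), ?_, ?_⟩
      · intro I' hI'
        rcases Finset.mem_insert.1 hI' with rfl | h
        · have h3 : φ (ModuleCat.of A (A ⧸ I')) = 0 := h2 (A ⧸ I') hex
          have : (hd K P (ModuleCat.of A (A ⧸ I')) : ℝ) ≠ 0 := by positivity
          simp only [h3]
          field_simp
          ring
        · haveI hIs : IsSimpleModule A (A ⧸ I') :=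
            isSimpleModule_iff_quot_maximal.2
              ⟨I', hL I' (Finset.mem_insert_of_mem h), ⟨LinearEquiv.refl _ _⟩⟩
          have h3 : hd K P (ModuleCat.of A (A ⧸ I')) = 0 :=
            hz (A ⧸ I') ⟨fun e => (hex I' h).false e.symm⟩
          simp [h3, h1 I' h]
      · intro S _ _ _ hS
        have h3 : hd K P (ModuleCat.of A S) = 0 := hz S (hS I (Finset.mem_insert_self _ _))
        have h4 : φ (ModuleCat.of A S) = 0 := h2 S (fun J hJ => hS J (Finset.mem_insert_of_mem hJ))
        simp [h3, h4]

theorem stab_ext {φ : ModuleCat.{0} A → ℝ} (K : Type) [Field K] [Algebra K A]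
    [FiniteDimensional K A] (hφ : IsStability A φ) (hθ : IsStability A θ)
    (h : ∀ (S : Type) [AddCommGroup S] [Module A S] [IsSimpleModule A S],
      φ (ModuleCat.of A S) = θ (ModuleCat.of A S)) (n : ℕ) :
    ∀ (X : Type) [AddCommGroup X] [Module A X] [Module.Finite A X], dm K (ModuleCat.of A X) = n →
      φ (ModuleCat.of A X) = θ (ModuleCat.of A X) := by
  induction n using Nat.strong_induction_on with
  | _ n ih =>
    intro X _ _ _ hn
    rcases subsingleton_or_nontrivial X with hX | hX
    · rw [th_sub hφ, th_sub hθ]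
    · obtain ⟨N, hN, hs⟩ := exists_coatom_simple (A := A) (X := X)
      rw [th_add hφ N, th_add hθ N, ih _ (hn ▸ dm_sub_lt K hN) N rfl, h]

theorem approx_stab (hθ : IsStability A θ) : Approx K θ := by
  obtain ⟨L, hL, h⟩ := simples_finite K A
  obtain ⟨φ, hφ, ⟨B, ha⟩, h1, -⟩ := approx_list K hθ L hL
  refine ⟨B, fun N => ?_⟩
  obtain ⟨P, _, _, Q, _, _, a1, a2, a3, a4, h'⟩ := ha N
  refine ⟨P, _, _, Q, _, _, a1, a2, a3, a4, ?_⟩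
  intro X _ _ _
  rw [← stab_ext K hφ hθ ?_ _ X rfl]
  · exact h' X
  · intro S _ _ _
    obtain ⟨I, hI, ⟨e⟩⟩ := h S
    rw [th_equiv hφ e, th_equiv hθ e, h1 I hI]

end Aux4

section Aux5
set_option linter.all false
set_option linter.unusedSectionVars false
set_option linter.style.haveILetI false
variable {A}
theorem polymap_not_cover (K : Type) [Field K] (τ : Type) [Fintype τ] (I : Type) [Fintype I]
    (σ : I → Type) [∀ i, Fintype (σ i)] (t : ℕ) (hI : Fintype.card I ≤ 2 ^ t)
    (hσ : ∀ i, Fintype.card (σ i) + t < Fintype.card τ)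
    (p : ∀ i, τ → MvPolynomial (σ i) K) :
    ∃ y : τ → K, ∀ i (x : σ i → K), (fun j => MvPolynomial.eval x (p i j)) ≠ y := by
  classical
  rcases finite_or_infinite K with hK | hK
  · letI := Fintype.ofFinite K
    by_contra hcon
    push Not at hcon
    choose i x hx using hcon
    have hinj : Function.Injective (fun y : τ → K => (⟨i y, x y⟩ : Σ i, (σ i → K))) := by
      intro y y' h
      simp only [Sigma.mk.injEq] at h
      obtain ⟨h1, h2⟩ := h
      rw [← hx y, ← hx y']
      clear hx
      generalize x y = a at *
      generalize x y' = b at *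
      generalize i y = c at *
      generalize i y' = d at *
      subst h1
      rw [eq_of_heq h2]
    have hc := Fintype.card_le_of_injective _ hinj
    rw [Fintype.card_sigma] at hc
    simp only [Fintype.card_fun] at hc
    set q := Fintype.card K with hq
    have hq2 : 2 ≤ q := Fintype.one_lt_card
    by_cases hne : Nonempty I
    · obtain ⟨i0⟩ := hne
      have h1 : ∀ i, q ^ Fintype.card (σ i) ≤ q ^ (Fintype.card τ - t - 1) := by
        intro i
        refine Nat.pow_le_pow_right (by omega) ?_
        have := hσ i
        omega
      have h2 : ∑ i, q ^ Fintype.card (σ i) ≤ Fintype.card I * q ^ (Fintype.card τ - t - 1) := by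
        refine (Finset.sum_le_card_nsmul _ _ _ (fun i _ => h1 i)).trans ?_
        simp
      have h3 : Fintype.card I * q ^ (Fintype.card τ - t - 1) ≤
          q ^ t * q ^ (Fintype.card τ - t - 1) :=
        Nat.mul_le_mul_right _ (hI.trans (Nat.pow_le_pow_left hq2 t))
      rw [← pow_add] at h3
      have h4 : q ^ (t + (Fintype.card τ - t - 1)) < q ^ Fintype.card τ := by
        refine Nat.pow_lt_pow_right (by omega) ?_
        have := hσ i0
        omega
      omega
    · rw [not_nonempty_iff] at hne
      rw [Finset.univ_eq_empty, Finset.sum_empty] at hc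
      have : 0 < q ^ Fintype.card τ := Nat.pow_pos (by omega)
      omega
  · have hg : ∀ i, ∃ g : MvPolynomial τ K, g ≠ 0 ∧ MvPolynomial.aeval (p i) g = 0 := by
      intro i
      have hna : ¬ AlgebraicIndependent K (p i) := by
        intro h
        have h1 := h.cardinalMk_le_trdeg
        rw [MvPolynomial.trdeg_of_isDomain] at h1
        simp only [Cardinal.mk_fintype, Cardinal.lift_natCast, Nat.cast_le] at h1
        have := hσ i
        omega
      rw [algebraicIndependent_iff] at hna
      push Not at hna
      obtain ⟨g, h1, h2⟩ := hna
      exact ⟨g, h2, h1⟩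
    choose g hg0 hg using hg
    have hprod : ∏ i, g i ≠ 0 := Finset.prod_ne_zero_iff.2 (fun i _ => hg0 i)
    have : ∃ y, MvPolynomial.eval y (∏ i, g i) ≠ 0 := by
      by_contra hcon
      push Not at hcon
      exact hprod (MvPolynomial.funext (fun y => by rw [hcon y, map_zero]))
    obtain ⟨y, hy⟩ := this
    refine ⟨y, ?_⟩
    intro i x hxy
    apply hy
    rw [map_prod]
    refine Finset.prod_eq_zero (Finset.mem_univ i) ?_
    have h := congrArg (MvPolynomial.eval x) (hg i)
    rw [map_zero] at h
    rw [← h, ← hxy]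
    have e : ∀ q : MvPolynomial τ K, MvPolynomial.eval (fun j => MvPolynomial.eval x (p i j)) q =
        MvPolynomial.eval x (MvPolynomial.aeval (p i) q) := by
      intro q
      induction q using MvPolynomial.induction_on with
      | C a => simp
      | add a b ha hb => simp [ha, hb]
      | mul_X a n ha => simp [ha]
    exact e _

/-- choose pivot columns -/
theorem pivots (K : Type) [Field K] (r l : ℕ) (s : Fin r → Fin l → K) (hs : LinearIndependent K s) :
    ∃ (J : Fin r ↪ Fin l) (N : Fin r → Fin r → K), ∀ i' i'', ∑ i, N i' i * s i (J i'') =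
      if i' = i'' then 1 else 0 := by
  classical
  set M : Matrix (Fin r) (Fin l) K := Matrix.of s with hM
  have hrank : M.rank = r := by
    have := LinearIndependent.rank_matrix (M := M) hs
    simpa using this
  have hspan : Module.finrank K (Submodule.span K (Set.range M.col)) = r := by
    rw [← Matrix.rank_eq_finrank_span_cols, hrank]
  obtain ⟨κ, a, ha, hsp, hli⟩ := exists_linearIndependent' K M.col
  haveI : Finite κ := Finite.of_injective a ha
  letI := Fintype.ofFinite κ
  have hcard : Fintype.card κ = r := by
    rw [← finrank_span_eq_card hli, hsp, hspan]
  let e : Fin r ≃ κ := (Fintype.equivFinOfCardEq hcard).symm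
  have hli2 := hli.comp e e.injective
  set M' : Matrix (Fin r) (Fin r) K := Matrix.of (fun i i' => s i (a (e i'))) with hM'
  have hu : IsUnit M' := by
    rw [← Matrix.linearIndependent_cols_iff_isUnit]
    exact hli2
  refine ⟨⟨a ∘ e, ha.comp e.injective⟩, fun i j => (M'⁻¹ : Matrix (Fin r) (Fin r) K) i j, ?_⟩
  intro i' i''
  have h := Matrix.nonsing_inv_mul M' ((Matrix.isUnit_iff_isUnit_det _).1 hu)
  have h2 := congrFun (congrFun h i') i''
  rw [Matrix.mul_apply, Matrix.one_apply] at h2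
  exact h2

theorem NC_param (K : Type) [Field K] (g r l e : ℕ) (f : Fin l → Fin l → Fin g → K)
    (s : Fin r → Fin l → K) (hs : LinearIndependent K s) (S : Submodule K (Fin r → Fin g → K))
    (hS : Module.finrank K S ≤ e) (hf : ∀ j, (fun i => ∑ k, s i k • f k j) ∈ S) :
    ∃ (J : Fin r ↪ Fin l) (s' : Fin r → Fin l → K) (c : Fin l → Fin e → K)
      (b : Fin e → Fin r → Fin g → K), ∀ i j x, f (J i) j x =
        ∑ t, c j t * b t i x - ∑ k : {k // k ∉ Set.range J}, s' i k * f k j x := by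
  classical
  obtain ⟨J, N, hN⟩ := pivots K r l s hs
  -- spanning vectors of S
  have hb : ∃ b0 : Fin e → (Fin r → Fin g → K), S ≤ Submodule.span K (Set.range b0) := by
    obtain ⟨b1, hb1⟩ := Submodule.exists_fun_fin_finrank_span_eq K (S : Set (Fin r → Fin g → K))
    have hd : Module.finrank K (Submodule.span K (S : Set (Fin r → Fin g → K))) ≤ e := by
      rwa [Submodule.span_eq]
    refine ⟨fun t => if h : (t : ℕ) < Module.finrank K (Submodule.span K (S : Set (Fin r → Fin g → K)))
      then b1 ⟨t, h⟩ else 0, ?_⟩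
    have h2 := hb1.2.1.trans (Submodule.span_eq S)
    refine le_trans h2.ge (Submodule.span_mono ?_)
    rintro _ ⟨t, rfl⟩
    exact ⟨⟨t, lt_of_lt_of_le t.2 hd⟩, dif_pos t.2⟩
  obtain ⟨b0, hb0⟩ := hb
  have hc : ∀ j, ∃ c : Fin e → K, ∑ t, c t • b0 t = (fun i => ∑ k, s i k • f k j) := fun j =>
    (Submodule.mem_span_range_iff_exists_fun K).1 (hb0 (hf j))
  choose c hc using hc
  refine ⟨J, fun i' k => ∑ i, N i' i * s i k, c, fun t i' x => ∑ i, N i' i * b0 t i x, ?_⟩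
  intro i' j x
  have hcx : ∀ i, ∑ t, c j t * b0 t i x = ∑ k, s i k * f k j x := by
    intro i
    have := congrFun (congrFun (hc j) i) x
    simpa [Finset.sum_apply] using this
  have h1 : ∑ t, c j t * ∑ i, N i' i * b0 t i x = ∑ k, (∑ i, N i' i * s i k) * f k j x := by
    calc ∑ t, c j t * ∑ i, N i' i * b0 t i x
        = ∑ i, N i' i * ∑ t, c j t * b0 t i x := by
          simp only [Finset.mul_sum]
          rw [Finset.sum_comm]
          refine Finset.sum_congr rfl (fun i _ => Finset.sum_congr rfl (fun t _ => by ring))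
      _ = ∑ i, N i' i * ∑ k, s i k * f k j x := by simp only [hcx]
      _ = _ := by
          simp only [Finset.mul_sum, Finset.sum_mul]
          rw [Finset.sum_comm]
          refine Finset.sum_congr rfl (fun i _ => Finset.sum_congr rfl (fun t _ => by ring))
  rw [h1, ← Fintype.sum_subtype_add_sum_subtype (fun k => k ∈ Set.range J), add_sub_cancel_right]
  have h2 : ∑ k : {k // k ∈ Set.range J}, (∑ i, N i' i * s i k) * f k j x =
      ∑ i'' : Fin r, (∑ i, N i' i * s i (J i'')) * f (J i'') j x :=
    (Equiv.sum_comp (Equiv.ofInjective J J.injective)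
      (fun k : {k // k ∈ Set.range J} => (∑ i, N i' i * s i k) * f k j x)).symm
  have h3 : f (J i') j x = ∑ i'' : Fin r, (∑ i, N i' i * s i (J i'')) * f (J i'') j x := by
    simp [hN]
  rw [h3, ← h2]
  exact Finset.sum_congr (by ext; simp) (fun _ _ => rfl)

theorem growth (a C m : ℕ) : ∃ l, C + 1 ≤ l ∧ a * l ^ m ≤ 2 ^ (l - C - 1) := by
  have h := tendsto_pow_const_div_const_pow_of_one_lt m (r := (2:ℝ)) (by norm_num)
  have hε : (0:ℝ) < 1 / (a * 2 ^ (C + 1) + 1) := by positivity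
  have h2 := (h.eventually (gt_mem_nhds hε)).and (Filter.eventually_ge_atTop (C + 1))
  obtain ⟨l, hl, hl2⟩ := h2.exists
  refine ⟨l, hl2, ?_⟩
  rw [div_lt_div_iff₀ (by positivity) (by positivity)] at hl
  have e : (2:ℝ) ^ l = 2 ^ (C + 1) * 2 ^ (l - C - 1) := by
    rw [← pow_add]; congr 1; omega
  have h3 : (a:ℝ) * l ^ m * 2 ^ (C + 1) ≤ 2 ^ (C + 1) * 2 ^ (l - C - 1) := by
    rw [← e]
    have : (0:ℝ) ≤ (l:ℝ) ^ m := by positivity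
    nlinarith
  have h4 : (a:ℝ) * l ^ m ≤ 2 ^ (l - C - 1) := by
    have : (0:ℝ) < 2 ^ (C+1) := by positivity
    nlinarith
  exact_mod_cast h4

theorem NC (K : Type) [Field K] (g m : ℕ) : ∃ l : ℕ, 1 ≤ l ∧ ∃ f : Fin l → Fin l → (Fin g → K),
    ∀ r, 1 ≤ r → r ≤ m → ∀ s : Fin r → Fin l → K, LinearIndependent K s →
      ∀ S : Submodule K (Fin r → Fin g → K), Module.finrank K S + r < g * r →
        ¬ (∀ j, (fun i => ∑ k, s i k • f k j) ∈ S) ∧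
        ¬ (∀ k, (fun i => ∑ j, s i j • f k j) ∈ S) := by
  classical
  set C := m * m + (g * m) * m * g with hC
  obtain ⟨l, hl1, hl2⟩ := growth (2 * (m + 1)) C m
  refine ⟨l, by omega, ?_⟩
  let R := {r : Fin (m + 1) // 1 ≤ (r : ℕ) ∧ (r : ℕ) < g * r}
  let I := Σ r : R, (Fin r.1 ↪ Fin l) × Bool
  let ed : ℕ → ℕ := fun r => g * r - r - 1
  let σ' : I → Type := fun i => (({k // k ∉ Set.range i.2.1} × Fin i.1.1) ⊕ (Fin l × Fin (ed i.1.1))) ⊕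
    ((Fin (ed i.1.1) × Fin i.1.1 × Fin g) ⊕ ({k // k ∉ Set.range i.2.1} × Fin l × Fin g))
  let p0 : ∀ i : I, Fin l → Fin l → Fin g → MvPolynomial (σ' i) K := fun i k j x =>
    if h : ∃ a, i.2.1 a = k then
      ∑ t, MvPolynomial.X (Sum.inl (Sum.inr (j, t))) *
          MvPolynomial.X (Sum.inr (Sum.inl (t, h.choose, x)))
        - ∑ k' : {k // k ∉ Set.range i.2.1}, MvPolynomial.X (Sum.inl (Sum.inl (k', h.choose))) *
          MvPolynomial.X (Sum.inr (Sum.inr (k', j, x)))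
    else MvPolynomial.X (Sum.inr (Sum.inr (⟨k, h⟩, j, x)))
  let p : ∀ i : I, (Fin l × Fin l × Fin g) → MvPolynomial (σ' i) K := fun i q =>
    if i.2.2 then p0 i q.1 q.2.1 q.2.2 else p0 i q.2.1 q.1 q.2.2
  obtain ⟨y, hy⟩ := polymap_not_cover K (Fin l × Fin l × Fin g) I σ' (l - C - 1) (by
      refine le_trans ?_ hl2
      have hR : Fintype.card R ≤ m + 1 := by
        refine (Fintype.card_subtype_le _).trans ?_
        simp
      have : Fintype.card I = ∑ r : R, Fintype.card ((Fin r.1 ↪ Fin l) × Bool) :=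
        Fintype.card_sigma
      rw [this]
      have h1 : ∀ r : R, Fintype.card ((Fin r.1 ↪ Fin l) × Bool) ≤ 2 * l ^ m := by
        intro r
        rw [Fintype.card_prod, Fintype.card_bool, Fintype.card_embedding_eq, mul_comm]
        refine Nat.mul_le_mul_left _ ?_
        simp only [Fintype.card_fin]
        refine (Nat.descFactorial_le_pow _ _).trans (Nat.pow_le_pow_right (by omega) ?_)
        have := r.1.2
        omega
      refine (Finset.sum_le_card_nsmul _ _ _ (fun r _ => h1 r)).trans ?_
      rw [smul_eq_mul, Finset.card_univ]
      calc _ ≤ (m + 1) * (2 * l ^ m) := Nat.mul_le_mul_right _ hR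
        _ = _ := by ring)
    (by
      rintro ⟨⟨⟨r, hrm⟩, hr1, hr2⟩, J, fl⟩
      simp only at hr1 hr2 J
      have hsub : Fintype.card {k // k ∉ Set.range J} = l - r := by
        rw [Fintype.card_subtype_compl]
        have := Set.card_range_of_injective J.injective
        simp only [Fintype.card_fin] at this ⊢
        congr 1
      have hrl : r ≤ l := by
        have := Fintype.card_le_of_embedding J
        simpa using this
      have hcard : Fintype.card (σ' ⟨⟨⟨r, hrm⟩, hr1, hr2⟩, J, fl⟩) =
          ((l - r) * r + l * ed r) + (ed r * (r * g) + (l - r) * (l * g)) := by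
        simp only [σ', Fintype.card_sum, Fintype.card_prod, Fintype.card_fin, hsub]
      rw [hcard]
      simp only [Fintype.card_prod, Fintype.card_fin]
      obtain ⟨d, rfl⟩ := Nat.exists_eq_add_of_le hrl
      obtain ⟨e, he⟩ := Nat.exists_eq_add_of_lt hr2
      have hed : ed r = e := by simp only [ed]; omega
      rw [hed, Nat.add_sub_cancel_left]
      have hm : r ≤ m := by omega
      have heg : e ≤ g * m := by
        have : g * r ≤ g * m := Nat.mul_le_mul_left _ hm
        omega
      have hCb : e * (r * g) ≤ C := by
        have h1 : e * (r * g) ≤ (g * m) * (m * g) :=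
          Nat.mul_le_mul heg (Nat.mul_le_mul_right _ hm)
        have h2 : (g * m) * (m * g) = (g * m) * m * g := by ring
        rw [hC]; omega
      have key : d * r + (r + d) * e + (e * (r * g) + d * ((r + d) * g)) + (r + d) + r * r
          = (r + d) * ((r + d) * g) + e * (r * g) := by
        have : (r + d) * ((r + d) * g) = r * g * (r + d) + d * ((r + d) * g) := by ring
        rw [this, mul_comm r g, he]; ring
      have hr2 : r ≤ r * r := Nat.le_mul_self r
      omega) p
  -- the resulting f
  refine ⟨fun k j x => y (k, j, x), ?_⟩
  have main : ∀ fl : Bool, ∀ r, 1 ≤ r → r ≤ m → ∀ s : Fin r → Fin l → K, LinearIndependent K s →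
      ∀ S : Submodule K (Fin r → Fin g → K), Module.finrank K S + r < g * r →
      ∀ f : Fin l → Fin l → Fin g → K,
        (∀ k j x, f k j x = if fl then y (k, j, x) else y (j, k, x)) →
        ¬ (∀ j, (fun i => ∑ k, s i k • f k j) ∈ S) := by
    intro fl r hr1 hrm s hs S hS f hfy hf
    obtain ⟨J, s', c, b, hJ⟩ := NC_param K g r l (ed r) f s hs S (by simp only [ed]; omega) hf
    let i : I := ⟨⟨⟨r, by omega⟩, hr1, by simp only; omega⟩, J, fl⟩
    let x : σ' i → K := fun v => match v with
      | Sum.inl (Sum.inl (k, a)) => s' a k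
      | Sum.inl (Sum.inr (j, t)) => c j t
      | Sum.inr (Sum.inl (t, a, z)) => b t a z
      | Sum.inr (Sum.inr (k, j, z)) => f k j z
    have hp0 : ∀ k j z, MvPolynomial.eval x (p0 i k j z) = f k j z := by
      intro k j z
      simp only [p0]
      split_ifs with h
      · have hk := h.choose_spec
        have := hJ h.choose j z
        have hk' : J h.choose = k := hk
        rw [hk'] at this
        rw [this]
        simp only [map_sub, map_sum, map_mul, MvPolynomial.eval_X, x]
        rfl
      · simp only [MvPolynomial.eval_X, x]
    apply hy i x
    funext ⟨k, j, z⟩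
    simp only [p, i]
    have h0 := hfy
    cases fl
    · simp only [Bool.false_eq_true, if_false] at h0 ⊢
      rw [← h0 j k z]
      exact hp0 j k z
    · simp only [if_true] at h0 ⊢
      rw [← h0 k j z]
      exact hp0 k j z
  intro r hr1 hrm s hs S hS
  constructor
  · exact main true r hr1 hrm s hs S hS _ (by simp)
  · exact main false r hr1 hrm s hs S hS (fun k j x => y (j, k, x)) (by simp)

end Aux5

section Aux6
set_option linter.all false
set_option linter.unusedSectionVars false
set_option linter.style.haveILetI false
variable {A}
variable [IsNoetherianRing A] [IsArtinianRing A]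
variable {X Y Z : Type} [AddCommGroup X] [Module A X] [AddCommGroup Y] [Module A Y]
  [AddCommGroup Z] [Module A Z]
variable (K : Type) [Field K] [Algebra K A] [FiniteDimensional K A]

theorem coords {V : Type} [AddCommGroup V] [Module K V] {l : ℕ} (w : Fin l → V) :
    ∃ (r : ℕ) (u : Fin r → V) (s : Fin r → Fin l → K), LinearIndependent K u ∧
      LinearIndependent K s ∧ ∀ k, w k = ∑ i, s i k • u i := by
  classical
  let W := Submodule.span K (Set.range w)
  haveI : Module.Finite K W := Module.Finite.span_of_finite K (Set.finite_range w)
  let b := Module.finBasis K W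
  have hw : ∀ k, w k ∈ W := fun k => Submodule.subset_span ⟨k, rfl⟩
  refine ⟨_, fun i => (b i : V), fun i k => b.repr ⟨w k, hw k⟩ i, ?_, ?_, ?_⟩
  · exact b.linearIndependent.map' W.subtype (Submodule.ker_subtype W)
  · rw [Fintype.linearIndependent_iff]
    intro a ha
    let lam : W →ₗ[K] K := ∑ i, a i • b.coord i
    have hlam : lam = 0 := by
      have htop : Submodule.span K (Set.range (fun k => (⟨w k, hw k⟩ : W))) = ⊤ := by
        have h1 : Set.range (fun k => (⟨w k, hw k⟩ : W)) = Subtype.val ⁻¹' (Set.range w) := by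
          ext x
          simp only [Set.mem_range, Set.mem_preimage]
          exact ⟨fun ⟨k, hk⟩ => ⟨k, congrArg Subtype.val hk⟩, fun ⟨k, hk⟩ => ⟨k, Subtype.ext hk⟩⟩
        rw [h1]
        exact Submodule.span_span_coe_preimage
      refine LinearMap.ext_on_range htop ?_
      intro k
      have := congrFun ha k
      simpa [lam, Finset.sum_apply] using this
    intro i
    have := LinearMap.congr_fun hlam (b i)
    simpa [lam, Finset.sum_apply, Finsupp.single_apply] using this
  · intro k
    have := congrArg W.subtype (b.sum_repr ⟨w k, hw k⟩)
    rw [map_sum] at this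
    exact this.symm

variable {P0 P1 : Type} [AddCommGroup P0] [Module A P0] [AddCommGroup P1] [Module A P1]

/-- precomposition as a `K`-linear map -/
def prec [Module K X] [IsScalarTower K A X] (α : P1 →ₗ[A] P0) :
    (P0 →ₗ[A] X) →ₗ[K] (P1 →ₗ[A] X) where
  toFun h := h.comp α
  map_add' a b := by ext; simp
  map_smul' a b := by ext p; simp

@[simp] theorem postc_apply [Module K X] [IsScalarTower K A X] [Module K Y] [IsScalarTower K A Y]
    (g : X →ₗ[A] Y) (h : P0 →ₗ[A] X) : postc K P0 g h = g.comp h := rfl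

@[simp] theorem prec_apply [Module K X] [IsScalarTower K A X] (α : P1 →ₗ[A] P0)
    (h : P0 →ₗ[A] X) : prec K α h = h.comp α := rfl

/-- lift a map landing in a sum of images -/
theorem lift_sum [Module.Projective A P1] {d : ℕ} (β : Fin d → (P0 →ₗ[A] X)) (h : P1 →ₗ[A] X)
    (hh : ∀ p, h p ∈ LinearMap.range (LinearMap.lsum A (fun _ : Fin d => P0) ℕ β)) :
    ∃ α : Fin d → (P1 →ₗ[A] P0), h = ∑ t, (β t).comp (α t) := by
  set L := LinearMap.lsum A (fun _ : Fin d => P0) ℕ β with hL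
  obtain ⟨v, hv⟩ := Module.projective_lifting_property L.rangeRestrict
    (h.codRestrict (LinearMap.range L) hh) L.surjective_rangeRestrict
  refine ⟨fun t => (LinearMap.proj t).comp v, ?_⟩
  ext p
  have h1 := congrArg Subtype.val (LinearMap.congr_fun hv p)
  have h2 : L (v p) = h p := h1
  rw [← h2, hL]
  simp [LinearMap.lsum_apply]

theorem indep_le_finrank {V : Type} [AddCommGroup V] [Module K V] {r : ℕ} (u : Fin r → V)
    (hu : LinearIndependent K u) (D : Submodule K V) [Module.Finite K D] (hD : ∀ i, u i ∈ D) :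
    r ≤ Module.finrank K D := by
  have : LinearIndependent K (fun i => (⟨u i, hD i⟩ : D)) :=
    LinearIndependent.of_comp D.subtype hu
  simpa using this.fintype_card_le_finrank

theorem core_F [Module.Finite A P0] [Module.Projective A P0] [Module.Finite A P1]
    [Module.Projective A P1] [Module K P0] [IsScalarTower K A P0]
    {l m g : ℕ} (E : (Fin g → K) ≃ₗ[K] (P1 →ₗ[A] P0)) (f : Fin l → Fin l → (Fin g → K))
    (hf : ∀ r, 1 ≤ r → r ≤ m → ∀ s : Fin r → Fin l → K, LinearIndependent K s →
      ∀ S : Submodule K (Fin r → Fin g → K), Module.finrank K S + r < g * r →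
        ¬ (∀ j, (fun i => ∑ k, s i k • f k j) ∈ S))
    [Module.Finite A Y] (hm : hd K P0 (ModuleCat.of A Y) ≤ m)
    (hlt : ∀ Y' : Submodule A Y, Y' ≠ ⊥ → hd K P0 (ModuleCat.of A Y') < hd K P1 (ModuleCat.of A Y'))
    (φ : Fin l → (P0 →ₗ[A] Y)) (hφ : ∀ j, ∑ k, (φ k).comp (E (f k j)) = 0) : φ = 0 := by
  classical
  letI := kmod K A Y
  haveI := kmod_tower K A Y
  haveI : Module.Finite K (P0 →ₗ[A] Y) := hom_fin (A := A) K
  haveI : Module.Finite K (P1 →ₗ[A] Y) := hom_fin (A := A) K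
  obtain ⟨r, y, s, hy, hs, hsy⟩ := coords K φ
  rcases Nat.eq_zero_or_pos r with rfl | hr
  · funext k; rw [hsy k]; simp
  exfalso
  have hrm : r ≤ m := by
    have := hy.fintype_card_le_finrank
    rw [← hd_eq] at this
    simp only [Fintype.card_fin] at this
    omega
  let Λ : (Fin r → Fin g → K) →ₗ[K] (P1 →ₗ[A] Y) :=
    ∑ i, ((postc K P1 (y i)).comp E.toLinearMap).comp (LinearMap.proj i)
  have hΛ : ∀ a, Λ a = ∑ i, (y i).comp (E (a i)) := by
    intro a; simp [Λ, LinearMap.sum_apply]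
  let L := LinearMap.lsum A (fun _ : Fin r => P0) ℕ y
  let Y' : Submodule A Y := LinearMap.range L
  have hyY : ∀ i p, y i p ∈ Y' := by
    intro i p
    refine ⟨Pi.single i p, ?_⟩
    simp only [L, LinearMap.lsum_apply, LinearMap.sum_apply, LinearMap.comp_apply, LinearMap.proj_apply]
    rw [Finset.sum_eq_single i]
    · simp
    · intro b _ hb; simp [Pi.single_eq_of_ne hb]
    · simp
  have hY' : Y' ≠ ⊥ := by
    intro h
    apply hy.ne_zero ⟨0, hr⟩
    ext p
    have := hyY ⟨0, hr⟩ p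
    rw [h] at this
    simpa using this
  have hlt' := hlt Y' hY'
  letI := kmod K A Y'
  haveI := kmod_tower K A Y'
  haveI : Module.Finite K (P0 →ₗ[A] Y') := hom_fin (A := A) K
  haveI : Module.Finite K (P1 →ₗ[A] Y') := hom_fin (A := A) K
  rw [hd_eq, hd_eq] at hlt'
  have h1 : r ≤ Module.finrank K (P0 →ₗ[A] Y') := by
    have : LinearIndependent K (fun i => (y i).codRestrict Y' (hyY i)) := by
      refine LinearIndependent.of_comp (postc K P0 Y'.subtype) ?_
      exact hy
    simpa using this.fintype_card_le_finrank
  have h2 : Module.finrank K (P1 →ₗ[A] Y') ≤ Module.finrank K (LinearMap.range Λ) := by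
    have hinj : Function.Injective (postc K P1 Y'.subtype) := by
      intro a b hab
      ext p
      exact LinearMap.congr_fun hab p
    rw [← LinearMap.finrank_range_of_inj hinj]
    refine Submodule.finrank_mono ?_
    rintro _ ⟨h, rfl⟩
    obtain ⟨α, hα⟩ := lift_sum (A := A) y (Y'.subtype.comp h) (fun p => (h p).2)
    refine ⟨fun i => E.symm (α i), ?_⟩
    rw [hΛ]
    simp [hα]
  have h3 := Λ.finrank_range_add_finrank_ker
  have h4 : Module.finrank K (Fin r → Fin g → K) = r * g := by
    simp [Module.finrank_pi_fintype]
  have h5 : r * g = g * r := mul_comm _ _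
  refine hf r hr hrm s hs (LinearMap.ker Λ) (by omega) ?_
  intro j
  rw [LinearMap.mem_ker, hΛ, ← hφ j]
  calc ∑ i, (y i).comp (E (∑ k, s i k • f k j))
      = ∑ i, ∑ k, s i k • (y i).comp (E (f k j)) := by
        refine Finset.sum_congr rfl (fun i _ => ?_)
        have := map_sum ((postc K P1 (y i)).comp E.toLinearMap) (fun k => s i k • f k j) Finset.univ
        simpa only [LinearMap.comp_apply, LinearEquiv.coe_coe, postc_apply, map_smul] using this
    _ = ∑ k, ∑ i, s i k • (y i).comp (E (f k j)) := Finset.sum_comm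
    _ = _ := by
        refine Finset.sum_congr rfl (fun k _ => ?_)
        have := map_sum (prec K (X := Y) (E (f k j))) (fun i => s i k • y i) Finset.univ
        rw [← hsy k] at this
        simpa only [prec_apply, map_smul] using this.symm

theorem core_T [Module.Finite A P0] [Module.Projective A P0] [Module.Finite A P1]
    [Module.Projective A P1] [Module K P0] [IsScalarTower K A P0]
    {l m g : ℕ} (E : (Fin g → K) ≃ₗ[K] (P1 →ₗ[A] P0)) (f : Fin l → Fin l → (Fin g → K))
    (hf : ∀ r, 1 ≤ r → r ≤ m → ∀ s : Fin r → Fin l → K, LinearIndependent K s →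
      ∀ S : Submodule K (Fin r → Fin g → K), Module.finrank K S + r < g * r →
        ¬ (∀ k, (fun i => ∑ j, s i j • f k j) ∈ S))
    [Module.Finite A X] (hm : hd K P1 (ModuleCat.of A X) ≤ m)
    (hlt : ∀ X' : Submodule A X, X' ≠ ⊤ →
      hd K P1 (ModuleCat.of A (X ⧸ X')) < hd K P0 (ModuleCat.of A (X ⧸ X')))
    (h : Fin l → (P1 →ₗ[A] X)) :
    ∃ φ : Fin l → (P0 →ₗ[A] X), ∀ j, ∑ k, (φ k).comp (E (f k j)) = h j := by
  classical
  letI := kmod K A X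
  haveI := kmod_tower K A X
  haveI : Module.Finite K (P0 →ₗ[A] X) := hom_fin (A := A) K
  haveI : Module.Finite K (P1 →ₗ[A] X) := hom_fin (A := A) K
  let Ψ : (Fin l → (P0 →ₗ[A] X)) →ₗ[K] (Fin l → (P1 →ₗ[A] X)) :=
    LinearMap.pi (fun j => ∑ k, (prec K (X := X) (E (f k j))).comp (LinearMap.proj k))
  have hΨ : ∀ φ j, Ψ φ j = ∑ k, (φ k).comp (E (f k j)) := by
    intro φ j; simp [Ψ, LinearMap.sum_apply]
  suffices hsur : LinearMap.range Ψ = ⊤ by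
    obtain ⟨φ, hφ⟩ := LinearMap.range_eq_top.1 hsur h
    exact ⟨φ, fun j => by rw [← hΨ, hφ]⟩
  by_contra hne
  obtain ⟨W, hW, hWr⟩ := Submodule.exists_dual_map_eq_bot_of_lt_top (lt_top_iff_ne_top.2 hne)
    inferInstance
  let w : Fin l → Module.Dual K (P1 →ₗ[A] X) := fun j => W.comp (LinearMap.single K (fun _ : Fin l => (P1 →ₗ[A] X)) j)
  have hWw : ∀ v, W v = ∑ j, w j (v j) := by
    intro v
    conv_lhs => rw [← Finset.univ_sum_single v]
    rw [map_sum]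
    rfl
  have hw0 : ∀ k φ, ∑ j, w j ((φ : P0 →ₗ[A] X).comp (E (f k j))) = 0 := by
    intro k φ
    have h1 : W (Ψ (Pi.single k φ)) = 0 := by
      have : W (Ψ (Pi.single k φ)) ∈ (LinearMap.range Ψ).map W := ⟨_, ⟨_, rfl⟩, rfl⟩
      rw [hWr] at this
      exact (Submodule.mem_bot K).1 this
    rw [hWw] at h1
    rw [← h1]
    refine Finset.sum_congr rfl (fun j _ => ?_)
    rw [hΨ, Finset.sum_eq_single k]
    · simp
    · intro b _ hb; simp [Pi.single_eq_of_ne hb]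
    · simp
  obtain ⟨r, u, s, hu, hs, hsu⟩ := coords K w
  rcases Nat.eq_zero_or_pos r with rfl | hr
  · apply hW
    refine LinearMap.ext fun v => ?_
    rw [hWw]
    simp [hsu]
  have hrm : r ≤ m := by
    have := hu.fintype_card_le_finrank
    rw [Subspace.dual_finrank_eq, ← hd_eq] at this
    simp only [Fintype.card_fin] at this
    omega
  let Λ : (Fin r → Fin g → K) →ₗ[K] Module.Dual K (P0 →ₗ[A] X) :=
    { toFun := fun a => ∑ i, (u i).comp (prec K (X := X) (E (a i)))
      map_add' := by
        intro a b
        ext φ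
        simp only [LinearMap.sum_apply, LinearMap.add_apply, LinearMap.comp_apply, prec_apply,
          Pi.add_apply, map_add, LinearMap.comp_add, Finset.sum_add_distrib]
      map_smul' := by
        intro c a
        ext φ
        rw [LinearMap.smul_apply, LinearMap.sum_apply, LinearMap.sum_apply, Finset.smul_sum]
        refine Finset.sum_congr rfl (fun i _ => ?_)
        exact ((u i).comp ((postc K P1 φ).comp E.toLinearMap)).map_smul c (a i) }
  have hΛ : ∀ a φ, Λ a φ = ∑ i, u i (φ.comp (E (a i))) := by
    intro a φ; simp [Λ, LinearMap.sum_apply]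
  let B : Submodule K (P0 →ₗ[A] X) := (LinearMap.range Λ).dualCoannihilator
  have hB : ∀ φ ∈ B, ∀ (i : Fin r) (α : P1 →ₗ[A] P0), u i ((φ : P0 →ₗ[A] X).comp α) = 0 := by
    intro φ hφ i α
    have h1 := (Submodule.mem_dualCoannihilator φ).1 hφ (Λ (Pi.single i (E.symm α))) ⟨_, rfl⟩
    rw [hΛ, Finset.sum_eq_single i] at h1
    · simpa using h1
    · intro b _ hb; simp [Pi.single_eq_of_ne hb]
    · simp
  let β := Module.finBasis K B
  let L := LinearMap.lsum A (fun _ : Fin (Module.finrank K B) => P0) ℕ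
    (fun t => ((β t : B) : P0 →ₗ[A] X))
  let X' : Submodule A X := LinearMap.range L
  have hβX : ∀ i p, ((β i : B) : P0 →ₗ[A] X) p ∈ X' := by
    intro i p
    refine ⟨Pi.single i p, ?_⟩
    simp only [L, LinearMap.lsum_apply, LinearMap.sum_apply, LinearMap.comp_apply, LinearMap.proj_apply]
    rw [Finset.sum_eq_single i]
    · simp
    · intro b _ hb; simp [Pi.single_eq_of_ne hb]
    · simp
  letI := kmod K A X'
  haveI := kmod_tower K A X'
  haveI : Module.Finite K (P0 →ₗ[A] X') := hom_fin (A := A) K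
  haveI : Module.Finite K (P1 →ₗ[A] X') := hom_fin (A := A) K
  have h1 : Module.finrank K B ≤ hd K P0 (ModuleCat.of A X') := by
    rw [hd_eq]
    have : LinearIndependent K (fun i => ((β i : B) : P0 →ₗ[A] X).codRestrict X' (hβX i)) := by
      refine LinearIndependent.of_comp (postc K P0 X'.subtype) ?_
      have := β.linearIndependent.map' B.subtype (Submodule.ker_subtype B)
      exact this
    simpa using this.fintype_card_le_finrank
  have e0 : hd K P0 (ModuleCat.of A X) = hd K P0 (ModuleCat.of A X') +
      hd K P0 (ModuleCat.of A (X ⧸ X')) := by exact_mod_cast th_add (hd_stab K (P := P0)) X'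
  have e1 : hd K P1 (ModuleCat.of A X) = hd K P1 (ModuleCat.of A X') +
      hd K P1 (ModuleCat.of A (X ⧸ X')) := by exact_mod_cast th_add (hd_stab K (P := P1)) X'
  have e2 : Module.finrank K (LinearMap.range Λ) + Module.finrank K B =
      hd K P0 (ModuleCat.of A X) := by
    rw [hd_eq]
    exact Subspace.finrank_add_finrank_dualCoannihilator_eq (LinearMap.range Λ)
  let D := LinearMap.range (postc K P1 X'.subtype)
  have hD1 : Module.finrank K D = hd K P1 (ModuleCat.of A X') := by
    rw [hd_eq]
    refine LinearMap.finrank_range_of_inj ?_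
    intro a b hab
    ext p
    exact LinearMap.congr_fun hab p
  have hD2 : Module.finrank K D + Module.finrank K D.dualAnnihilator =
      hd K P1 (ModuleCat.of A X) := by
    rw [hd_eq]
    exact Subspace.finrank_add_finrank_dualAnnihilator_eq D
  have hD3 : r ≤ Module.finrank K D.dualAnnihilator := by
    refine indep_le_finrank K u hu _ ?_
    intro i
    rw [Submodule.mem_dualAnnihilator]
    rintro _ ⟨q, rfl⟩
    obtain ⟨α, hα⟩ := lift_sum (A := A) (fun t => ((β t : B) : P0 →ₗ[A] X)) (X'.subtype.comp q)
      (fun p => (q p).2)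
    rw [postc_apply, hα, map_sum]
    exact Finset.sum_eq_zero (fun t _ => hB _ (β t).2 i (α t))
  have hne' : X' ≠ ⊤ := by
    intro htop
    haveI : Subsingleton (X ⧸ X') := Submodule.Quotient.subsingleton_iff.2 htop
    have : hd K P1 (ModuleCat.of A (X ⧸ X')) = 0 := by
      have := th_sub (X := X ⧸ X') (hd_stab K (P := P1) (A := A))
      exact_mod_cast this
    omega
  have hlt' := hlt X' hne'
  have h3 := Λ.finrank_range_add_finrank_ker
  have h4 : Module.finrank K (Fin r → Fin g → K) = r * g := by
    simp [Module.finrank_pi_fintype]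
  have h5 : r * g = g * r := mul_comm _ _
  refine hf r hr hrm s hs (LinearMap.ker Λ) (by omega) ?_
  intro k
  rw [LinearMap.mem_ker]
  ext φ
  rw [hΛ, LinearMap.zero_apply, ← hw0 k φ]
  calc ∑ i, u i (φ.comp (E (∑ j, s i j • f k j)))
      = ∑ i, ∑ j, s i j • u i (φ.comp (E (f k j))) := by
        refine Finset.sum_congr rfl (fun i _ => ?_)
        have := map_sum ((u i).comp ((postc K P1 φ).comp E.toLinearMap))
          (fun j => s i j • f k j) Finset.univ
        simpa only [LinearMap.comp_apply, LinearEquiv.coe_coe, postc_apply, map_smul] using this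
    _ = ∑ j, ∑ i, s i j • u i (φ.comp (E (f k j))) := Finset.sum_comm
    _ = _ := by
        refine Finset.sum_congr rfl (fun j _ => ?_)
        rw [hsu j]
        simp [LinearMap.sum_apply]

theorem core_lin (P0 P1 : Type) [AddCommGroup P0] [Module A P0] [AddCommGroup P1] [Module A P1]
    [Module.Finite A P0] [Module.Projective A P0] [Module.Finite A P1] [Module.Projective A P1]
    (m0 : ℕ) : ∃ l : ℕ, 1 ≤ l ∧ ∃ F : (Fin l → P1) →ₗ[A] (Fin l → P0),
      (∀ (Y : Type) [AddCommGroup Y] [Module A Y] [Module.Finite A Y],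
        dm K (ModuleCat.of A Y) ≤ m0 →
        (∀ Y' : Submodule A Y, Y' ≠ ⊥ →
          hd K P0 (ModuleCat.of A Y') < hd K P1 (ModuleCat.of A Y')) →
        ∀ φ : (Fin l → P0) →ₗ[A] Y, φ.comp F = 0 → φ = 0) ∧
      (∀ (X : Type) [AddCommGroup X] [Module A X] [Module.Finite A X],
        dm K (ModuleCat.of A X) ≤ m0 →
        (∀ X' : Submodule A X, X' ≠ ⊤ →
          hd K P1 (ModuleCat.of A (X ⧸ X')) < hd K P0 (ModuleCat.of A (X ⧸ X'))) →
        ∀ h : (Fin l → P1) →ₗ[A] X, ∃ u : (Fin l → P0) →ₗ[A] X, u.comp F = h) := by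
  classical
  letI := kmod K A P0
  haveI := kmod_tower K A P0
  haveI : Module.Finite K (P1 →ₗ[A] P0) := hom_fin (A := A) K
  let b := Module.finBasis K (P1 →ₗ[A] P0)
  let E := b.equivFun.symm
  obtain ⟨l, hl, f, hf⟩ := NC K (Module.finrank K (P1 →ₗ[A] P0))
    ((dm K (ModuleCat.of A P0) + dm K (ModuleCat.of A P1)) * m0)
  have hFs : ∀ j p k, (LinearMap.pi (fun k => ∑ j, (E (f k j)).comp (LinearMap.proj j)) :
      (Fin l → P1) →ₗ[A] (Fin l → P0)) (Pi.single j p) k = E (f k j) p := by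
    intro j p k
    simp only [LinearMap.pi_apply, LinearMap.sum_apply, LinearMap.comp_apply, LinearMap.proj_apply]
    rw [Finset.sum_eq_single j]
    · simp
    · intro b _ hb; simp [Pi.single_eq_of_ne hb]
    · simp
  have hcomp : ∀ (Y : Type) [AddCommGroup Y] [Module A Y] (φ : (Fin l → P0) →ₗ[A] Y) (j : Fin l),
      (φ.comp (LinearMap.pi (fun k => ∑ j, (E (f k j)).comp (LinearMap.proj j)) :
      (Fin l → P1) →ₗ[A] (Fin l → P0))).comp (LinearMap.single A (fun _ : Fin l => P1) j) =
      ∑ k, (φ.comp (LinearMap.single A (fun _ : Fin l => P0) k)).comp (E (f k j)) := by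
    intro Y _ _ φ j
    ext p
    rw [LinearMap.comp_apply, LinearMap.comp_apply]
    rw [← Finset.univ_sum_single ((LinearMap.pi (fun k => ∑ j, (E (f k j)).comp (LinearMap.proj j)) :
      (Fin l → P1) →ₗ[A] (Fin l → P0)) (LinearMap.single A (fun _ : Fin l => P1) j p)), map_sum, LinearMap.sum_apply]
    refine Finset.sum_congr rfl (fun k _ => ?_)
    rw [LinearMap.single_apply, hFs]
    rfl
  refine ⟨l, hl, LinearMap.pi (fun k => ∑ j, (E (f k j)).comp (LinearMap.proj j)), ?_, ?_⟩
  · intro Y _ _ _ hY hlt φ hφ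
    have h1 := core_F K E f (fun r h1 h2 s hs S hS => (hf r h1 h2 s hs S hS).1) (Y := Y) (by
      refine (hd_le K).trans (Nat.mul_le_mul (Nat.le_add_right _ _) hY)) hlt
      (fun k => φ.comp (LinearMap.single A (fun _ : Fin l => P0) k)) (by
        intro j
        rw [← hcomp, hφ, LinearMap.zero_comp])
    refine LinearMap.pi_ext' (fun k => ?_)
    exact congrFun h1 k
  · intro X _ _ _ hX hlt h
    obtain ⟨φ, hφ⟩ := core_T K E f (fun r h1 h2 s hs S hS => (hf r h1 h2 s hs S hS).2) (X := X) (by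
      refine (hd_le K).trans (Nat.mul_le_mul (Nat.le_add_left _ _) hX)) hlt
      (fun k => h.comp (LinearMap.single A (fun _ : Fin l => P1) k))
    refine ⟨LinearMap.lsum A (fun _ => P0) ℕ φ, ?_⟩
    refine LinearMap.pi_ext' (fun j => ?_)
    rw [hcomp, ← hφ j]
    refine Finset.sum_congr rfl (fun k _ => ?_)
    congr 1
    ext p
    simp only [LinearMap.lsum_apply, LinearMap.comp_apply, LinearMap.sum_apply, LinearMap.proj_apply,
      LinearMap.single_apply]
    rw [Finset.sum_eq_single k]
    · simp
    · intro b _ hb; simp [Pi.single_eq_of_ne hb]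
    · simp

end Aux6

section Aux7
set_option linter.all false
set_option linter.unusedSectionVars false
set_option linter.style.haveILetI false
variable {A}
variable [IsNoetherianRing A] [IsArtinianRing A]
variable {X Y Z : Type} [AddCommGroup X] [Module A X] [AddCommGroup Y] [Module A Y]
  [AddCommGroup Z] [Module A Z]
variable (K : Type) [Field K] [Algebra K A] [FiniteDimensional K A]
variable {θ η : ModuleCat.{0} A → ℝ} {T : ModuleCat.{0} A → Prop}

theorem block_T (hT : IsTorsionClass A T) (hη : IsStability A η) (c : ℝ) (hc : 0 < c)
    (hTm : ∀ X : ModuleCat.{0} A, T X → c * dm K X ≤ η X)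
    (hFm : ∀ X : ModuleCat.{0} A, rightPerp A T X → η X ≤ - (c * dm K X)) :
    ∃ m0 : ℕ, ∀ (X : Type) [AddCommGroup X] [Module A X] [Nontrivial X], T (ModuleCat.of A X) →
      ∃ R : Submodule A X, R ≠ ⊤ ∧ T (ModuleCat.of A R) ∧ dm K (ModuleCat.of A (X ⧸ R)) ≤ m0 := by
  obtain ⟨b, hb0, hb⟩ := simple_bound K hη
  refine ⟨⌈b / c⌉₊, ?_⟩
  intro X _ _ _ hX
  haveI : Module.Finite A X := tors_fin hT hX
  obtain ⟨N, hN, hS⟩ := exists_coatom_simple (A := A) (X := X)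
  obtain ⟨t, ht, -, hp⟩ := exists_tors hT N
  let e : t ≃ₗ[A] t.map N.subtype := Submodule.equivMapOfInjective N.subtype N.injective_subtype t
  have hR : T (ModuleCat.of A (t.map N.subtype)) := tors_equiv hT ht e
  refine ⟨t.map N.subtype, ?_, hR, ?_⟩
  · intro h
    apply hN
    rw [eq_top_iff, ← h]
    exact Submodule.map_subtype_le N t
  · have h1 := hTm _ (tors_surj hT hX (t.map N.subtype).mkQ (Submodule.mkQ_surjective _))
    have h2 := th_add hη (t.map N.subtype)
    have h3 := th_add hη N
    have h4 := th_add hη t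
    have h5 := th_equiv hη e
    have h6 := hFm _ hp
    have h7 : (0 : ℝ) ≤ c * dm K (ModuleCat.of A (N ⧸ t)) := by positivity
    have h8 := (abs_le.1 (hb (X ⧸ N))).2
    have h9 : c * dm K (ModuleCat.of A (X ⧸ t.map N.subtype)) ≤ b := by linarith
    have h10 : (dm K (ModuleCat.of A (X ⧸ t.map N.subtype)) : ℝ) ≤ b / c := by
      rw [le_div_iff₀ hc]; linarith
    exact_mod_cast h10.trans (Nat.le_ceil _)

theorem block_F (hT : IsTorsionClass A T) (hη : IsStability A η) (c : ℝ) (hc : 0 < c)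
    (hTm : ∀ X : ModuleCat.{0} A, T X → c * dm K X ≤ η X)
    (hFm : ∀ X : ModuleCat.{0} A, rightPerp A T X → η X ≤ - (c * dm K X)) :
    ∃ m0 : ℕ, ∀ (Y : Type) [AddCommGroup Y] [Module A Y] [Nontrivial Y],
      rightPerp A T (ModuleCat.of A Y) →
      ∃ R : Submodule A Y, R ≠ ⊥ ∧ rightPerp A T (ModuleCat.of A (Y ⧸ R)) ∧
        dm K (ModuleCat.of A R) ≤ m0 := by
  obtain ⟨b, hb0, hb⟩ := simple_bound K hη
  refine ⟨⌈b / c⌉₊, ?_⟩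
  intro Y _ _ _ hY
  haveI : Module.Finite A Y := perp_fin hY
  obtain ⟨S, hS, hSs⟩ := exists_simple_sub (A := A) (X := Y)
  obtain ⟨t, ht, -, hp⟩ := exists_tors hT (Y ⧸ S)
  let g : Y →ₗ[A] (Y ⧸ S) ⧸ t := t.mkQ.comp S.mkQ
  have hg : Function.Surjective g := t.mkQ_surjective.comp S.mkQ_surjective
  let e := g.quotKerEquivOfSurjective hg
  refine ⟨LinearMap.ker g, ?_, perp_inj hp e.toLinearMap e.injective, ?_⟩
  · intro h
    apply hS
    rw [eq_bot_iff, ← h]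
    intro s hs
    rw [LinearMap.mem_ker]
    have : S.mkQ s = 0 := (Submodule.Quotient.mk_eq_zero S).2 hs
    simp only [g, LinearMap.comp_apply, this, map_zero]
  · have h1 := hFm _ (perp_sub hY (LinearMap.ker g))
    have h2 := th_surj hη g hg
    have h3 := th_add hη S
    have h4 := th_add hη t
    have h6 := hTm _ ht
    have h7 : (0 : ℝ) ≤ c * dm K (ModuleCat.of A t) := by positivity
    have h8 := (abs_le.1 (hb S)).1
    have h9 : c * dm K (ModuleCat.of A (LinearMap.ker g)) ≤ b := by linarith
    have h10 : (dm K (ModuleCat.of A (LinearMap.ker g)) : ℝ) ≤ b / c := by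
      rw [le_div_iff₀ hc]; linarith
    exact_mod_cast h10.trans (Nat.le_ceil _)

theorem finrank_pow {P : Type} [AddCommGroup P] [Module A P] [Module.Finite A P]
    [Module.Finite A X] [Module K X] [IsScalarTower K A X] (l : ℕ) :
    Module.finrank K ((Fin l → P) →ₗ[A] X) = l * hd K P (ModuleCat.of A X) := by
  classical
  haveI : Module.Finite K (P →ₗ[A] X) := hom_fin (A := A) K
  rw [hd_eq, ← (LinearMap.lsum A (fun _ : Fin l => P) K (M := X)).finrank_eq]
  simp [Module.finrank_pi_fintype]

theorem count_surj {P Q : Type} [AddCommGroup P] [Module A P] [Module.Finite A P]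
    [AddCommGroup Q] [Module A Q] [Module.Finite A Q] [Module.Finite A X] (l : ℕ) (hl : 1 ≤ l)
    (F : (Fin l → P) →ₗ[A] (Fin l → Q))
    (h : ∀ h : (Fin l → P) →ₗ[A] X, ∃ u : (Fin l → Q) →ₗ[A] X, u.comp F = h) :
    hd K P (ModuleCat.of A X) ≤ hd K Q (ModuleCat.of A X) := by
  letI := kmod K A X
  haveI := kmod_tower K A X
  haveI : Module.Finite K ((Fin l → Q) →ₗ[A] X) := hom_fin (A := A) K
  have h1 := LinearMap.finrank_le_finrank_of_surjective (f := prec K (X := X) F) h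
  rw [finrank_pow, finrank_pow] at h1
  exact Nat.le_of_mul_le_mul_left h1 hl

theorem count_inj {P Q : Type} [AddCommGroup P] [Module A P] [Module.Finite A P]
    [AddCommGroup Q] [Module A Q] [Module.Finite A Q] [Module.Finite A X] (l : ℕ) (hl : 1 ≤ l)
    (F : (Fin l → P) →ₗ[A] (Fin l → Q))
    (h : ∀ u : (Fin l → Q) →ₗ[A] X, u.comp F = 0 → u = 0) :
    hd K Q (ModuleCat.of A X) ≤ hd K P (ModuleCat.of A X) := by
  letI := kmod K A X
  haveI := kmod_tower K A X
  haveI : Module.Finite K ((Fin l → P) →ₗ[A] X) := hom_fin (A := A) K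
  have h1 := LinearMap.finrank_le_finrank_of_injective (f := prec K (X := X) F)
    ((injective_iff_map_eq_zero _).2 h)
  rw [finrank_pow, finrank_pow] at h1
  exact Nat.le_of_mul_le_mul_left h1 hl

/-- the package -/
structure Pkg (T : ModuleCat.{0} A → Prop) {P Q : Type} [AddCommGroup P] [Module A P]
    [AddCommGroup Q] [Module A Q] (f : P →ₗ[A] Q) : Prop where
  finP : Module.Finite A P
  finQ : Module.Finite A Q
  projP : Module.Projective A P
  projQ : Module.Projective A Q
  tC : T (ModuleCat.of A (Q ⧸ LinearMap.range f))
  ext : ∀ (X : Type) [AddCommGroup X] [Module A X], T (ModuleCat.of A X) →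
    ∀ h : P →ₗ[A] X, ∃ u : Q →ₗ[A] X, u.comp f = h
  zero : ∀ (Y : Type) [AddCommGroup Y] [Module A Y], rightPerp A T (ModuleCat.of A Y) →
    (∀ h : P →ₗ[A] Y, ∃ u : Q →ₗ[A] Y, u.comp f = h) → Subsingleton Y
  gen : ∀ (X : Type) [AddCommGroup X] [Module A X], T (ModuleCat.of A X) →
    ∀ X' : Submodule A X, (∀ g : (Q ⧸ LinearMap.range f) →ₗ[A] X, LinearMap.range g ≤ X') → X' = ⊤

theorem proj_pi {P : Type} [AddCommGroup P] [Module A P] [Module.Projective A P] (l : ℕ) :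
    Module.Projective A (Fin l → P) := by
  exact Module.Projective.of_equiv (DFinsupp.linearEquivFunOnFintype (R := A) (M := fun _ : Fin l => P))

theorem core2 (hT : IsTorsionClass A T) (hη : IsStability A η) (c : ℝ) (hc : 0 < c)
    (hTm : ∀ X : ModuleCat.{0} A, T X → c * dm K X ≤ η X)
    (hFm : ∀ X : ModuleCat.{0} A, rightPerp A T X → η X ≤ - (c * dm K X)) :
    ∃ (P : Type) (_ : AddCommGroup P) (_ : Module A P) (Q : Type) (_ : AddCommGroup Q)
      (_ : Module A Q) (f : P →ₗ[A] Q), Pkg T f := by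
  obtain ⟨m1, hm1⟩ := block_T K hT hη c hc hTm hFm
  obtain ⟨m2, hm2⟩ := block_F K hT hη c hc hTm hFm
  obtain ⟨B, hB⟩ := approx_stab K hη
  obtain ⟨N, hN⟩ := exists_nat_gt (B / c)
  obtain ⟨P0, _, _, P1, _, _, _, _, _, _, happ⟩ := hB N
  rw [div_lt_iff₀ hc] at hN
  have hTh : ∀ (X : Type) [AddCommGroup X] [Module A X], T (ModuleCat.of A X) → Nontrivial X →
      hd K P1 (ModuleCat.of A X) < hd K P0 (ModuleCat.of A X) := by
    intro X _ _ hX _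
    haveI : Module.Finite A X := tors_fin hT hX
    have h1 := (abs_le.1 (happ X)).1
    have h2 := hTm _ hX
    have h3 : (0 : ℝ) < dm K (ModuleCat.of A X) := by exact_mod_cast dm_pos (A := A) (X := X) K
    have h4 : (N : ℝ) * (c * dm K (ModuleCat.of A X)) ≤ N * η (ModuleCat.of A X) :=
      mul_le_mul_of_nonneg_left h2 (Nat.cast_nonneg N)
    have h5 := mul_lt_mul_of_pos_right hN h3
    have : (hd K P1 (ModuleCat.of A X) : ℝ) < hd K P0 (ModuleCat.of A X) := by linarith
    exact_mod_cast this
  have hFh : ∀ (X : Type) [AddCommGroup X] [Module A X], rightPerp A T (ModuleCat.of A X) →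
      Nontrivial X → hd K P0 (ModuleCat.of A X) < hd K P1 (ModuleCat.of A X) := by
    intro X _ _ hX _
    haveI : Module.Finite A X := perp_fin hX
    have h1 := (abs_le.1 (happ X)).2
    have h2 := hFm _ hX
    have h3 : (0 : ℝ) < dm K (ModuleCat.of A X) := by exact_mod_cast dm_pos (A := A) (X := X) K
    have h4 : N * η (ModuleCat.of A X) ≤ (N : ℝ) * (-(c * dm K (ModuleCat.of A X))) :=
      mul_le_mul_of_nonneg_left h2 (Nat.cast_nonneg N)
    have h5 := mul_lt_mul_of_pos_right hN h3
    have : (hd K P0 (ModuleCat.of A X) : ℝ) < hd K P1 (ModuleCat.of A X) := by linarith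
    exact_mod_cast this
  obtain ⟨l, hl, f, hfF, hfT⟩ := core_lin (A := A) K P0 P1 (max m1 m2)
  haveI : Module.Projective A (Fin l → P0) := proj_pi l
  haveI : Module.Projective A (Fin l → P1) := proj_pi l
  have hext : ∀ (n : ℕ) (X : Type) [AddCommGroup X] [Module A X], dm K (ModuleCat.of A X) = n →
      T (ModuleCat.of A X) →
      ∀ h : (Fin l → P1) →ₗ[A] X, ∃ u : (Fin l → P0) →ₗ[A] X, u.comp f = h := by
    intro n
    induction n using Nat.strong_induction_on with
    | _ n ih =>
      intro X _ _ hn hX h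
      haveI : Module.Finite A X := tors_fin hT hX
      rcases subsingleton_or_nontrivial X with hs | hs
      · exact ⟨0, LinearMap.ext fun x => Subsingleton.elim _ _⟩
      obtain ⟨R, hR, hRT, hRm⟩ := hm1 X hX
      have hXR : T (ModuleCat.of A (X ⧸ R)) := tors_surj hT hX R.mkQ R.mkQ_surjective
      obtain ⟨u0, hu0⟩ := hfT (X ⧸ R) (hRm.trans (le_max_left _ _)) (by
        intro X' hX'
        exact hTh _ (tors_surj hT hXR X'.mkQ X'.mkQ_surjective)
          (Submodule.Quotient.nontrivial_iff.2 hX')) (R.mkQ.comp h)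
      obtain ⟨u, hu⟩ := Module.projective_lifting_property R.mkQ u0 R.mkQ_surjective
      obtain ⟨u1, hu1⟩ := ih _ (hn ▸ dm_sub_lt K hR) R rfl hRT
        ((h - u.comp f).codRestrict R (by
          intro p
          rw [← R.ker_mkQ, LinearMap.mem_ker]
          have h1 := LinearMap.congr_fun hu0 p
          have h2 := LinearMap.congr_fun hu (f p)
          simp only [LinearMap.comp_apply] at h1 h2
          simp only [LinearMap.sub_apply, LinearMap.comp_apply, map_sub]
          rw [h2, h1, sub_self]))
      refine ⟨u + R.subtype.comp u1, ?_⟩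
      refine LinearMap.ext fun p => ?_
      have h1 := congrArg Subtype.val (LinearMap.congr_fun hu1 p)
      simp only [LinearMap.comp_apply, LinearMap.codRestrict_apply, LinearMap.sub_apply] at h1
      simp only [LinearMap.comp_apply, LinearMap.add_apply, Submodule.subtype_apply, h1]
      abel
  have hext' : ∀ (X : Type) [AddCommGroup X] [Module A X], T (ModuleCat.of A X) →
      ∀ h : (Fin l → P1) →ₗ[A] X, ∃ u : (Fin l → P0) →ₗ[A] X, u.comp f = h :=
    fun X _ _ hX => hext _ X rfl hX
  have hC : ∀ (n : ℕ) (Y : Type) [AddCommGroup Y] [Module A Y], dm K (ModuleCat.of A Y) = n →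
      rightPerp A T (ModuleCat.of A Y) → ∀ g : (Fin l → P0) →ₗ[A] Y, g.comp f = 0 → g = 0 := by
    intro n
    induction n using Nat.strong_induction_on with
    | _ n ih =>
      intro Y _ _ hn hY g hg
      haveI : Module.Finite A Y := perp_fin hY
      rcases subsingleton_or_nontrivial Y with hs | hs
      · exact LinearMap.ext fun x => Subsingleton.elim _ _
      obtain ⟨R, hR, hRF, hRm⟩ := hm2 Y hY
      have h1 := ih _ (hn ▸ dm_quot_lt K hR) (Y ⧸ R) rfl hRF (R.mkQ.comp g) (by
        rw [LinearMap.comp_assoc, hg, LinearMap.comp_zero])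
      have hgR : ∀ x, g x ∈ R := fun x => by
        rw [← R.ker_mkQ, LinearMap.mem_ker]; exact LinearMap.congr_fun h1 x
      have h2 := hfF R (hRm.trans (le_max_right _ _)) (by
        intro Y' hY'
        exact hFh _ (perp_sub (perp_sub hY R) Y') (Submodule.nontrivial_iff_ne_bot.2 hY'))
        (g.codRestrict R hgR) (by
          refine LinearMap.ext fun p => ?_
          exact Subtype.ext (LinearMap.congr_fun hg p))
      refine LinearMap.ext fun x => ?_
      exact congrArg Subtype.val (LinearMap.congr_fun h2 x)
  refine ⟨Fin l → P1, inferInstance, inferInstance, Fin l → P0, inferInstance, inferInstance, f,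
    inferInstance, inferInstance, inferInstance, inferInstance, ?_, hext', ?_, ?_⟩
  · refine tors_of_hom_perp hT ?_
    intro Y _ _ hY g
    have h1 := hC _ Y rfl hY (g.comp (LinearMap.range f).mkQ) (by
      rw [LinearMap.comp_assoc, LinearMap.range_mkQ_comp, LinearMap.comp_zero])
    refine LinearMap.ext fun x => ?_
    obtain ⟨x, rfl⟩ := (LinearMap.range f).mkQ_surjective x
    exact LinearMap.congr_fun h1 x
  · intro Y _ _ hY h
    haveI : Module.Finite A Y := perp_fin hY
    by_contra hs
    rw [not_subsingleton_iff_nontrivial] at hs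
    have h1 := count_surj K l hl f h
    have h2 := hFh Y hY hs
    omega
  · intro X _ _ hX X' hX'
    haveI : Module.Finite A X := tors_fin hT hX
    obtain ⟨t, ht, htmax, -⟩ := exists_tors hT X'
    let e : t ≃ₗ[A] t.map X'.subtype := Submodule.equivMapOfInjective X'.subtype X'.injective_subtype t
    set W := t.map X'.subtype with hW
    have hWT : T (ModuleCat.of A W) := tors_equiv hT ht e
    have htC : T (ModuleCat.of A ((Fin l → P0) ⧸ LinearMap.range f)) := by
      refine tors_of_hom_perp hT ?_
      intro Y _ _ hY g
      have h1 := hC _ Y rfl hY (g.comp (LinearMap.range f).mkQ) (by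
        rw [LinearMap.comp_assoc, LinearMap.range_mkQ_comp, LinearMap.comp_zero])
      refine LinearMap.ext fun x => ?_
      obtain ⟨x, rfl⟩ := (LinearMap.range f).mkQ_surjective x
      exact LinearMap.congr_fun h1 x
    have hgW : ∀ (g : ((Fin l → P0) ⧸ LinearMap.range f) →ₗ[A] X) x, g x ∈ W := by
      intro g x
      let g' := g.codRestrict X' (fun x => hX' g ⟨x, rfl⟩)
      have h1 := htmax _ (tors_range hT htC g') ⟨x, rfl⟩
      exact ⟨_, h1, rfl⟩
    suffices h : W = ⊤ by
      rw [eq_top_iff, ← h]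
      exact Submodule.map_subtype_le X' t
    by_contra hne
    have hXW : T (ModuleCat.of A (X ⧸ W)) := tors_surj hT hX W.mkQ W.mkQ_surjective
    have h2 := hTh _ hXW (Submodule.Quotient.nontrivial_iff.2 hne)
    have h1 := count_inj (X := X ⧸ W) K l hl f (by
      intro u hu
      obtain ⟨v, hv⟩ := Module.projective_lifting_property W.mkQ u W.mkQ_surjective
      have hvf : ∀ p, v (f p) ∈ W := fun p => by
        rw [← W.ker_mkQ, LinearMap.mem_ker]
        have h1 := LinearMap.congr_fun hv (f p)
        have h2 := LinearMap.congr_fun hu p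
        simp only [LinearMap.comp_apply, LinearMap.zero_apply] at h1 h2
        rw [h1, h2]
      obtain ⟨w, hw⟩ := hext' W hWT ((v.comp f).codRestrict W hvf)
      let g := (LinearMap.range f).liftQ (v - W.subtype.comp w) (by
        rintro _ ⟨p, rfl⟩
        have h1 := congrArg Subtype.val (LinearMap.congr_fun hw p)
        simp only [LinearMap.comp_apply, LinearMap.codRestrict_apply] at h1
        simp only [LinearMap.mem_ker, LinearMap.sub_apply, LinearMap.comp_apply,
          Submodule.subtype_apply, h1, sub_self])
      refine LinearMap.ext fun x => ?_
      have h3 := hgW g ((LinearMap.range f).mkQ x)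
      have h4 : v x - (w x : X) ∈ W := h3
      have h5 : v x ∈ W := by simpa using W.add_mem h4 (w x).2
      rw [← W.ker_mkQ, LinearMap.mem_ker] at h5
      rw [← LinearMap.congr_fun hv x]
      exact h5)
    omega

theorem pkg_theta (hθ : IsStability A θ) (h : MarginT K θ) :
    ∃ (P : Type) (_ : AddCommGroup P) (_ : Module A P) (Q : Type) (_ : AddCommGroup Q)
      (_ : Module A Q) (f : P →ₗ[A] Q), Pkg (tTheta A θ) f := by
  obtain ⟨c, hc, h⟩ := h
  refine core2 K (tTheta_tors hθ) (stab_comb K hθ (-(c/2))) (c/2) (by positivity) ?_ ?_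
  · intro X hX
    have := h X hX
    linarith
  · intro X hX
    haveI : Module.Finite A X := hX.1
    have := perp_tTheta_le K hθ _ X rfl hX
    have h2 : θ X ≤ 0 := this
    linarith

end Aux7

section Aux8
set_option linter.all false
set_option linter.unusedSectionVars false
set_option linter.style.haveILetI false
variable {A}
variable [IsNoetherianRing A] [IsArtinianRing A]
variable {X Y Z : Type} [AddCommGroup X] [Module A X] [AddCommGroup Y] [Module A Y]
  [AddCommGroup Z] [Module A Z]
variable (K : Type) [Field K] [Algebra K A] [FiniteDimensional K A]
variable {θ η : ModuleCat.{0} A → ℝ} {T : ModuleCat.{0} A → Prop}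

theorem factor_surj (Φ : X →ₗ[A] Y) (hΦ : Function.Surjective Φ) (Ψ : X →ₗ[A] Z)
    (h : ∀ x, Φ x = 0 → Ψ x = 0) : ∃ ψ : Y →ₗ[A] Z, ∀ x, ψ (Φ x) = Ψ x := by
  refine ⟨((LinearMap.ker Φ).liftQ Ψ h).comp (Φ.quotKerEquivOfSurjective hΦ).symm.toLinearMap, ?_⟩
  intro x
  have : (Φ.quotKerEquivOfSurjective hΦ).symm (Φ x) = (LinearMap.ker Φ).mkQ x := by
    rw [LinearEquiv.symm_apply_eq]; rfl
  simp only [LinearMap.comp_apply, LinearEquiv.coe_coe, this]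
  rfl

/-- left approximation of the regular module -/
def LApp (T : ModuleCat.{0} A → Prop) : Prop :=
  ∃ (C0 : Type) (_ : AddCommGroup C0) (_ : Module A C0) (c0 : C0), T (ModuleCat.of A C0) ∧
    ∀ (X : Type) [AddCommGroup X] [Module A X], T (ModuleCat.of A X) → ∀ x : X,
      ∃ h : C0 →ₗ[A] X, h c0 = x

theorem lapp_of_ff (h : FunctoriallyFinite A T) : LApp T := by
  obtain ⟨X, f, hX, hf⟩ := h.1 (ModuleCat.of A A) (inferInstance : Module.Finite A A)
  refine ⟨X, inferInstance, inferInstance, f (1 : A), hX, ?_⟩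
  intro Y _ _ hY y
  obtain ⟨h, hh⟩ := hf (ModuleCat.of A Y) hY (LinearMap.toSpanSingleton A Y y)
  refine ⟨h, ?_⟩
  have := LinearMap.congr_fun hh (1 : A)
  simp only [LinearMap.comp_apply] at this
  refine this.trans ?_
  exact (LinearMap.toSpanSingleton_apply A Y y 1).trans (one_smul A y)

theorem ff_of_lapp (hT : IsTorsionClass A T) (h : LApp T) : FunctoriallyFinite A T := by
  classical
  obtain ⟨C0, _, _, c0, hC0, hc0⟩ := h
  constructor
  · intro M hM
    obtain ⟨n, π, hπ⟩ := Module.Finite.exists_fin' A M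
    let ι : (Fin n → A) →ₗ[A] (Fin n → C0) :=
      LinearMap.pi (fun i => (LinearMap.toSpanSingleton A C0 c0).comp (LinearMap.proj i))
    let W := (LinearMap.ker π).map ι
    obtain ⟨φ, hφ⟩ := factor_surj π hπ (W.mkQ.comp ι) (by
      intro x hx
      refine (Submodule.Quotient.mk_eq_zero W).2 ⟨x, hx, rfl⟩)
    refine ⟨ModuleCat.of A ((Fin n → C0) ⧸ W), φ, tors_surj hT (tors_pi hT hC0 n) W.mkQ
      W.mkQ_surjective, ?_⟩
    intro Y hY g
    have h1 : ∀ i, ∃ h : C0 →ₗ[A] Y, h c0 = g (π (Pi.single i 1)) := fun i => hc0 Y hY _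
    choose H hH using h1
    have h2 : ∀ x, (LinearMap.lsum A (fun _ : Fin n => C0) ℕ H) (ι x) = g (π x) := by
      intro x
      have : (LinearMap.lsum A (fun _ : Fin n => C0) ℕ H).comp ι = g.comp π := by
        refine LinearMap.pi_ext' (fun i => ?_)
        refine LinearMap.ext_ring ?_
        simp only [LinearMap.comp_apply, LinearMap.lsum_apply, LinearMap.sum_apply,
          LinearMap.proj_apply, LinearMap.single_apply]
        rw [Finset.sum_eq_single i]
        · simp [ι, hH]
        · intro b _ hb; simp [ι, Pi.single_eq_of_ne hb]
        · simp
      exact LinearMap.congr_fun this x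
    refine ⟨W.liftQ (LinearMap.lsum A (fun _ : Fin n => C0) ℕ H) ?_, ?_⟩
    · rintro _ ⟨x, hx, rfl⟩
      rw [LinearMap.mem_ker, h2, show π x = 0 from hx, map_zero]
    · refine LinearMap.ext fun m => ?_
      obtain ⟨x, rfl⟩ := hπ m
      rw [LinearMap.comp_apply, hφ]
      exact h2 x
  · intro M hM
    obtain ⟨t, ht, hmax, -⟩ := exists_tors hT M
    refine ⟨ModuleCat.of A t, t.subtype, ht, ?_⟩
    intro Y hY g
    refine ⟨g.codRestrict t (fun y => hmax _ (tors_range (X := Y) (Y := M) hT hY g) ⟨y, rfl⟩), ?_⟩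
    rfl

theorem lapp_of_gen (hT : IsTorsionClass A T) (C : Type) [AddCommGroup C] [Module A C]
    (hC : T (ModuleCat.of A C))
    (hgen : ∀ (X : Type) [AddCommGroup X] [Module A X], T (ModuleCat.of A X) →
      ∀ X' : Submodule A X, (∀ g : C →ₗ[A] X, LinearMap.range g ≤ X') → X' = ⊤)
    (K : Type) [Field K] [Algebra K A] [FiniteDimensional K A] :
    LApp T := by
  classical
  haveI : Module.Finite A C := tors_fin hT hC
  letI := kmod K A C
  haveI := kmod_tower K A C
  haveI : Module.Finite K C := kfin (A := A) K
  let b := Module.finBasis K C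
  refine ⟨Fin (Module.finrank K C) → C, inferInstance, inferInstance, b, tors_pi hT hC _, ?_⟩
  intro X _ _ hX x
  letI := kmod K A X
  haveI := kmod_tower K A X
  have hx : x ∈ ⨆ g : C →ₗ[A] X, LinearMap.range g := by
    rw [hgen X hX _ (fun g => le_iSup (fun g : C →ₗ[A] X => LinearMap.range g) g)]
    trivial
  induction hx using Submodule.iSup_induction' with
  | mem g x hx =>
    obtain ⟨c, rfl⟩ := hx
    refine ⟨∑ j, (b.repr c j) • g.comp (LinearMap.proj j), ?_⟩
    simp only [LinearMap.sum_apply, LinearMap.smul_apply, LinearMap.comp_apply, LinearMap.proj_apply]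
    conv_rhs => rw [← b.sum_repr c]
    rw [map_sum]
    refine Finset.sum_congr rfl (fun j _ => ?_)
    exact ((g.restrictScalars K).map_smul _ _).symm
  | zero => exact ⟨0, rfl⟩
  | add x y _ _ hx hy =>
    obtain ⟨h1, e1⟩ := hx
    obtain ⟨h2, e2⟩ := hy
    exact ⟨h1 + h2, by rw [LinearMap.add_apply, e1, e2]⟩

theorem ff_of_pkg (hT : IsTorsionClass A T) {P Q : Type} [AddCommGroup P] [Module A P]
    [AddCommGroup Q] [Module A Q] {f : P →ₗ[A] Q} (hp : Pkg T f)
    (K : Type) [Field K] [Algebra K A] [FiniteDimensional K A] : FunctoriallyFinite A T :=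
  ff_of_lapp hT (lapp_of_gen hT _ hp.tC hp.gen K)

theorem core1_ext (hT : IsTorsionClass A T) {P Q : Type} [AddCommGroup P] [Module A P]
    [AddCommGroup Q] [Module A Q] {f : P →ₗ[A] Q} (hp : Pkg T f)
    (K : Type) [Field K] [Algebra K A] [FiniteDimensional K A]
    {B : Type} [AddCommGroup B] [Module A B] [Module.Finite A X]
    (b : B →ₗ[A] X) (hb : Function.Injective b) (hXb : T (ModuleCat.of A (X ⧸ LinearMap.range b)))
    (hY : rightPerp A T (ModuleCat.of A Y)) (β : B →ₗ[A] Y)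
    (hβ : ∀ h : P →ₗ[A] B, (∃ u : Q →ₗ[A] X, u.comp f = b.comp h) →
      ∃ u : Q →ₗ[A] Y, u.comp f = β.comp h) : ∃ ψ : X →ₗ[A] Y, ψ.comp b = β := by
  classical
  haveI := hp.finP
  haveI := hp.finQ
  haveI := hp.projP
  haveI := hp.projQ
  let C := Q ⧸ LinearMap.range f
  let C' := X ⧸ LinearMap.range b
  let mk : Q →ₗ[A] C := (LinearMap.range f).mkQ
  have hmk : Function.Surjective mk := Submodule.mkQ_surjective _
  have hmk0 : ∀ q, mk q = 0 ↔ ∃ p, f p = q := by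
    intro q
    exact (Submodule.Quotient.mk_eq_zero _).trans Iff.rfl
  letI := kmod K A C
  haveI := kmod_tower K A C
  letI := kmod K A C'
  haveI := kmod_tower K A C'
  haveI : Module.Finite K (C →ₗ[A] C') := hom_fin (A := A) K
  let bas := Module.finBasis K (C →ₗ[A] C')
  let k := Module.finrank K (C →ₗ[A] C')
  let L : (Fin k → C) →ₗ[A] C' := LinearMap.lsum A (fun _ : Fin k => C) ℕ bas
  have hL : ∀ c, L c = ∑ i, bas i (c i) := by
    intro c
    simp [L, LinearMap.lsum_apply, LinearMap.sum_apply]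
    rfl
  have hgL : ∀ g : C →ₗ[A] C', ∃ s : C →ₗ[A] (Fin k → C), L.comp s = g := by
    intro g
    refine ⟨LinearMap.pi (fun i => bas.repr g i • LinearMap.id), ?_⟩
    refine LinearMap.ext fun c => ?_
    rw [LinearMap.comp_apply, hL]
    conv_rhs => rw [← bas.sum_repr g]
    rw [LinearMap.sum_apply]
    refine Finset.sum_congr rfl (fun i _ => ?_)
    exact ((bas i).restrictScalars K).map_smul _ _
  have hLs : Function.Surjective L := by
    rw [← LinearMap.range_eq_top]
    refine hp.gen _ hXb _ ?_
    rintro g _ ⟨c, rfl⟩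
    obtain ⟨s, rfl⟩ := hgL g
    exact ⟨s c, rfl⟩
  have hCk : T (ModuleCat.of A (Fin k → C)) := tors_pi hT hp.tC k
  have hK0 : T (ModuleCat.of A (LinearMap.ker L)) := by
    haveI : Module.Finite A (Fin k → C) := tors_fin hT hCk
    obtain ⟨t, ht, -, hq⟩ := exists_tors hT (LinearMap.ker L)
    haveI := hp.zero _ hq (by
      intro h
      obtain ⟨h', hh'⟩ := Module.projective_lifting_property t.mkQ h t.mkQ_surjective
      obtain ⟨u, hu⟩ := hp.ext _ hCk ((LinearMap.ker L).subtype.comp h')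
      have hu' : ∀ p, u (f p) = h' p := fun p => LinearMap.congr_fun hu p
      obtain ⟨g, hg⟩ := factor_surj mk hmk (L.comp u) (by
        intro q hq
        obtain ⟨p, rfl⟩ := (hmk0 q).1 hq
        rw [LinearMap.comp_apply, hu']
        exact (h' p).2)
      obtain ⟨s, hs⟩ := hgL g
      have hs' : ∀ c, L (s c) = g c := fun c => LinearMap.congr_fun hs c
      refine ⟨t.mkQ.comp ((u - s.comp mk).codRestrict (LinearMap.ker L) ?_), ?_⟩
      · intro q
        rw [LinearMap.mem_ker, LinearMap.sub_apply, map_sub, LinearMap.comp_apply, hs', hg,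
          LinearMap.comp_apply, sub_self]
      · refine LinearMap.ext fun p => ?_
        rw [← hh']
        simp only [LinearMap.comp_apply]
        congr 1
        refine Subtype.ext ?_
        simp only [LinearMap.codRestrict_apply, LinearMap.sub_apply, LinearMap.comp_apply, hu',
          (hmk0 (f p)).2 ⟨p, rfl⟩, map_zero, sub_zero])
    have : t = ⊤ := Submodule.Quotient.subsingleton_iff.1 this
    subst this
    exact tors_equiv hT ht Submodule.topEquiv
  have hv : ∀ i : Fin k, ∃ v : Q →ₗ[A] X, (LinearMap.range b).mkQ.comp v = (bas i).comp mk :=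
    fun i => Module.projective_lifting_property _ _ (Submodule.mkQ_surjective _)
  choose v hv using hv
  have hv' : ∀ i q, (LinearMap.range b).mkQ (v i q) = bas i (mk q) :=
    fun i q => LinearMap.congr_fun (hv i) q
  have hvb : ∀ i : Fin k, ∃ h : P →ₗ[A] B, (v i).comp f = b.comp h := by
    intro i
    have h1 : ∀ p, v i (f p) ∈ LinearMap.range b := by
      intro p
      rw [← (LinearMap.range b).ker_mkQ, LinearMap.mem_ker, hv', (hmk0 _).2 ⟨p, rfl⟩, map_zero]
    refine ⟨(LinearEquiv.ofInjective b hb).symm.toLinearMap.comp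
      (((v i).comp f).codRestrict (LinearMap.range b) h1), ?_⟩
    refine LinearMap.ext fun p => ?_
    have := (LinearEquiv.ofInjective b hb).apply_symm_apply
      (((v i).comp f).codRestrict (LinearMap.range b) h1 p)
    exact (congrArg Subtype.val this).symm
  choose h hh using hvb
  have hu : ∀ i, ∃ u : Q →ₗ[A] Y, u.comp f = β.comp (h i) := fun i => hβ (h i) ⟨v i, hh i⟩
  choose u hu using hu
  let Φ : ((Fin k → Q) × B) →ₗ[A] X := (LinearMap.lsum A (fun _ : Fin k => Q) ℕ v).coprod b
  let Ψ : ((Fin k → Q) × B) →ₗ[A] Y := (LinearMap.lsum A (fun _ : Fin k => Q) ℕ u).coprod β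
  have hΦ : ∀ q y, Φ (q, y) = ∑ i, v i (q i) + b y := by
    intro q y; simp [Φ, LinearMap.lsum_apply, LinearMap.sum_apply]
  have hΨ : ∀ q y, Ψ (q, y) = ∑ i, u i (q i) + β y := by
    intro q y; simp [Ψ, LinearMap.lsum_apply, LinearMap.sum_apply]
  have hmkv : ∀ q : Fin k → Q, (LinearMap.range b).mkQ (∑ i, v i (q i)) = L (fun i => mk (q i)) := by
    intro q
    rw [map_sum, hL]
    exact Finset.sum_congr rfl (fun i _ => hv' i (q i))
  have hΦs : Function.Surjective Φ := by
    intro x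
    obtain ⟨c, hc⟩ := hLs ((LinearMap.range b).mkQ x)
    choose q hq using fun i => hmk (c i)
    have h1 : x - ∑ i, v i (q i) ∈ LinearMap.range b := by
      rw [← (LinearMap.range b).ker_mkQ, LinearMap.mem_ker, map_sub, hmkv, ← hc]
      simp only [hq]
      exact sub_self _
    obtain ⟨y, hy⟩ := h1
    exact ⟨(q, y), by rw [hΦ, hy]; abel⟩
  have hker : ∀ x, Φ x = 0 → Ψ x = 0 := by
    -- map from the kernel of `Φ` to the kernel of `L`
    have hm : ∀ x : LinearMap.ker Φ, (LinearMap.pi (fun i => mk.comp (LinearMap.proj i)) :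
        (Fin k → Q) →ₗ[A] (Fin k → C)) x.1.1 ∈ LinearMap.ker L := by
      rintro ⟨⟨q, y⟩, hx⟩
      rw [LinearMap.mem_ker, hΦ] at hx
      rw [LinearMap.mem_ker]
      refine (hmkv q).symm.trans ?_
      rw [eq_neg_of_add_eq_zero_left hx, map_neg, neg_eq_zero]
      exact (Submodule.Quotient.mk_eq_zero _).2 ⟨y, rfl⟩
    let m : LinearMap.ker Φ →ₗ[A] LinearMap.ker L :=
      ((LinearMap.pi (fun i => mk.comp (LinearMap.proj i))).comp
        ((LinearMap.fst A _ _).comp (LinearMap.ker Φ).subtype)).codRestrict (LinearMap.ker L) hm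
    have hms : Function.Surjective m := by
      rintro ⟨c, hc⟩
      choose q hq using fun i => hmk (c i)
      have h1 : ∑ i, v i (q i) ∈ LinearMap.range b := by
        rw [← (LinearMap.range b).ker_mkQ, LinearMap.mem_ker, hmkv]
        simp only [hq]
        exact hc
      obtain ⟨y, hy⟩ := h1
      refine ⟨⟨(q, -y), ?_⟩, ?_⟩
      · rw [LinearMap.mem_ker, hΦ, map_neg, hy, add_neg_cancel]
      · refine Subtype.ext (funext fun i => hq i)
    obtain ⟨ψ, hψ⟩ := factor_surj m hms (Ψ.comp (LinearMap.ker Φ).subtype) (by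
      rintro ⟨⟨q, y⟩, hx⟩ hmx
      have h1 : ∀ i, mk (q i) = 0 := fun i => congrFun (congrArg Subtype.val hmx) i
      choose p hp' using fun i => (hmk0 (q i)).1 (h1 i)
      have h2 : y = - ∑ i, h i (p i) := by
        apply hb
        rw [LinearMap.mem_ker, hΦ] at hx
        rw [eq_neg_of_add_eq_zero_right hx, map_neg, map_sum]
        congr 1
        refine Finset.sum_congr rfl (fun i _ => ?_)
        rw [← hp' i]
        exact LinearMap.congr_fun (hh i) (p i)
      rw [LinearMap.comp_apply, Submodule.subtype_apply, hΨ, h2, map_neg, map_sum,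
        ← sub_eq_add_neg, sub_eq_zero]
      refine Finset.sum_congr rfl (fun i _ => ?_)
      rw [← hp' i]
      exact LinearMap.congr_fun (hu i) (p i))
    intro x hx
    have h1 := hψ ⟨x, hx⟩
    rw [perp_hom hY hK0 ψ, LinearMap.zero_apply] at h1
    exact h1.symm
  obtain ⟨ψ, hψ⟩ := factor_surj Φ hΦs Ψ hker
  refine ⟨ψ, LinearMap.ext fun y => ?_⟩
  have h1 := hψ (0, y)
  rw [hΦ, hΨ] at h1
  simpa using h1

end Aux8

section Aux9
set_option linter.all false
set_option linter.unusedSectionVars false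
set_option linter.style.haveILetI false
variable {A}
variable [IsNoetherianRing A] [IsArtinianRing A]
variable {X Y Z : Type} [AddCommGroup X] [Module A X] [AddCommGroup Y] [Module A Y]
  [AddCommGroup Z] [Module A Z]
variable (K : Type) [Field K] [Algebra K A] [FiniteDimensional K A]
variable {θ η : ModuleCat.{0} A → ℝ} {T : ModuleCat.{0} A → Prop}
variable {P Q B : Type} [AddCommGroup P] [Module A P] [AddCommGroup Q] [Module A Q]
  [AddCommGroup B] [Module A B]

/-- maps whose composition with `b` extends along `f` -/
def DD [Module K B] [IsScalarTower K A B] (f : P →ₗ[A] Q) (b : B →ₗ[A] X) :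
    Submodule K (P →ₗ[A] B) where
  carrier := {h | ∃ u : Q →ₗ[A] X, u.comp f = b.comp h}
  zero_mem' := ⟨0, by simp⟩
  add_mem' := by
    rintro h h' ⟨u, hu⟩ ⟨u', hu'⟩
    exact ⟨u + u', by rw [LinearMap.add_comp, hu, hu', LinearMap.comp_add]⟩
  smul_mem' := by
    rintro c h ⟨u, hu⟩
    letI := kmod K A X
    haveI := kmod_tower K A X
    refine ⟨c • u, LinearMap.ext fun p => ?_⟩
    have h1 : u (f p) = b (h p) := LinearMap.congr_fun hu p
    simp only [LinearMap.comp_apply, LinearMap.smul_apply, h1]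
    exact ((b.restrictScalars K).map_smul c (h p)).symm

theorem mem_DD [Module K B] [IsScalarTower K A B] (f : P →ₗ[A] Q) (b : B →ₗ[A] X) (h : P →ₗ[A] B) :
    h ∈ DD K f b ↔ ∃ u : Q →ₗ[A] X, u.comp f = b.comp h := Iff.rfl

/-- shrinking the target -/
theorem shrink (K : Type) [Field K] [Algebra K A] [FiniteDimensional K A]
    (hθ : IsStability A θ) (b : B →ₗ[A] X) (hX : tThetaBar A θ (ModuleCat.of A X)) :
    ∃ (X1 : Submodule A X) (hb : ∀ y, b y ∈ X1), tThetaBar A θ (ModuleCat.of A X1) ∧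
      tTheta A θ (ModuleCat.of A (X1 ⧸ LinearMap.range (b.codRestrict X1 hb))) := by
  have hT := tTheta_tors hθ
  haveI : Module.Finite A X := hX.1
  obtain ⟨t, ht, -, hp⟩ := exists_tors hT (X ⧸ LinearMap.range b)
  let g : X →ₗ[A] (X ⧸ LinearMap.range b) ⧸ t := t.mkQ.comp (LinearMap.range b).mkQ
  have hg : Function.Surjective g := t.mkQ_surjective.comp (LinearMap.range b).mkQ_surjective
  have hmemt : ∀ x, x ∈ LinearMap.ker g ↔ (LinearMap.range b).mkQ x ∈ t := by
    intro x
    rw [LinearMap.mem_ker]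
    exact Submodule.Quotient.mk_eq_zero t
  have hb : ∀ y, b y ∈ LinearMap.ker g := by
    intro y
    rw [hmemt, show (LinearMap.range b).mkQ (b y) = 0 from
      (Submodule.Quotient.mk_eq_zero _).2 ⟨y, rfl⟩]
    exact t.zero_mem
  refine ⟨LinearMap.ker g, hb, ?_, ?_⟩
  · rw [tThetaBar_iff]
    intro Y _ _ p hpp
    let L := (LinearMap.ker p).map (LinearMap.ker g).subtype
    have e := th_equiv hθ (Submodule.equivMapOfInjective (LinearMap.ker g).subtype
      (LinearMap.ker g).injective_subtype (LinearMap.ker p))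
    have h1 := th_add hθ L
    have h2 := th_surj hθ g hg
    have h3 := th_surj hθ p hpp
    have h4 := perp_tTheta_le K hθ _ _ rfl hp
    have h5 := tThetaBar_iff.1 hX _ L.mkQ L.mkQ_surjective
    have e' : θ (ModuleCat.of A (LinearMap.ker p)) = θ (ModuleCat.of A L) := e
    linarith
  · let m : LinearMap.ker g →ₗ[A] t :=
      ((LinearMap.range b).mkQ.comp (LinearMap.ker g).subtype).codRestrict t
        (fun x => (hmemt x.1).1 x.2)
    have hm : Function.Surjective m := by
      rintro ⟨y, hy⟩
      obtain ⟨x, rfl⟩ := (LinearMap.range b).mkQ_surjective y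
      exact ⟨⟨x, (hmemt x).2 hy⟩, rfl⟩
    obtain ⟨ψ, hψ⟩ := factor_surj m hm
      (LinearMap.range (b.codRestrict (LinearMap.ker g) hb)).mkQ (by
        intro x hx
        have h1 : (LinearMap.range b).mkQ x.1 = 0 := congrArg Subtype.val hx
        obtain ⟨y, hy⟩ := (Submodule.Quotient.mk_eq_zero _).1 h1
        exact (Submodule.Quotient.mk_eq_zero _).2 ⟨y, Subtype.ext hy⟩)
    refine tors_surj hT ht ψ ?_
    intro y
    obtain ⟨x, rfl⟩ := Submodule.mkQ_surjective _ y
    exact ⟨m x, hψ x⟩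

theorem core1_best (hθ : IsStability A θ) [Module.Finite A P] [Module.Finite A B] [Module K B]
    [IsScalarTower K A B] (f : P →ₗ[A] Q)
    (hex : ∃ (X : Type) (_ : AddCommGroup X) (_ : Module A X) (b : B →ₗ[A] X),
      tThetaBar A θ (ModuleCat.of A X) ∧ Function.Injective b) :
    ∃ (X : Type) (_ : AddCommGroup X) (_ : Module A X) (b : B →ₗ[A] X),
      tThetaBar A θ (ModuleCat.of A X) ∧ Function.Injective b ∧
      tTheta A θ (ModuleCat.of A (X ⧸ LinearMap.range b)) ∧
      ∀ (Y : Type) [AddCommGroup Y] [Module A Y] (β : B →ₗ[A] Y), tThetaBar A θ (ModuleCat.of A Y) →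
        DD K f b ≤ DD K f β := by
  classical
  haveI : Module.Finite K (P →ₗ[A] B) := hom_fin (A := A) K
  have hT := tThetaBar_tors hθ
  let pr : ℕ → Prop := fun n => ∃ (X : Type) (_ : AddCommGroup X) (_ : Module A X) (b : B →ₗ[A] X),
      tThetaBar A θ (ModuleCat.of A X) ∧ Function.Injective b ∧ Module.finrank K (DD K f b) = n
  have hpr : ∃ n, pr n := by
    obtain ⟨X, _, _, b, h1, h2⟩ := hex
    exact ⟨_, X, _, _, b, h1, h2, rfl⟩
  obtain ⟨X0, _, _, b0, hX0, hb0, hn⟩ := Nat.find_spec hpr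
  have hmin : ∀ (Y : Type) [AddCommGroup Y] [Module A Y] (β : B →ₗ[A] Y),
      tThetaBar A θ (ModuleCat.of A Y) → DD K f b0 ≤ DD K f β := by
    intro Y _ _ β hY
    have hinj : Function.Injective (b0.prod β) := by
      intro x y hxy
      exact hb0 (congrArg Prod.fst hxy)
    have h1 : Nat.find hpr ≤ Module.finrank K (DD K f (b0.prod β)) :=
      Nat.find_min' hpr ⟨X0 × Y, inferInstance, inferInstance, b0.prod β, tors_prod hT hX0 hY, hinj, rfl⟩
    have hle0 : DD K f (b0.prod β) ≤ DD K f b0 := by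
      rintro h ⟨u, hu⟩
      refine ⟨(LinearMap.fst A X0 Y).comp u, LinearMap.ext fun p => ?_⟩
      exact congrArg Prod.fst (LinearMap.congr_fun hu p)
    have hle1 : DD K f (b0.prod β) ≤ DD K f β := by
      rintro h ⟨u, hu⟩
      refine ⟨(LinearMap.snd A X0 Y).comp u, LinearMap.ext fun p => ?_⟩
      exact congrArg Prod.snd (LinearMap.congr_fun hu p)
    rw [← Submodule.eq_of_le_of_finrank_le hle0 (by omega)]
    exact hle1
  obtain ⟨X1, hb1, hX1, hq⟩ := shrink K hθ b0 hX0
  refine ⟨X1, inferInstance, inferInstance, b0.codRestrict X1 hb1, hX1, ?_, hq, ?_⟩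
  · intro x y hxy
    exact hb0 (congrArg Subtype.val hxy)
  · intro Y _ _ β hY
    refine le_trans ?_ (hmin Y β hY)
    rintro h ⟨u, hu⟩
    refine ⟨X1.subtype.comp u, LinearMap.ext fun p => ?_⟩
    exact congrArg Subtype.val (LinearMap.congr_fun hu p)

theorem core1_hat (hθ : IsStability A θ) {f : P →ₗ[A] Q} (hp : Pkg (tTheta A θ) f)
    [Module.Finite A B] [Module K B] [IsScalarTower K A B]
    (hex : ∃ (X : Type) (_ : AddCommGroup X) (_ : Module A X) (b : B →ₗ[A] X),
      tThetaBar A θ (ModuleCat.of A X) ∧ Function.Injective b) :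
    ∃ (X : Type) (_ : AddCommGroup X) (_ : Module A X) (b : B →ₗ[A] X),
      tThetaBar A θ (ModuleCat.of A X) ∧
      ∀ (Y : Type) [AddCommGroup Y] [Module A Y] (β : B →ₗ[A] Y), tThetaBar A θ (ModuleCat.of A Y) →
        ∃ h : X →ₗ[A] Y, h.comp b = β := by
  classical
  haveI := hp.finP
  haveI := hp.finQ
  have hT := tThetaBar_tors hθ
  obtain ⟨X1, _, _, b1, hX1, hb1, hq, hD⟩ := core1_best K hθ f hex
  haveI : Module.Finite A X1 := hX1.1
  haveI : Module.Finite K (P →ₗ[A] B) := hom_fin (A := A) K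
  let bas := Module.finBasis K (DD K f b1)
  let d := Module.finrank K (DD K f b1)
  let h : Fin d → (P →ₗ[A] B) := fun i => (bas i : P →ₗ[A] B)
  have hspan : ∀ (Y : Type) [AddCommGroup Y] [Module A Y] (β : B →ₗ[A] Y),
      (∀ i, ∃ u : Q →ₗ[A] Y, u.comp f = β.comp (h i)) → DD K f b1 ≤ DD K f β := by
    intro Y _ _ β hi g hg
    have h1 := congrArg (DD K f b1).subtype (bas.sum_repr ⟨g, hg⟩)
    rw [map_sum] at h1
    have h2 : g = ∑ i, bas.repr ⟨g, hg⟩ i • h i := h1.symm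
    rw [h2]
    exact Submodule.sum_mem _ (fun i _ => Submodule.smul_mem _ _ (hi i))
  let r : (Fin d → P) →ₗ[A] (Fin d → Q) × B :=
    (LinearMap.pi (fun i => f.comp (LinearMap.proj i))).prod
      (-(LinearMap.lsum A (fun _ : Fin d => P) ℕ h))
  have hr : ∀ p, r p = (fun i => f (p i), - ∑ i, h i (p i)) := by
    intro p
    refine Prod.ext rfl ?_
    simp [r, LinearMap.lsum_apply, LinearMap.sum_apply]
  let W := LinearMap.range r
  let j : Fin d → (Q →ₗ[A] ((Fin d → Q) × B) ⧸ W) := fun i =>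
    W.mkQ.comp ((LinearMap.inl A (Fin d → Q) B).comp (LinearMap.single A (fun _ : Fin d => Q) i))
  let bh : B →ₗ[A] ((Fin d → Q) × B) ⧸ W := W.mkQ.comp (LinearMap.inr A (Fin d → Q) B)
  have hj : ∀ i p, j i (f p) = bh (h i p) := by
    intro i p
    rw [← sub_eq_zero]
    refine (map_sub W.mkQ _ _).symm.trans ((Submodule.Quotient.mk_eq_zero W).2 ?_)
    refine ⟨Pi.single i p, ?_⟩
    rw [hr]
    refine Prod.ext ?_ ?_
    · funext i'
      by_cases hii : i' = i
      · subst hii; simp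
      · simp [Pi.single_eq_of_ne hii]
    · simp only [LinearMap.inl_apply, LinearMap.inr_apply, LinearMap.comp_apply, Prod.snd_sub, zero_sub]
      congr 1
      rw [Finset.sum_eq_single i]
      · simp
      · intro b _ hb; simp [Pi.single_eq_of_ne hb]
      · simp
  have hdec : ∀ (q : Fin d → Q) (y : B), W.mkQ (q, y) = ∑ i, j i (q i) + bh y := by
    intro q y
    have h1 : ((q, y) : (Fin d → Q) × B) =
        ∑ i, (LinearMap.inl A (Fin d → Q) B) (Pi.single i (q i)) + LinearMap.inr A (Fin d → Q) B y := by
      rw [← map_sum, Finset.univ_sum_single]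
      simp
    rw [h1, map_add, map_sum]
    rfl
  refine ⟨((Fin d → Q) × B) ⧸ W, inferInstance, inferInstance, bh, ?_, ?_⟩
  · refine tors_of_hom_perp hT ?_
    intro Y _ _ hY ρ
    have hYF : rightPerp A (tTheta A θ) (ModuleCat.of A Y) :=
      ⟨hY.1, fun M hM g => hY.2 M (tTheta_le hθ hM) g⟩
    obtain ⟨ψ, hψ⟩ := core1_ext (tTheta_tors hθ) hp K b1 hb1 hq hYF (ρ.comp bh) (by
      refine hspan Y (ρ.comp bh) ?_
      intro i
      refine ⟨ρ.comp (j i), LinearMap.ext fun p => ?_⟩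
      simp only [LinearMap.comp_apply, hj])
    have hβ : ρ.comp bh = 0 := by
      rw [← hψ, perp_hom hY hX1 ψ, LinearMap.zero_comp]
    have hji : ∀ i, ρ.comp (j i) = 0 := by
      intro i
      obtain ⟨g, hg⟩ := factor_surj (LinearMap.range f).mkQ (Submodule.mkQ_surjective _)
        (ρ.comp (j i)) (by
          intro q hq
          obtain ⟨p, rfl⟩ := (Submodule.Quotient.mk_eq_zero _).1 hq
          rw [LinearMap.comp_apply, hj]
          exact LinearMap.congr_fun hβ _)
      refine LinearMap.ext fun q => ?_
      rw [← hg, perp_hom hYF hp.tC g]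
      rfl
    refine LinearMap.ext fun x => ?_
    obtain ⟨⟨q, y⟩, rfl⟩ := W.mkQ_surjective x
    rw [hdec, map_add, map_sum]
    have h1 : ρ (bh y) = 0 := LinearMap.congr_fun hβ y
    have h2 : ∀ i, ρ (j i (q i)) = 0 := fun i => LinearMap.congr_fun (hji i) (q i)
    rw [h1, Finset.sum_eq_zero (fun i _ => h2 i)]
    simp
  · intro Y _ _ β hY
    have hu : ∀ i, ∃ u : Q →ₗ[A] Y, u.comp f = β.comp (h i) := fun i => hD Y β hY (bas i).2
    choose u hu using hu
    have hm : ∀ q y, ((LinearMap.lsum A (fun _ : Fin d => Q) ℕ u).coprod β) (q, y) =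
        ∑ i, u i (q i) + β y := by
      intro q y; simp [LinearMap.lsum_apply, LinearMap.sum_apply]
    refine ⟨W.liftQ ((LinearMap.lsum A (fun _ : Fin d => Q) ℕ u).coprod β) ?_, ?_⟩
    · rintro _ ⟨p, rfl⟩
      rw [LinearMap.mem_ker, hr, hm, map_neg, map_sum, ← sub_eq_add_neg, sub_eq_zero]
      exact Finset.sum_congr rfl (fun i _ => LinearMap.congr_fun (hu i) (p i))
    · refine LinearMap.ext fun y => ?_
      refine (hm 0 y).trans ?_
      simp

theorem core1 (hθ : IsStability A θ) {f : P →ₗ[A] Q} (hp : Pkg (tTheta A θ) f)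
    (K : Type) [Field K] [Algebra K A] [FiniteDimensional K A] :
    FunctoriallyFinite A (tThetaBar A θ) := by
  have hT := tThetaBar_tors hθ
  refine ff_of_lapp hT ?_
  obtain ⟨Z, ⟨X0, _, _, x0, hX0, hZ⟩, hmin⟩ := WellFounded.has_min (wellFounded_lt (α := Submodule A A))
    {Z | ∃ (X : Type) (_ : AddCommGroup X) (_ : Module A X) (x : X), tThetaBar A θ (ModuleCat.of A X) ∧
      Z = LinearMap.ker (LinearMap.toSpanSingleton A X x)}
    ⟨_, PUnit, inferInstance, inferInstance, 0, tors_subsingleton hT, rfl⟩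
  have hle : ∀ (X : Type) [AddCommGroup X] [Module A X] (x : X), tThetaBar A θ (ModuleCat.of A X) →
      Z ≤ LinearMap.ker (LinearMap.toSpanSingleton A X x) := by
    intro X _ _ x hX
    have h1 := hmin _ ⟨X0 × X, inferInstance, inferInstance, (x0, x), tors_prod hT hX0 hX, rfl⟩
    have h2 : LinearMap.ker (LinearMap.toSpanSingleton A (X0 × X) (x0, x)) ≤ Z := by
      rw [hZ]
      intro a ha
      exact congrArg Prod.fst ha
    have h3 := eq_of_le_of_not_lt h2 h1
    rw [← h3]
    intro a ha
    exact congrArg Prod.snd ha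
  letI := kmod K A (A ⧸ Z)
  haveI := kmod_tower K A (A ⧸ Z)
  obtain ⟨X, _, _, b, hX, hb⟩ := core1_hat (B := A ⧸ Z) K hθ hp
    ⟨X0, _, _, Z.liftQ (LinearMap.toSpanSingleton A X0 x0) (hle X0 x0 hX0), hX0, by
      rw [← LinearMap.ker_eq_bot]
      exact Submodule.ker_liftQ_eq_bot _ _ _ hZ.ge⟩
  refine ⟨X, _, _, b (Z.mkQ 1), hX, ?_⟩
  intro Y _ _ hY y
  obtain ⟨h, hh⟩ := hb Y (Z.liftQ (LinearMap.toSpanSingleton A Y y) (hle Y y hY)) hY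
  refine ⟨h, ?_⟩
  have h1 := LinearMap.congr_fun hh (Z.mkQ 1)
  refine h1.trans ?_
  exact (LinearMap.toSpanSingleton_apply A Y y 1).trans (one_smul A y)

end Aux9

section Aux10
set_option linter.all false
set_option linter.unusedSectionVars false
set_option linter.style.haveILetI false
variable {A}
variable [IsNoetherianRing A] [IsArtinianRing A]
variable {X Y Z : Type} [AddCommGroup X] [Module A X] [AddCommGroup Y] [Module A Y]
  [AddCommGroup Z] [Module A Z]
variable (K : Type) [Field K] [Algebra K A] [FiniteDimensional K A]
variable {θ η : ModuleCat.{0} A → ℝ} {T : ModuleCat.{0} A → Prop}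

theorem compact_of_lapp (hT : IsTorsionClass A T) (h : LApp T) : IsCompactTors A T := by
  classical
  obtain ⟨C0, _, _, c0, hC, hc⟩ := h
  refine ⟨ModuleCat.of A C0, tors_fin hT hC, ?_⟩
  funext X
  refine propext ⟨fun hX T' hT' h' => ?_, fun h => h T hT (by rintro Y rfl; exact hC)⟩
  have hC' : T' (ModuleCat.of A C0) := h' _ rfl
  haveI : Module.Finite A X := hT.fin _ hX
  obtain ⟨n, π, hπ⟩ := Module.Finite.exists_fin' A X
  have h1 : ∀ i, ∃ h : C0 →ₗ[A] X, h c0 = π (Pi.single i 1) := fun i => hc X hX _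
  choose H hH using h1
  refine tors_surj (Y := X) hT' (tors_pi hT' hC' n) (LinearMap.lsum A (fun _ : Fin n => C0) ℕ H) ?_
  intro x
  obtain ⟨a, rfl⟩ := hπ x
  refine ⟨fun i => a i • c0, ?_⟩
  simp only [LinearMap.lsum_apply, LinearMap.sum_apply, LinearMap.comp_apply, LinearMap.proj_apply,
    map_smul, hH]
  conv_rhs => rw [pi_eq_sum_univ a, map_sum]
  refine Finset.sum_congr rfl fun i _ => ?_
  rw [map_smul]
  congr 2
  funext j
  simp [Pi.single_apply, eq_comm]

theorem lapp_min (hT : IsTorsionClass A T) (h : LApp T)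
    (K : Type) [Field K] [Algebra K A] [FiniteDimensional K A] :
    ∃ (C0 : Type) (_ : AddCommGroup C0) (_ : Module A C0) (c0 : C0), T (ModuleCat.of A C0) ∧
    (∀ (X : Type) [AddCommGroup X] [Module A X], T (ModuleCat.of A X) → ∀ x : X,
      ∃ h : C0 →ₗ[A] X, h c0 = x) ∧
    ∀ σ : C0 →ₗ[A] C0, σ c0 = c0 → Function.Bijective σ := by
  obtain ⟨C, _, _, c, hC, hc⟩ := h
  obtain ⟨n, ⟨C0, _, _, c0, hn, hC0, hc0⟩, hmin⟩ := WellFounded.has_min (wellFounded_lt (α := ℕ))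
    {n | ∃ (C0 : Type) (_ : AddCommGroup C0) (_ : Module A C0) (c0 : C0),
      dm K (ModuleCat.of A C0) = n ∧ T (ModuleCat.of A C0) ∧
      ∀ (X : Type) [AddCommGroup X] [Module A X], T (ModuleCat.of A X) → ∀ x : X,
      ∃ h : C0 →ₗ[A] X, h c0 = x} ⟨_, C, _, _, c, rfl, hC, hc⟩
  refine ⟨C0, _, _, c0, hC0, hc0, ?_⟩
  intro σ hσ
  haveI : Module.Finite A C0 := tors_fin hT hC0
  have hs : LinearMap.range σ = ⊤ := by
    by_contra hne
    refine hmin _ ⟨LinearMap.range σ, _, _, ⟨c0, c0, hσ⟩, rfl, tors_range hT hC0 σ, ?_⟩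
      (hn ▸ dm_sub_lt K hne)
    intro X _ _ hX x
    obtain ⟨h, hh⟩ := hc0 X hX x
    exact ⟨h.comp (LinearMap.range σ).subtype, hh⟩
  have hs' := LinearMap.range_eq_top.1 hs
  exact ⟨IsNoetherian.injective_of_surjective_endomorphism σ hs', hs'⟩

theorem rigid_ext (hT : IsTorsionClass A T) {C0 : Type} [AddCommGroup C0] [Module A C0] {c0 : C0}
    (hC : T (ModuleCat.of A C0))
    (hc : ∀ (X : Type) [AddCommGroup X] [Module A X], T (ModuleCat.of A X) → ∀ x : X,
      ∃ h : C0 →ₗ[A] X, h c0 = x)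
    (hb : ∀ σ : C0 →ₗ[A] C0, σ c0 = c0 → Function.Bijective σ)
    {Q : Type} [AddCommGroup Q] [Module A Q] (π : Q →ₗ[A] C0) (hπ : Function.Surjective π)
    (hX : T (ModuleCat.of A X)) (g : LinearMap.ker π →ₗ[A] X) :
    ∃ u : Q →ₗ[A] X, ∀ k : LinearMap.ker π, u k = g k := by
  let W : Submodule A (Q × X) := LinearMap.range ((LinearMap.ker π).subtype.prod (-g))
  let i : X →ₗ[A] ((Q × X) ⧸ W) := W.mkQ.comp (LinearMap.inr A Q X)
  let p : ((Q × X) ⧸ W) →ₗ[A] C0 := W.liftQ (π.comp (LinearMap.fst A Q X)) (by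
    rintro _ ⟨k, rfl⟩
    exact k.2)
  have hpm : ∀ z, p (W.mkQ z) = π z.1 := fun z => rfl
  have hp : Function.Surjective p := by
    intro c
    obtain ⟨q, rfl⟩ := hπ c
    exact ⟨W.mkQ (q, 0), rfl⟩
  have hWk : ∀ k : LinearMap.ker π, W.mkQ ((k : Q), 0) = i (g k) := by
    intro k
    refine (Submodule.Quotient.eq W).2 ⟨k, ?_⟩
    simp
  have hker : LinearMap.ker p ≤ LinearMap.range i := by
    intro z hz
    obtain ⟨⟨q, x⟩, rfl⟩ := W.mkQ_surjective z
    have hq : π q = 0 := hz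
    refine ⟨g ⟨q, hq⟩ + x, ?_⟩
    rw [map_add, ← hWk]
    show W.mkQ _ + W.mkQ _ = _
    rw [← map_add]
    simp
  have hi : Function.Injective i := by
    rw [injective_iff_map_eq_zero]
    intro x hx
    obtain ⟨k, hk⟩ := (Submodule.Quotient.mk_eq_zero W).1 hx
    have h1 : (k : Q) = 0 := congrArg Prod.fst hk
    have h2 : - g k = x := congrArg Prod.snd hk
    have h3 : k = 0 := Subtype.ext h1
    rw [← h2, h3]; simp
  have hE := tors_exact hT i p hp hker hX hC
  obtain ⟨e, he⟩ := hp c0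
  obtain ⟨H, hH⟩ := hc _ hE e
  let τ := LinearEquiv.ofBijective (p.comp H) (hb (p.comp H) (by rw [LinearMap.comp_apply, hH, he]))
  let s : C0 →ₗ[A] ((Q × X) ⧸ W) := H.comp τ.symm.toLinearMap
  have hs : ∀ c, p (s c) = c := fun c => τ.apply_symm_apply c
  let r0 : ((Q × X) ⧸ W) →ₗ[A] LinearMap.range i :=
    (LinearMap.id - s.comp p).codRestrict _ (fun z => hker (by
      simp [LinearMap.mem_ker, hs]))
  let r := (LinearEquiv.ofInjective i hi).symm.toLinearMap.comp r0
  have hr : ∀ z, i (r z) = z - s (p z) := by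
    intro z
    have := (LinearEquiv.ofInjective i hi).apply_symm_apply (r0 z)
    exact congrArg Subtype.val this
  refine ⟨r.comp (W.mkQ.comp (LinearMap.inl A Q X)), fun k => hi ?_⟩
  refine (hr _).trans ?_
  show W.mkQ ((k : Q), 0) - s (π k) = _
  rw [hWk, show π k = 0 from k.2, map_zero, sub_zero]

theorem pres_ext (hT : IsTorsionClass A T) {C0 : Type} [AddCommGroup C0] [Module A C0] {c0 : C0}
    (hC : T (ModuleCat.of A C0))
    (hc : ∀ (X : Type) [AddCommGroup X] [Module A X], T (ModuleCat.of A X) → ∀ x : X,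
      ∃ h : C0 →ₗ[A] X, h c0 = x)
    (hb : ∀ σ : C0 →ₗ[A] C0, σ c0 = c0 → Function.Bijective σ)
    {Q : Type} [AddCommGroup Q] [Module A Q] [Module.Finite A Q] [Module.Projective A Q]
    (π : Q →ₗ[A] C0) (hπ : Function.Surjective π)
    (K : Type) [Field K] [Algebra K A] [FiniteDimensional K A] :
    ∃ (P : Type) (_ : AddCommGroup P) (_ : Module A P) (f : P →ₗ[A] Q), Module.Finite A P ∧
      Module.Projective A P ∧ LinearMap.range f = LinearMap.ker π ∧
      ∀ (X : Type) [AddCommGroup X] [Module A X], T (ModuleCat.of A X) → ∀ h : P →ₗ[A] X,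
        ∃ u : Q →ₗ[A] X, u.comp f = h := by
  obtain ⟨P, _, _, ρ, hP, hPp, hρ, hcov⟩ := proj_cover (A := A) K (LinearMap.ker π)
  refine ⟨P, _, _, (LinearMap.ker π).subtype.comp ρ, hP, hPp, ?_, ?_⟩
  · rw [LinearMap.range_comp, LinearMap.range_eq_top.2 hρ, Submodule.map_top, Submodule.range_subtype]
  · intro X _ _ hX h
    let X1 := (LinearMap.ker ρ).map h
    obtain ⟨g, hg⟩ := factor_surj ρ hρ (X1.mkQ.comp h) (by
      intro x hx
      exact (Submodule.Quotient.mk_eq_zero X1).2 ⟨x, hx, rfl⟩)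
    obtain ⟨u, hu⟩ := rigid_ext hT hC hc hb π hπ (tors_surj hT hX X1.mkQ X1.mkQ_surjective) g
    obtain ⟨v, hv⟩ := Module.projective_lifting_property X1.mkQ u X1.mkQ_surjective
    refine ⟨v, ?_⟩
    let h' : P →ₗ[A] X := h - v.comp ((LinearMap.ker π).subtype.comp ρ)
    have h1 : ∀ z, h' z ∈ X1 := by
      intro z
      rw [← Submodule.Quotient.mk_eq_zero X1]
      show X1.mkQ (h' z) = 0
      have h2 : X1.mkQ (v (ρ z)) = u (ρ z) := LinearMap.congr_fun hv _
      have h3 : X1.mkQ (h z) = g (ρ z) := (hg z).symm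
      show X1.mkQ (h z - v (ρ z)) = 0
      rw [map_sub, h2, h3, hu, sub_self]
    have h2 : LinearMap.ker h' = ⊤ := by
      refine hcov _ (eq_top_iff.2 fun z _ => ?_)
      obtain ⟨k, hk, hkz⟩ := h1 z
      have hk' : h' k = h k := by
        show h k - v (ρ k) = h k
        rw [show ρ k = 0 from hk]; simp
      have : z = (z - k) + k := by abel
      rw [this]
      refine Submodule.add_mem_sup ?_ hk
      rw [LinearMap.mem_ker, map_sub, hk', ← hkz, sub_self]
    refine LinearMap.ext fun z => ?_
    have h3 : h' z = 0 := by
      have : z ∈ LinearMap.ker h' := by rw [h2]; trivial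
      exact this
    exact (sub_eq_zero.1 h3).symm

/-- numerical presentation of a functorially finite torsion class -/
theorem tors_pres (hT : IsTorsionClass A T) (h : LApp T)
    (K : Type) [Field K] [Algebra K A] [FiniteDimensional K A] :
    ∃ (Q : Type) (_ : AddCommGroup Q) (_ : Module A Q) (n : ℕ) (q : Fin n → Q), Module.Finite A Q ∧
      Module.Projective A Q ∧
      (∀ (X : Type) [AddCommGroup X] [Module A X], T (ModuleCat.of A X) → ∀ x : Fin n → X,
        ∃ u : Q →ₗ[A] X, ∀ i, u (q i) = x i) ∧
      (∀ (Y : Type) [AddCommGroup Y] [Module A Y], rightPerp A T (ModuleCat.of A Y) →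
        (∀ x : Fin n → Y, ∃ u : Q →ₗ[A] Y, ∀ i, u (q i) = x i) → Subsingleton Y) := by
  classical
  obtain ⟨C0, _, _, c0, hC, hc, hb⟩ := lapp_min hT h K
  haveI : Module.Finite A C0 := tors_fin hT hC
  obtain ⟨m, π, hπ⟩ := Module.Finite.exists_fin' A C0
  obtain ⟨P, _, _, f, hP, hPp, hf, hext⟩ := pres_ext hT hC hc hb π hπ K
  obtain ⟨n, p, hp⟩ := Module.Finite.exists_fin' A P
  obtain ⟨s, hs⟩ := Module.projective_lifting_property p LinearMap.id hp
  have hs' : ∀ z, p (s z) = z := fun z => LinearMap.congr_fun hs z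
  obtain ⟨a, ha⟩ := hπ c0
  let q : Fin (n + 1) → (Fin m → A) × (Fin n → A) :=
    Fin.snoc (α := fun _ => (Fin m → A) × (Fin n → A))
      (fun i => (f (p (Pi.single i 1)), Pi.single i 1 - s (p (Pi.single i 1)))) (a, 0)
  refine ⟨(Fin m → A) × (Fin n → A), _, _, n + 1, q, inferInstance, inferInstance, ?_, ?_⟩
  · intro X _ _ hX x
    let h0 : (Fin n → A) →ₗ[A] X := Fintype.linearCombination A (fun i => x i.castSucc)
    have hh0 : ∀ i, h0 (Pi.single i 1) = x i.castSucc := by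
      intro i
      simp [h0, Fintype.linearCombination_apply, Pi.single_apply]
    obtain ⟨u, hu⟩ := hext X hX (h0.comp s)
    obtain ⟨g, hg⟩ := hc X hX (x (Fin.last n) - u a)
    have hfπ : ∀ z, π (f z) = 0 := fun z => by
      have : f z ∈ LinearMap.ker π := hf ▸ ⟨z, rfl⟩
      exact this
    refine ⟨(u + g.comp π).coprod h0, fun i => ?_⟩
    refine Fin.lastCases ?_ (fun j => ?_) i
    · simp [q, ha, hg]
    · have h1 : u (f (p (Pi.single j 1))) = h0 (s (p (Pi.single j 1))) := LinearMap.congr_fun hu _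
      simp [q, hfπ, h1, hh0]
  · intro Y _ _ hY hx
    refine ⟨fun y z => ?_⟩
    have key : ∀ y : Y, y = 0 := by
      intro y
      obtain ⟨u, hu⟩ := hx (Fin.snoc (α := fun _ => Y) (fun _ => 0) y)
      have hu1 := hu (Fin.last n)
      have hu2 := fun j : Fin n => hu j.castSucc
      simp only [q, Fin.snoc_last, Fin.snoc_castSucc] at hu1 hu2
      let φ : (Fin n → A) →ₗ[A] (Fin m → A) × (Fin n → A) :=
        (f.comp p).prod (LinearMap.id - s.comp p)
      have h1 : u.comp φ = 0 := by
        refine LinearMap.pi_ext' (fun i => ?_)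
        refine LinearMap.ext_ring ?_
        exact hu2 i
      have h2 : ∀ z, u (f z, 0) = 0 := by
        intro z
        have h4 : φ (s z) = (f z, 0) := by
          refine Prod.ext ?_ ?_
          · show f (p (s z)) = f z
            rw [hs']
          · show s z - s (p (s z)) = 0
            rw [hs', sub_self]
        rw [← h4]
        exact LinearMap.congr_fun h1 (s z)
      obtain ⟨g, hg⟩ := factor_surj π hπ (u.comp (LinearMap.inl A _ _)) (by
        intro w hw
        have : w ∈ LinearMap.range f := hf ▸ hw
        obtain ⟨z, rfl⟩ := this
        exact h2 z)
      have h3 := hg a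
      rw [perp_hom hY hC g] at h3
      rw [← hu1]
      exact h3.symm
    rw [key y, key z]

end Aux10

section Aux11
set_option linter.all false
set_option linter.unusedSectionVars false
set_option linter.style.haveILetI false
variable {A}
variable [IsNoetherianRing A] [IsArtinianRing A]
variable {X Y Z : Type} [AddCommGroup X] [Module A X] [AddCommGroup Y] [Module A Y]
  [AddCommGroup Z] [Module A Z]
variable (K : Type) [Field K] [Algebra K A] [FiniteDimensional K A]
variable {θ η : ModuleCat.{0} A → ℝ} {T : ModuleCat.{0} A → Prop}

/-- The `A`-module structure on the dual of `A ^ n`, by right multiplication. -/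
@[reducible] def dualFree (A : Type) [Ring A] [Algebra K A] (n : ℕ) :
    Module A ((Fin n → A) →ₗ[K] K) where
  smul a w := w.comp (LinearMap.pi (fun i => (LinearMap.mulRight K a).comp (LinearMap.proj i)))
  one_smul w := by
    refine LinearMap.ext fun b => ?_
    show w (fun i => b i * 1) = w b
    simp
  mul_smul a a' w := by
    refine LinearMap.ext fun b => ?_
    show w (fun i => b i * (a * a')) = w (fun i => b i * a * a')
    simp [mul_assoc]
  smul_zero a := rfl
  smul_add a w w' := rfl
  add_smul a a' w := by
    refine LinearMap.ext fun b => ?_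
    show w (fun i => b i * (a + a')) = w (fun i => b i * a) + w (fun i => b i * a')
    rw [← map_add]
    simp only [mul_add]
    rfl
  zero_smul w := by
    refine LinearMap.ext fun b => ?_
    show w (fun i => b i * 0) = 0
    simp only [mul_zero]
    exact map_zero w

theorem cocompact_of_lapp (hT : IsTorsionClass A T) (h : LApp T)
    (K : Type) [Field K] [Algebra K A] [FiniteDimensional K A] : IsCocompactTors A T := by
  classical
  obtain ⟨Q, _, _, n, q, hQ, hQp, hq1, hq2⟩ := tors_pres hT h K
  letI := dualFree K A n
  have hact : ∀ (a : A) (w : (Fin n → A) →ₗ[K] K) (b : Fin n → A), (a • w) b = w (fun i => b i * a) :=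
    fun a w b => rfl
  let N : Submodule A ((Fin n → A) →ₗ[K] K) :=
    { carrier := {w | ∀ β : Q →ₗ[A] A, w (fun i => β (q i)) = 0}
      zero_mem' := fun β => rfl
      add_mem' := by
        intro v w hv hw β
        rw [LinearMap.add_apply, hv, hw, add_zero]
      smul_mem' := by
        intro a w hw β
        rw [hact]
        exact hw ((LinearMap.toSpanSingleton A A a).comp β) }
  have hNmem : ∀ w : N, ∀ β : Q →ₗ[A] A, (w : (Fin n → A) →ₗ[K] K) (fun i => β (q i)) = 0 :=
    fun w => w.2
  haveI : IsScalarTower K A ((Fin n → A) →ₗ[K] K) := by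
    refine ⟨fun k a w => LinearMap.ext fun b => ?_⟩
    rw [hact]
    show w _ = k • (a • w) b
    rw [hact, ← map_smul]
    congr 1
    funext i
    simp
  haveI : Module.Finite A ((Fin n → A) →ₗ[K] K) := Module.Finite.of_restrictScalars_finite K A _
  haveI hNfin : Module.Finite A N := inferInstance
  have hNF : rightPerp A T (ModuleCat.of A N) := by
    refine ⟨hNfin, fun M hM ψ' => ?_⟩
    let ψ : M →ₗ[A] N := ψ'
    show ψ = 0
    obtain ⟨m, p, hp⟩ := Module.Finite.exists_fin' A Q
    obtain ⟨s, hs⟩ := Module.projective_lifting_property p LinearMap.id hp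
    have hs' : ∀ z, p (s z) = z := fun z => LinearMap.congr_fun hs z
    let Λ : M → ((Fin n → A) →ₗ[K] K) := fun x => (ψ x : (Fin n → A) →ₗ[K] K)
    have hΛ : ∀ (a : A) x b, Λ (a • x) b = Λ x (fun i => b i * a) := by
      intro a x b
      show ((ψ (a • x) : N) : (Fin n → A) →ₗ[K] K) b = _
      rw [map_smul]
      rfl
    have hΛs : ∀ (ι : Type) (t : Finset ι) (x : ι → M), Λ (∑ j ∈ t, x j) = ∑ j ∈ t, Λ (x j) := by
      intro ι t x
      show ((ψ _ : N) : (Fin n → A) →ₗ[K] K) = _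
      rw [map_sum]
      exact map_sum N.subtype _ _
    have h1 : ∀ x : Fin n → M, ∑ i, Λ (x i) (Pi.single i 1) = 0 := by
      intro x
      obtain ⟨u, hu⟩ := hq1 M hM x
      let v : Fin m → M := fun j => u (p (Pi.single j 1))
      have h2 : ∀ z : Q, u z = ∑ j, s z j • v j := by
        intro z
        conv_lhs => rw [← hs' z, pi_eq_sum_univ (s z), map_sum, map_sum]
        refine Finset.sum_congr rfl fun j _ => ?_
        rw [map_smul, map_smul]
        congr 3
        funext l
        simp [Pi.single_apply, eq_comm]
      have h3 : ∀ i, Λ (x i) (Pi.single i 1) = ∑ j, Λ (v j) (Pi.single i (s (q i) j)) := by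
        intro i
        rw [← hu, h2, hΛs, LinearMap.sum_apply]
        refine Finset.sum_congr rfl fun j _ => ?_
        rw [hΛ]
        congr 1
        funext l
        by_cases hl : l = i
        · subst hl; simp
        · simp [Pi.single_eq_of_ne hl]
      rw [Finset.sum_congr rfl (fun i _ => h3 i), Finset.sum_comm]
      refine Finset.sum_eq_zero fun j _ => ?_
      rw [← map_sum, Finset.univ_sum_single (fun i => s (q i) j)]
      exact hNmem (ψ (v j)) ((LinearMap.proj j).comp s)
    have h4 : ∀ x i, Λ x (Pi.single i 1) = 0 := by
      intro x i
      have := h1 (Pi.single i x)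
      rw [Finset.sum_eq_single i] at this
      · simpa using this
      · intro l _ hl
        rw [Pi.single_eq_of_ne hl]
        show ((ψ 0 : N) : (Fin n → A) →ₗ[K] K) _ = 0
        rw [map_zero]
        rfl
      · simp
    refine LinearMap.ext fun x => Subtype.ext (LinearMap.ext fun b => ?_)
    show Λ x b = 0
    rw [← Finset.univ_sum_single b, map_sum]
    refine Finset.sum_eq_zero fun i _ => ?_
    rw [← h4 (b i • x) i, hΛ]
    congr 1
    funext l
    by_cases hl : l = i
    · subst hl; simp
    · simp [Pi.single_eq_of_ne hl]
  have hcog : ∀ (Y : Type) [AddCommGroup Y] [Module A Y], rightPerp A T (ModuleCat.of A Y) →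
      (∀ φ : Y →ₗ[A] N, φ = 0) → Subsingleton Y := by
    intro Y _ _ hY hφ
    letI := kmod K A Y
    haveI := kmod_tower K A Y
    refine hq2 Y hY ?_
    by_contra hne
    let R : (Q →ₗ[A] Y) →ₗ[K] (Fin n → Y) :=
      { toFun := fun u i => u (q i)
        map_add' := fun u v => rfl
        map_smul' := fun k u => rfl }
    have hR : LinearMap.range R < ⊤ := by
      refine lt_top_iff_ne_top.2 fun hR => hne fun x => ?_
      obtain ⟨u, hu⟩ := LinearMap.range_eq_top.1 hR x
      exact ⟨u, fun i => congrFun hu i⟩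
    obtain ⟨l, hl0, hl⟩ := Submodule.exists_le_ker_of_lt_top _ hR
    have hl' : ∀ u : Q →ₗ[A] Y, l (fun i => u (q i)) = 0 := fun u => hl ⟨u, rfl⟩
    let w : Y → ((Fin n → A) →ₗ[K] K) := fun y => l.comp
      (LinearMap.pi (fun i => ((LinearMap.toSpanSingleton A Y y).restrictScalars K).comp
        (LinearMap.proj i)))
    have hw : ∀ y b, w y b = l (fun i => b i • y) := fun y b => rfl
    let φ : Y →ₗ[A] N :=
      { toFun := fun y => ⟨w y, fun β => by
          rw [hw]
          exact hl' ((LinearMap.toSpanSingleton A Y y).comp β)⟩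
        map_add' := fun y z => Subtype.ext (LinearMap.ext fun b => by
          show w (y + z) b = w y b + w z b
          rw [hw, hw, hw, ← map_add]
          simp only [smul_add]
          rfl)
        map_smul' := fun a y => Subtype.ext (LinearMap.ext fun b => by
          show w (a • y) b = w y (fun i => b i * a)
          rw [hw, hw]
          simp only [mul_smul]) }
    apply hl0
    refine LinearMap.pi_ext' fun i => LinearMap.ext fun y => ?_
    have h1 : w y (Pi.single i 1) = 0 := by
      have h2 : φ y = 0 := LinearMap.congr_fun (hφ φ) y
      have h3 : w y = 0 := congrArg Subtype.val h2
      rw [h3]; rfl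
    rw [hw] at h1
    show l (Pi.single i y) = 0
    rw [← h1]
    congr 1
    funext l
    by_cases hl : l = i
    · subst hl; simp
    · simp [Pi.single_eq_of_ne hl]
  refine ⟨ModuleCat.of A N, hNfin, ?_⟩
  funext X
  refine propext ⟨fun hX F hF h' => ?_, fun h => h _ perp_torf (by rintro Y rfl; exact hNF)⟩
  have hN' : F (ModuleCat.of A N) := h' _ rfl
  have main : ∀ d : ℕ, ∀ (Y : Type) [AddCommGroup Y] [Module A Y], rightPerp A T (ModuleCat.of A Y) →
      dm K (ModuleCat.of A Y) = d → F (ModuleCat.of A Y) := by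
    intro d
    induction d using Nat.strong_induction_on with
    | _ d ih =>
    intro Y _ _ hY hd
    haveI : Module.Finite A Y := perp_fin hY
    by_cases hφ : ∀ φ : Y →ₗ[A] N, φ = 0
    · haveI := hcog Y hY hφ
      exact hF.zero _ (fun x => Subsingleton.elim (α := Y) x 0)
    · push Not at hφ
      obtain ⟨φ, hφ⟩ := hφ
      refine hF.ext (ModuleCat.of A Y) ‹_› (LinearMap.ker φ) ?_ ?_
      · exact ih _ (hd ▸ dm_sub_lt K (fun h => hφ (LinearMap.ker_eq_top.1 h))) _
          (perp_sub hY _) rfl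
      · refine hF.sub (ModuleCat.of A N) (ModuleCat.of A (Y ⧸ LinearMap.ker φ)) hN' ?_
          ⟨(LinearMap.ker φ).liftQ φ le_rfl, ?_⟩
        · exact (inferInstance : Module.Finite A (Y ⧸ LinearMap.ker φ))
        · rw [← LinearMap.ker_eq_bot]
          exact Submodule.ker_liftQ_eq_bot _ _ _ le_rfl
  exact main _ X hX rfl

end Aux11

section Aux12
set_option linter.all false
set_option linter.unusedSectionVars false
set_option linter.style.haveILetI false
variable {A}
variable {K : Type} [Field K] [Algebra K A]
variable {B : Type} [Ring B] [Algebra K B]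
variable {X Y Z : Type} [AddCommGroup X] [Module A X] [AddCommGroup Y] [Module A Y]
  [AddCommGroup Z] [Module A Z]

/-- The `K`-dual of an `A`-module, for `B` isomorphic to the opposite algebra of `A`. -/
def Du (τ : B ≃ₐ[K] Aᵐᵒᵖ) (X : Type) [AddCommGroup X] [Module A X] : Type :=
  @LinearMap K K _ _ (RingHom.id K) X K _ _ (kmod K A X) _

noncomputable instance duGroup (τ : B ≃ₐ[K] Aᵐᵒᵖ) : AddCommGroup (Du τ X) :=
  @LinearMap.addCommGroup K K X K _ _ _ _ (kmod K A X) _ (RingHom.id K)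

/-- evaluation -/
noncomputable def Du.ev {τ : B ≃ₐ[K] Aᵐᵒᵖ} (w : Du τ X) (x : X) : K :=
  letI := kmod K A X
  (show X →ₗ[K] K from w) x

theorem Du.ext {τ : B ≃ₐ[K] Aᵐᵒᵖ} {v w : Du τ X} (h : ∀ x, v.ev x = w.ev x) : v = w := by
  letI := kmod K A X
  exact LinearMap.ext h

/-- constructor -/
noncomputable def Du.mk (τ : B ≃ₐ[K] Aᵐᵒᵖ) (w : X → K) (h1 : ∀ x y, w (x + y) = w x + w y)
    (h2 : ∀ (k : K) x, w (algebraMap K A k • x) = k * w x) : Du τ X :=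
  letI := kmod K A X
  ({ toFun := w, map_add' := h1, map_smul' := h2 } : X →ₗ[K] K)

theorem Du.ev_mk (τ : B ≃ₐ[K] Aᵐᵒᵖ) (w : X → K) (h1) (h2) (x : X) :
    (Du.mk (A := A) τ w h1 h2).ev x = w x := rfl

theorem Du.ev_add {τ : B ≃ₐ[K] Aᵐᵒᵖ} (w : Du τ X) (x y : X) :
    w.ev (x + y) = w.ev x + w.ev y := by
  letI := kmod K A X
  exact map_add (show X →ₗ[K] K from w) x y

theorem Du.ev_alg {τ : B ≃ₐ[K] Aᵐᵒᵖ} (w : Du τ X) (k : K) (x : X) :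
    w.ev (algebraMap K A k • x) = k * w.ev x := by
  letI := kmod K A X
  exact map_smul (show X →ₗ[K] K from w) k x

theorem Du.add_ev {τ : B ≃ₐ[K] Aᵐᵒᵖ} (v w : Du τ X) (x : X) :
    (v + w).ev x = v.ev x + w.ev x := rfl

theorem Du.zero_ev {τ : B ≃ₐ[K] Aᵐᵒᵖ} (x : X) : (0 : Du τ X).ev x = 0 := rfl

theorem Du.ev_zero {τ : B ≃ₐ[K] Aᵐᵒᵖ} (w : Du τ X) : w.ev 0 = 0 := by
  letI := kmod K A X
  exact map_zero (show X →ₗ[K] K from w)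

noncomputable instance duModule (τ : B ≃ₐ[K] Aᵐᵒᵖ) : Module B (Du τ X) where
  smul b w := Du.mk τ (fun x => w.ev ((τ b).unop • x)) (fun x y => by rw [smul_add, Du.ev_add])
    (fun k x => by
      rw [← Du.ev_alg, ← mul_smul, ← mul_smul, Algebra.commutes])
  one_smul w := Du.ext fun x => by
    show w.ev ((τ 1).unop • x) = w.ev x
    rw [map_one, MulOpposite.unop_one, one_smul]
  mul_smul a b w := Du.ext fun x => by
    show w.ev ((τ (a * b)).unop • x) = w.ev ((τ b).unop • (τ a).unop • x)
    rw [map_mul, MulOpposite.unop_mul, mul_smul]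
  smul_zero a := rfl
  smul_add a v w := rfl
  add_smul a b w := Du.ext fun x => by
    show w.ev ((τ (a + b)).unop • x) = w.ev ((τ a).unop • x) + w.ev ((τ b).unop • x)
    rw [map_add, MulOpposite.unop_add, add_smul, Du.ev_add]
  zero_smul w := Du.ext fun x => by
    show w.ev ((τ 0).unop • x) = 0
    rw [map_zero, MulOpposite.unop_zero, zero_smul, Du.ev_zero]

theorem Du.smul_ev {τ : B ≃ₐ[K] Aᵐᵒᵖ} (b : B) (w : Du τ X) (x : X) :
    (b • w).ev x = w.ev ((τ b).unop • x) := rfl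

/-- dual map -/
noncomputable def Du.map (τ : B ≃ₐ[K] Aᵐᵒᵖ) (f : X →ₗ[A] Y) : Du τ Y →ₗ[B] Du τ X where
  toFun w := Du.mk τ (fun x => w.ev (f x)) (fun x y => by rw [map_add, Du.ev_add])
    (fun k x => by rw [map_smul, Du.ev_alg])
  map_add' v w := rfl
  map_smul' b w := Du.ext fun x => by
    show w.ev ((τ b).unop • f x) = w.ev (f ((τ b).unop • x))
    rw [map_smul]

theorem Du.map_ev (τ : B ≃ₐ[K] Aᵐᵒᵖ) (f : X →ₗ[A] Y) (w : Du τ Y) (x : X) :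
    (Du.map τ f w).ev x = w.ev (f x) := rfl

theorem Du.map_inj (τ : B ≃ₐ[K] Aᵐᵒᵖ) (f : X →ₗ[A] Y) (hf : Function.Surjective f) :
    Function.Injective (Du.map τ f) := by
  intro v w h
  refine Du.ext fun y => ?_
  obtain ⟨x, rfl⟩ := hf y
  rw [← Du.map_ev τ f, h, Du.map_ev]

theorem Du.map_surj (τ : B ≃ₐ[K] Aᵐᵒᵖ) (f : X →ₗ[A] Y) (hf : Function.Injective f) :
    Function.Surjective (Du.map τ f) := by
  letI := kmod K A X
  haveI := kmod_tower K A X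
  letI := kmod K A Y
  haveI := kmod_tower K A Y
  intro w
  obtain ⟨v, hv⟩ := LinearMap.dualMap_surjective_of_injective (f := f.restrictScalars K) hf w
  exact ⟨v, hv⟩

theorem Du.map_exact (τ : B ≃ₐ[K] Aᵐᵒᵖ) (f : X →ₗ[A] Y) (g : Y →ₗ[A] Z)
    (hg : Function.Surjective g) (h : LinearMap.range f = LinearMap.ker g) :
    LinearMap.range (Du.map τ g) = LinearMap.ker (Du.map τ f) := by
  letI := kmod K A Z
  haveI := kmod_tower K A Z
  letI := kmod K A Y
  haveI := kmod_tower K A Y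
  ext w
  constructor
  · rintro ⟨v, rfl⟩
    refine Du.ext fun x => ?_
    have : g (f x) = 0 := by
      have : f x ∈ LinearMap.ker g := h ▸ ⟨x, rfl⟩
      exact this
    rw [Du.map_ev, Du.map_ev, this, Du.ev_zero, Du.zero_ev]
  · intro hw
    obtain ⟨v, hv⟩ := factor_surj (A := K) (g.restrictScalars K) hg w (by
      intro y hy
      have : y ∈ LinearMap.range f := h ▸ hy
      obtain ⟨x, rfl⟩ := this
      have hw' : Du.map τ f w = 0 := hw
      have h2 : (Du.map τ f w).ev x = 0 := by rw [hw']; rfl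
      exact h2)
    exact ⟨v, Du.ext hv⟩

theorem Du.dim (τ : B ≃ₐ[K] Aᵐᵒᵖ) [FiniteDimensional K A] [Module.Finite A X] :
    Module.Finite B (Du τ X) ∧ dm K (ModuleCat.of B (Du τ X)) = dm K (ModuleCat.of A X) := by
  haveI := IsNoetherianRing.of_finite K A
  haveI := IsArtinianRing.of_finite K A
  haveI : FiniteDimensional K B := Module.Finite.equiv τ.symm.toLinearEquiv
  haveI := IsNoetherianRing.of_finite K B
  haveI := IsArtinianRing.of_finite K B
  letI := kmod K A X
  haveI := kmod_tower K A X
  haveI : Module.Finite K X := kfin (A := A) K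
  letI i1 : Module K (Du τ X) := (inferInstance : Module K (X →ₗ[K] K))
  haveI : IsScalarTower K B (Du τ X) := by
    refine IsScalarTower.of_algebraMap_smul fun k w => Du.ext fun x => ?_
    rw [Du.smul_ev, AlgEquiv.commutes]
    exact Du.ev_alg w k x
  haveI : Module.Finite K (Du τ X) := (inferInstance : Module.Finite K (X →ₗ[K] K))
  refine ⟨Module.Finite.of_restrictScalars_finite K B _, ?_⟩
  rw [dm_eq, dm_eq]
  exact Subspace.dual_finrank_eq

theorem Du.double (τ : B ≃ₐ[K] Aᵐᵒᵖ) (τ' : A ≃ₐ[K] Bᵐᵒᵖ)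
    (hτ : ∀ a, (τ (τ' a).unop).unop = a) [FiniteDimensional K A] [FiniteDimensional K B]
    [Module.Finite A X] :
    Nonempty (X ≃ₗ[A] Du τ' (Du τ X)) := by
  haveI := IsNoetherianRing.of_finite K A
  haveI := IsArtinianRing.of_finite K A
  haveI := (Du.dim (X := X) τ).1
  haveI := (Du.dim (X := Du τ X) τ').1
  let e : X →ₗ[A] Du τ' (Du τ X) :=
    { toFun := fun x => Du.mk τ' (fun w => w.ev x) (fun v w => rfl) (fun k w => by
        rw [Du.smul_ev, AlgEquiv.commutes]
        exact Du.ev_alg w k x)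
      map_add' := fun x y => Du.ext fun w => Du.ev_add w x y
      map_smul' := fun a x => Du.ext fun w => by
        show w.ev (a • x) = w.ev ((τ (τ' a).unop).unop • x)
        rw [hτ] }
  have he : Function.Injective e := by
    rw [injective_iff_map_eq_zero]
    intro x hx
    letI := kmod K A X
    haveI := kmod_tower K A X
    refine (Module.forall_dual_apply_eq_zero_iff K x).1 fun w => ?_
    have : (e x).ev (w : Du τ X) = 0 := by rw [hx]; rfl
    exact this
  refine ⟨LinearEquiv.ofBijective e ⟨he, ?_⟩⟩
  rw [← LinearMap.range_eq_top]
  by_contra hne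
  have h1 := dm_sub_lt K hne
  rw [(Du.dim (X := Du τ X) τ').2, (Du.dim (X := X) τ).2,
    ← dm_equiv K (LinearEquiv.ofInjective e he)] at h1
  exact lt_irrefl _ h1

/-- the dual stability function -/
noncomputable def duTheta (τ' : A ≃ₐ[K] Bᵐᵒᵖ) (θ : ModuleCat.{0} A → ℝ) : ModuleCat.{0} B → ℝ :=
  fun Y => - θ (ModuleCat.of A (Du τ' Y))

theorem duTheta_stab (τ' : A ≃ₐ[K] Bᵐᵒᵖ) [FiniteDimensional K B] {θ : ModuleCat.{0} A → ℝ}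
    (hθ : IsStability A θ) : IsStability B (duTheta τ' θ) := by
  intro L M N hL hM hN f g hf hg hfg
  have := hθ (ModuleCat.of A (Du τ' N)) (ModuleCat.of A (Du τ' M)) (ModuleCat.of A (Du τ' L))
    (Du.dim τ').1 (Du.dim τ').1 (Du.dim τ').1 (Du.map τ' g) (Du.map τ' f) (Du.map_inj τ' g hg)
    (Du.map_surj τ' f hf) (Du.map_exact τ' f g hg hfg)
  unfold duTheta
  linarith

theorem du_fTheta (τ : B ≃ₐ[K] Aᵐᵒᵖ) (τ' : A ≃ₐ[K] Bᵐᵒᵖ)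
    (hτ : ∀ a, (τ (τ' a).unop).unop = a) [FiniteDimensional K A] [FiniteDimensional K B]
    {θ : ModuleCat.{0} A → ℝ} {η : ModuleCat.{0} B → ℝ}
    (h : ∀ (L : Type) [AddCommGroup L] [Module B L] [Module.Finite B L],
      η (ModuleCat.of B L) = - θ (ModuleCat.of A (Du τ' L)))
    (hX : tTheta A θ (ModuleCat.of A X)) : fTheta B η (ModuleCat.of B (Du τ X)) := by
  haveI : Module.Finite A X := hX.1
  haveI := IsNoetherianRing.of_finite K A
  haveI := IsArtinianRing.of_finite K A
  haveI := IsNoetherianRing.of_finite K B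
  haveI := IsArtinianRing.of_finite K B
  refine ⟨(Du.dim τ).1, ?_⟩
  rintro L hL ⟨f, hf⟩ ⟨x, hx⟩
  rw [show η L = _ from h L, neg_lt_zero]
  obtain ⟨e⟩ := Du.double (X := X) τ τ' hτ
  refine hX.2 _ (Du.dim (X := L) τ').1 ⟨(Du.map (X := L) (Y := Du τ X) τ' f).comp e.toLinearMap, ?_⟩ ?_
  · exact (Du.map_surj τ' f hf).comp e.surjective
  · haveI : Nontrivial L := ⟨x, 0, hx⟩
    have h1 := dm_pos (A := B) (X := L) K
    by_contra hne
    haveI := not_nonzero (X := Du τ' L) hne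
    have h2 := dm_zero (A := A) (X := Du τ' L) K
    rw [(Du.dim (X := L) τ').2] at h2
    omega

theorem du_margin (τ : B ≃ₐ[K] Aᵐᵒᵖ) (τ' : A ≃ₐ[K] Bᵐᵒᵖ)
    (hτ : ∀ a, (τ (τ' a).unop).unop = a) [FiniteDimensional K A] [FiniteDimensional K B]
    {θ : ModuleCat.{0} A → ℝ} {η : ModuleCat.{0} B → ℝ} (hη : IsStability B η)
    (h : ∀ (L : Type) [AddCommGroup L] [Module B L] [Module.Finite B L],
      η (ModuleCat.of B L) = - θ (ModuleCat.of A (Du τ' L)))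
    (h' : ∀ (L : Type) [AddCommGroup L] [Module A L] [Module.Finite A L],
      θ (ModuleCat.of A L) = - η (ModuleCat.of B (Du τ L)))
    (hm : MarginF K η) : MarginT K θ := by
  haveI := IsNoetherianRing.of_finite K B
  haveI := IsArtinianRing.of_finite K B
  obtain ⟨c, hc, hm⟩ := hm
  refine ⟨c, hc, fun X hX => ?_⟩
  haveI : Module.Finite A X := hX.1
  have h1 := hm _ (fTheta_perp hη (du_fTheta (X := X) τ τ' hτ h hX))
  rw [(Du.dim (X := X) τ).2] at h1
  have h2 : θ X = _ := h' X
  rw [h2]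
  have h3 : dm K (ModuleCat.of A X) = dm K X := rfl
  rw [h3] at h1
  linarith

theorem margin_bar [FiniteDimensional K A] {θ : ModuleCat.{0} A → ℝ} (hθ : IsStability A θ)
    (hm : MarginT K θ) : FunctoriallyFinite A (tThetaBar A θ) := by
  haveI := IsNoetherianRing.of_finite K A
  haveI := IsArtinianRing.of_finite K A
  obtain ⟨P, _, _, Q, _, _, f, hp⟩ := pkg_theta K hθ hm
  exact core1 hθ hp K

theorem marginF_T [FiniteDimensional K A] {θ : ModuleCat.{0} A → ℝ} (hθ : IsStability A θ)
    (hm : MarginF K θ) : MarginT K θ := by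
  haveI := IsNoetherianRing.of_finite K A
  haveI := IsArtinianRing.of_finite K A
  haveI : FiniteDimensional K Aᵐᵒᵖ := inferInstance
  haveI := IsNoetherianRing.of_finite K Aᵐᵒᵖ
  haveI := IsArtinianRing.of_finite K Aᵐᵒᵖ
  let τ : Aᵐᵒᵖ ≃ₐ[K] Aᵐᵒᵖ := AlgEquiv.refl
  let τ' : A ≃ₐ[K] Aᵐᵒᵖᵐᵒᵖ := AlgEquiv.opOp K A
  have hτ : ∀ a, (τ (τ' a).unop).unop = a := fun a => rfl
  have hτ' : ∀ b, (τ' (τ b).unop).unop = b := fun b => rfl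
  have hη := duTheta_stab τ' hθ
  have h1 : ∀ (L : Type) [AddCommGroup L] [Module Aᵐᵒᵖ L] [Module.Finite Aᵐᵒᵖ L],
      duTheta τ' θ (ModuleCat.of Aᵐᵒᵖ L) = - θ (ModuleCat.of A (Du τ' L)) := fun L _ _ _ => rfl
  have h2 : ∀ (L : Type) [AddCommGroup L] [Module A L] [Module.Finite A L],
      θ (ModuleCat.of A L) = - duTheta τ' θ (ModuleCat.of Aᵐᵒᵖ (Du τ L)) := by
    intro L _ _ _
    obtain ⟨e⟩ := Du.double (X := L) τ τ' hτ
    show _ = - - _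
    rw [neg_neg]
    exact th_equiv hθ e
  have m1 : MarginT K (duTheta τ' θ) := du_margin τ' τ hτ' hθ h2 h1 hm
  have m2 := margin_bar hη m1
  have m3 := cocompact_of_lapp (tThetaBar_tors hη) (lapp_of_ff m2) K
  exact du_margin τ τ' hτ hη h1 h2 (cocompact_margin K hη m3)

end Aux12

/-- For a stability function `θ`, the following are equivalent:
(i) `T_θ` is compact; (ii) `T_θ` is bicompact; (iii) `T_θ` is functorially finite;
(iv) `\bar T_θ` is cocompact; (v) `\bar T_θ` is bicompact;
(vi) `\bar T_θ` is functorially finite. -/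
theorem stmt2 (K : Type) [Field K] [Algebra K A] [FiniteDimensional K A]
    (θ : ModuleCat.{0} A → ℝ) (hθ : IsStability A θ) :
    List.TFAE [IsCompactTors A (tTheta A θ),
      IsBicompactTors A (tTheta A θ),
      FunctoriallyFinite A (tTheta A θ),
      IsCocompactTors A (tThetaBar A θ),
      IsBicompactTors A (tThetaBar A θ),
      FunctoriallyFinite A (tThetaBar A θ)] := by
  haveI := IsNoetherianRing.of_finite K A
  haveI := IsArtinianRing.of_finite K A
  have hT := tTheta_tors hθ
  have hB := tThetaBar_tors hθ
  have tb : MarginT K θ → FunctoriallyFinite A (tTheta A θ) := fun h => by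
    obtain ⟨P, _, _, Q, _, _, f, hp⟩ := pkg_theta K hθ h
    exact ff_of_pkg hT hp K
  tfae_have 1 → 6 := fun h => margin_bar hθ (compact_margin K hθ h)
  tfae_have 6 → 5 := fun h => ⟨compact_of_lapp hB (lapp_of_ff h), cocompact_of_lapp hB (lapp_of_ff h) K⟩
  tfae_have 5 → 4 := fun h => h.2
  tfae_have 4 → 3 := fun h => tb (marginF_T hθ (cocompact_margin K hθ h))
  tfae_have 3 → 2 := fun h => ⟨compact_of_lapp hT (lapp_of_ff h), cocompact_of_lapp hT (lapp_of_ff h) K⟩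
  tfae_have 2 → 1 := fun h => h.1
  tfae_finish
end TorsPaper
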